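/- Through a general point of the 4-th secant variety of the Segre product of 5 copies of ℙ¹ there pass exactly two 5-secant 4-spaces; concretely: there exists a nonzero polynomial P on the parameter space ((ℂ²)^5)^5 such that for every parameter v = (v_{i,j}) with P(v) ≠ 0, the set of decompositions of length 5 of the tensor T(v) = Σ_{i=0}^{4} v_{i,0} ⊗ ⋯ ⊗ v_{i,4} ∈ ⨂^5 ℂ² (i.e. the set of multisets of 5 nonzero decomposable tensors summing to T(v)) has exactly two elements. -/

import Mathlib

open scoped TensorProduct

/-- The `m`-fold tensor product of `ℂ²`, the affine cone over the Segre embedding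
of `(ℙ¹)^m`. -/
abbrev BinTensor (m : ℕ) := ⨂[ℂ] _ : Fin m, (Fin 2 → ℂ)

/-- A tensor is decomposable if it is a pure tensor `w 0 ⊗ ⋯ ⊗ w (m-1)`. -/
def Decomposable {m : ℕ} (t : BinTensor m) : Prop :=
  ∃ w : Fin m → Fin 2 → ℂ, t = ⨂ₜ[ℂ] j, w j

/-- A decomposition of length `n` of a tensor `T` is a multiset of `n` nonzero
decomposable tensors whose sum is `T`. -/
def IsDecomposition {m : ℕ} (n : ℕ) (T : BinTensor m) (D : Multiset (BinTensor m)) : Prop :=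
  Multiset.card D = n ∧ (∀ t ∈ D, t ≠ 0 ∧ Decomposable t) ∧ D.sum = T

namespace BinarySegre

open Polynomial

/-- The multilinear form with coefficient array `g`, evaluated at the vectors `e`. -/
def multiEval {R S : Type*} [CommSemiring R] [CommSemiring S] [Algebra R S]
    (g : (Fin 5 → Fin 2) → R) (e : Fin 5 → Fin 2 → S) : S :=
  ∑ α, algebraMap R S (g α) * ∏ j, e j (α j)

theorem map_multiEval {R S T : Type*} [CommSemiring R] [CommSemiring S] [CommSemiring T]
    [Algebra R S] [Algebra R T] (φ : S →ₐ[R] T) (g : (Fin 5 → Fin 2) → R)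
    (e : Fin 5 → Fin 2 → S) :
    φ (multiEval g e) = multiEval g (fun j a => φ (e j a)) := by
  simp [multiEval, map_sum, map_prod]

/-- The coordinate ring of the affine curve `y² = q(x)`. -/
abbrev CurveRing {R : Type*} [CommRing R] (q : R[X]) := QuadraticAlgebra R[X] q 0

section Param
variable {R : Type*} [CommRing R] (A B : Fin 4 → R[X]) (q : R[X])

/-- The parametrisation `(1, x) ⊗ ⨂ⱼ (2 Aⱼ(x), y - Bⱼ(x))` of the curve in the Segre variety. -/
noncomputable def curveVec : Fin 5 → Fin 2 → CurveRing q :=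
  Fin.cons ![1, ⟨X, 0⟩] (fun j => ![⟨2 * A j, 0⟩, ⟨-B j, 1⟩])

/-- The pullback to the curve of a multilinear form. -/
noncomputable def pull : ((Fin 5 → Fin 2) → R) →ₗ[R] CurveRing q where
  toFun g := multiEval g (curveVec A B q)
  map_add' g h := by simp [multiEval, add_mul, Finset.sum_add_distrib]
  map_smul' c g := by
    simp [multiEval, mul_assoc, Finset.mul_sum, Algebra.smul_def]

theorem pull_apply (g : (Fin 5 → Fin 2) → R) :
    pull A B q g = multiEval g (curveVec A B q) := rfl

/-- Evaluation of a function on the curve at `(x, y)`. -/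
noncomputable def evalPt (s : R × R) : CurveRing q →ₗ[R] R where
  toFun f := f.re.eval s.1 + f.im.eval s.1 * s.2
  map_add' f g := by simp; ring
  map_smul' c f := by simp [Polynomial.smul_eq_C_mul]; ring

theorem evalPt_apply (s : R × R) (f : CurveRing q) :
    evalPt q s f = f.re.eval s.1 + f.im.eval s.1 * s.2 := rfl

/-- Evaluation at a point of the curve, as an algebra map. -/
noncomputable def evalPtHom (s : R × R) (hs : s.2 ^ 2 = q.eval s.1) : CurveRing q →ₐ[R] R :=
  AlgHom.ofLinearMap (evalPt q s) (by
      simp [evalPt_apply, QuadraticAlgebra.re_one, QuadraticAlgebra.im_one])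
    (by
      intro f g
      simp only [evalPt_apply, QuadraticAlgebra.re_mul, QuadraticAlgebra.im_mul, eval_add, eval_mul,
        ← hs, zero_mul]
      simp
      ring)

theorem evalPtHom_apply (s : R × R) (hs : s.2 ^ 2 = q.eval s.1) (f : CurveRing q) :
    evalPtHom q s hs f = evalPt q s f := rfl

/-- The derivative of a function on the curve along the vector field `2y ∂ₓ + q'(x) ∂_y`. -/
noncomputable def derivPt (s : R × R) : CurveRing q →ₗ[R] R where
  toFun f := 2 * s.2 * (f.re.derivative.eval s.1 + f.im.derivative.eval s.1 * s.2)
    + q.derivative.eval s.1 * f.im.eval s.1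
  map_add' f g := by simp; ring
  map_smul' c f := by simp [Polynomial.smul_eq_C_mul]; ring

theorem derivPt_apply (s : R × R) (f : CurveRing q) :
    derivPt q s f = 2 * s.2 * (f.re.derivative.eval s.1 + f.im.derivative.eval s.1 * s.2)
    + q.derivative.eval s.1 * f.im.eval s.1 := rfl

theorem evalPt_pull (s : R × R) (hs : s.2 ^ 2 = q.eval s.1) (g : (Fin 5 → Fin 2) → R) :
    evalPt q s (pull A B q g) = multiEval g (fun j a => evalPt q s (curveVec A B q j a)) := by
  rw [← evalPtHom_apply q s hs, pull_apply, map_multiEval]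
  rfl

end Param

section Divisibility
variable {K : Type*} [Field K] {A B : Fin 4 → K[X]} {q : K[X]}

theorem natDegree_mul_curve {m n : ℕ} (hq : q.natDegree ≤ 4) {f g : CurveRing q}
    (hf : f.re.natDegree ≤ m + 2 ∧ f.im.natDegree ≤ m)
    (hg : g.re.natDegree ≤ n + 2 ∧ g.im.natDegree ≤ n) :
    (f * g).re.natDegree ≤ (m + n + 2) + 2 ∧ (f * g).im.natDegree ≤ m + n + 2 := by
  simp only [QuadraticAlgebra.re_mul, QuadraticAlgebra.im_mul, zero_mul, add_zero]
  constructor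
  · refine natDegree_add_le_of_degree_le ?_ ?_
    · exact natDegree_mul_le.trans (by omega)
    · refine natDegree_mul_le.trans ?_
      have := natDegree_mul_le (p := q) (q := f.im)
      omega
  · refine natDegree_add_le_of_degree_le ?_ ?_
    · exact natDegree_mul_le.trans (by omega)
    · exact natDegree_mul_le.trans (by omega)

theorem natDegree_pull (hq : q.natDegree ≤ 4) (hA : ∀ j, (A j).natDegree ≤ 2)
    (hB : ∀ j, (B j).natDegree ≤ 2) (g : (Fin 5 → Fin 2) → K) :
    (pull A B q g).re.natDegree ≤ 9 ∧ (pull A B q g).im.natDegree ≤ 7 := by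
  have hE : ∀ (j : Fin 4) (a : Fin 2), (curveVec A B q j.succ a).re.natDegree ≤ 0 + 2 ∧
      (curveVec A B q j.succ a).im.natDegree ≤ 0 := by
    intro j a
    fin_cases a
    · simp only [curveVec, Fin.cons_succ]
      simp
      refine natDegree_mul_le.trans ?_
      have : (2 : K[X]).natDegree = 0 := natDegree_ofNat 2
      have := hA j
      omega
    · simp only [curveVec, Fin.cons_succ]
      simpa using hB j
  have hmono : ∀ α : Fin 5 → Fin 2, (∏ j, curveVec A B q j (α j)).re.natDegree ≤ 9 ∧
      (∏ j, curveVec A B q j (α j)).im.natDegree ≤ 7 := by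
    intro α
    rw [Fin.prod_univ_succ, Fin.prod_univ_four]
    have h1 := natDegree_mul_curve hq (natDegree_mul_curve hq (natDegree_mul_curve hq
      (hE 0 (α (Fin.succ 0))) (hE 1 (α (Fin.succ 1)))) (hE 2 (α (Fin.succ 2))))
      (hE 3 (α (Fin.succ 3)))
    set f := curveVec A B q (Fin.succ 0) (α (Fin.succ 0)) *
      curveVec A B q (Fin.succ 1) (α (Fin.succ 1)) *
      curveVec A B q (Fin.succ 2) (α (Fin.succ 2)) * curveVec A B q (Fin.succ 3) (α (Fin.succ 3))
    have h0 : ∀ a, (curveVec A B q 0 a).im = 0 ∧ (curveVec A B q 0 a).re.natDegree ≤ 1 := by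
      intro a
      fin_cases a
      · simp [curveVec, QuadraticAlgebra.re_one, QuadraticAlgebra.im_one]
      · simp [curveVec]
    obtain ⟨h0i, h0r⟩ := h0 (α 0)
    simp only [QuadraticAlgebra.re_mul, QuadraticAlgebra.im_mul, h0i, mul_zero, zero_mul, add_zero]
    exact ⟨natDegree_mul_le.trans (by omega), natDegree_mul_le.trans (by omega)⟩
  have hs : ∀ f : (Fin 5 → Fin 2) → CurveRing q,
      (∑ α, f α).re = ∑ α, (f α).re ∧ (∑ α, f α).im = ∑ α, (f α).im := fun f =>
    ⟨by have := map_sum (QuadraticAlgebra.reₗ q 0) f Finset.univ; exact this,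
      by have := map_sum (QuadraticAlgebra.imₗ q 0) f Finset.univ; exact this⟩
  have hre : (pull A B q g).re = ∑ α, C (g α) * (∏ j, curveVec A B q j (α j)).re := by
    rw [pull_apply, multiEval, (hs _).1]
    simp only [← Algebra.smul_def, QuadraticAlgebra.re_smul, smul_eq_C_mul]
  have him : (pull A B q g).im = ∑ α, C (g α) * (∏ j, curveVec A B q j (α j)).im := by
    rw [pull_apply, multiEval, (hs _).2]
    simp only [← Algebra.smul_def, QuadraticAlgebra.im_smul, smul_eq_C_mul]
  rw [hre, him]
  exact ⟨natDegree_sum_le_of_forall_le _ _ fun α _ => (natDegree_C_mul_le _ _).trans (hmono α).1,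
    natDegree_sum_le_of_forall_le _ _ fun α _ => (natDegree_C_mul_le _ _).trans (hmono α).2⟩

theorem prod_dvd_pull_mul_star (hAB : ∀ j, A j ∣ B j ^ 2 - q) (g h : (Fin 5 → Fin 2) → K) :
    algebraMap K[X] (CurveRing q) (∏ j, A j) ∣ pull A B q g * star (pull A B q h) := by
  have key : ∀ (j : Fin 4) (a b : Fin 2), algebraMap K[X] (CurveRing q) (A j) ∣
      curveVec A B q j.succ a * star (curveVec A B q j.succ b) := by
    intro j a b
    obtain ⟨c, hc⟩ := hAB j
    have h0 : curveVec A B q j.succ 0 = ⟨2 * A j, 0⟩ := rfl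
    have h1 : curveVec A B q j.succ 1 = ⟨-B j, 1⟩ := rfl
    have hz : algebraMap K[X] (CurveRing q) (A j) ∣ ⟨2 * A j, 0⟩ :=
      ⟨⟨2, 0⟩, by ext <;> simp [QuadraticAlgebra.algebraMap_eq, mul_comm]⟩
    have hz' : algebraMap K[X] (CurveRing q) (A j) ∣ star ⟨2 * A j, 0⟩ := by
      simpa using hz
    fin_cases a
    · exact Dvd.dvd.mul_right hz _
    · fin_cases b
      · exact Dvd.dvd.mul_left hz' _
      · refine ⟨⟨c, 0⟩, ?_⟩
        change curveVec A B q j.succ 1 * star (curveVec A B q j.succ 1) = _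
        rw [h1]
        ext
        · simp only [QuadraticAlgebra.algebraMap_eq, QuadraticAlgebra.re_mul, zero_mul, mul_zero,
            add_zero, QuadraticAlgebra.star_mk, ← hc]
          ring_nf
        · simp [QuadraticAlgebra.algebraMap_eq]
  have hst : ∀ c : K, star (algebraMap K (CurveRing q) c) = algebraMap K (CurveRing q) c := by
    intro c
    change star (⟨C c, 0⟩ : CurveRing q) = ⟨C c, 0⟩
    simp
  simp only [pull_apply, multiEval, star_sum, Finset.sum_mul, Finset.mul_sum, star_mul', hst]
  refine Finset.dvd_sum fun α _ => Finset.dvd_sum fun β _ => ?_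
  have hp : star (∏ j, curveVec A B q j (α j)) = ∏ j, star (curveVec A B q j (α j)) :=
    map_prod (starRingEnd (CurveRing q)) _ _
  rw [hp, mul_mul_mul_comm, ← Finset.prod_mul_distrib]
  refine Dvd.dvd.mul_left ?_ _
  rw [map_prod, Fin.prod_univ_succ (n := 4)]
  exact Dvd.dvd.mul_left (Finset.prod_dvd_prod_of_dvd _ _ fun j _ => key j _ _) _

end Divisibility

section Vanishing
variable {K : Type*} [Field K] {A B : Fin 4 → K[X]} {q : K[X]}

theorem re_mul_star (f g : CurveRing q) :
    (f * star g).re = f.re * g.re - f.im * g.im * q := by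
  simp only [QuadraticAlgebra.re_mul, QuadraticAlgebra.re_star, QuadraticAlgebra.im_star]
  ring

theorem im_mul_star (f g : CurveRing q) :
    (f * star g).im = f.im * g.re - f.re * g.im := by
  simp only [QuadraticAlgebra.im_mul, QuadraticAlgebra.re_star, QuadraticAlgebra.im_star]
  ring

/-- The norm of `f` divided by its square part: `f · f̄` as a polynomial. -/
noncomputable def nm {R : Type*} [CommRing R] {q : R[X]} (f : CurveRing q) : R[X] :=
  f.re ^ 2 - f.im ^ 2 * q

theorem nm_eq (f : CurveRing q) : nm f = (f * star f).re := by
  rw [re_mul_star, nm]; ring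

theorem nodal_dvd [DecidableEq K] {S : Finset (K × K)} (hS : ∀ s ∈ S, s.2 ^ 2 = q.eval s.1)
    {f g : CurveRing q} (hf : ∀ s ∈ S, evalPt q s f = 0) (hg : ∀ s ∈ S, evalPt q s g = 0) :
    ∏ s ∈ S, (X - C s.1) ∣ (f * star g).re ∧ ∏ s ∈ S, (X - C s.1) ∣ (f * star g).im := by
  have hprod : ∏ s ∈ S, (X - C s.1) =
      ∏ x ∈ S.image Prod.fst, (X - C x) ^ (S.filter (fun s => s.1 = x)).card :=
    Finset.prod_comp (fun x : K => (X - C x)) Prod.fst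
  have main : ∀ x ∈ S.image Prod.fst,
      (X - C x) ^ (S.filter (fun s => s.1 = x)).card ∣ (f * star g).re ∧
      (X - C x) ^ (S.filter (fun s => s.1 = x)).card ∣ (f * star g).im := by
    intro x hx
    rw [re_mul_star, im_mul_star]
    obtain ⟨⟨x', y⟩, hs, rfl⟩ := Finset.mem_image.1 hx
    simp only
    by_cases hone : (S.filter (fun s => s.1 = x')).card ≤ 1
    · have h0 := hS _ hs
      have h1 := hf _ hs
      have h2 := hg _ hs
      simp only [evalPt_apply] at h0 h1 h2
      have e1 : f.re.eval x' = - (f.im.eval x' * y) := by linear_combination h1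
      have e2 : g.re.eval x' = - (g.im.eval x' * y) := by linear_combination h2
      refine ⟨(pow_dvd_pow _ hone).trans ?_, (pow_dvd_pow _ hone).trans ?_⟩
      · rw [pow_one, dvd_iff_isRoot, IsRoot]
        simp only [eval_sub, eval_mul, e1, e2, ← h0]
        ring
      · rw [pow_one, dvd_iff_isRoot, IsRoot]
        simp only [eval_sub, eval_mul, e1, e2]
        ring
    · push Not at hone
      have htwo : (S.filter (fun s => s.1 = x')).card ≤ 2 := by
        refine (Finset.card_le_card (t := {(x', y), (x', -y)}) ?_).trans Finset.card_le_two
        rintro ⟨x2, y2⟩ ht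
        obtain ⟨ht', hx'⟩ := Finset.mem_filter.1 ht
        simp only at hx'
        subst hx'
        have h0 := hS _ hs
        have h0' := hS _ ht'
        simp only at h0 h0'
        rcases sq_eq_sq_iff_eq_or_eq_neg.1 (h0'.trans h0.symm) with h | h <;> simp [h]
      obtain ⟨⟨xa, ya⟩, hta, ⟨xb, yb⟩, htb, hne⟩ := Finset.one_lt_card.1 hone
      obtain ⟨hta', ha⟩ := Finset.mem_filter.1 hta
      obtain ⟨htb', hb⟩ := Finset.mem_filter.1 htb
      simp only at ha hb
      clear hta htb
      subst ha
      subst hb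
      have hy : ya ≠ yb := fun h => hne (by rw [h])
      have van : ∀ u : CurveRing q, (∀ s ∈ S, evalPt q s u = 0) →
          (X - C xb) ∣ u.re ∧ (X - C xb) ∣ u.im := by
        intro u hu
        have h1 := hu _ hta'
        have h2 := hu _ htb'
        simp only [evalPt_apply] at h1 h2
        have h3 : u.im.eval xb = 0 := by
          have : u.im.eval xb * (ya - yb) = 0 := by linear_combination h1 - h2
          exact (mul_eq_zero.1 this).resolve_right (sub_ne_zero.2 hy)
        have h4 : u.re.eval xb = 0 := by rw [h3] at h1; simpa using h1
        exact ⟨dvd_iff_isRoot.2 h4, dvd_iff_isRoot.2 h3⟩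
      obtain ⟨f1, f2⟩ := van f hf
      obtain ⟨g1, g2⟩ := van g hg
      refine ⟨(pow_dvd_pow _ htwo).trans ?_, (pow_dvd_pow _ htwo).trans ?_⟩
      · rw [pow_two]
        exact dvd_sub (mul_dvd_mul f1 g1) (Dvd.dvd.mul_right (mul_dvd_mul f2 g2) _)
      · rw [pow_two]
        exact dvd_sub (mul_dvd_mul f2 g1) (mul_dvd_mul f1 g2)
  rw [hprod]
  have hcop : ((S.image Prod.fst : Finset K) : Set K).Pairwise (Function.onFun IsCoprime
      (fun x : K => (X - C x) ^ (S.filter (fun s => s.1 = x)).card)) := by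
    intro x _ x' _ hxx
    exact (isCoprime_X_sub_C_of_isUnit_sub (sub_ne_zero.2 hxx).isUnit).pow
  exact ⟨Finset.prod_dvd_of_coprime hcop fun x hx => (main x hx).1,
    Finset.prod_dvd_of_coprime hcop fun x hx => (main x hx).2⟩

/-- The points of the affine curve at which the parametrisation `curveVec` does not degenerate. -/
def IsGood (A : Fin 4 → K[X]) (q : K[X]) (s : K × K) : Prop :=
  s.2 ^ 2 = q.eval s.1 ∧ ∀ j, (A j).eval s.1 ≠ 0

/-- The standing assumptions on the polynomials defining the curve and its parametrisation. -/
structure Admissible (A B : Fin 4 → K[X]) (q : K[X]) : Prop where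
  dvd : ∀ j, A j ∣ B j ^ 2 - q
  degA : ∀ j, (A j).natDegree = 2
  degB : ∀ j, (B j).natDegree ≤ 2
  degq : q.natDegree = 4
  sqf : Squarefree q

theorem coprime_nodal {S : Finset (K × K)} (hS : ∀ s ∈ S, IsGood A q s) :
    IsCoprime (∏ j, A j) (∏ s ∈ S, (X - C s.1)) := by
  refine IsCoprime.prod_left fun j _ => IsCoprime.prod_right fun s hs => ?_
  refine (((irreducible_X_sub_C s.1).coprime_iff_not_dvd).2 fun h => ?_).symm
  exact (hS s hs).2 j (dvd_iff_isRoot.1 h)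

/-- `∏ Aⱼ · ∏ (x - xₛ)` divides both components of `g h̄` when `g` and `h` vanish on `S`. -/
theorem full_dvd (hA : Admissible A B q) {S : Finset (K × K)} (hS : ∀ s ∈ S, IsGood A q s)
    {g h : (Fin 5 → Fin 2) → K} (hg : ∀ s ∈ S, evalPt q s (pull A B q g) = 0)
    (hh : ∀ s ∈ S, evalPt q s (pull A B q h) = 0) :
    (∏ j, A j) * ∏ s ∈ S, (X - C s.1) ∣ (pull A B q g * star (pull A B q h)).re ∧
    (∏ j, A j) * ∏ s ∈ S, (X - C s.1) ∣ (pull A B q g * star (pull A B q h)).im := by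
  classical
  obtain ⟨k, hk⟩ := prod_dvd_pull_mul_star (q := q) hA.dvd g h
  have hn := nodal_dvd (fun s hs => (hS s hs).1) hg hh
  have h1 : (∏ j, A j) ∣ (pull A B q g * star (pull A B q h)).re :=
    ⟨k.re, by rw [hk, QuadraticAlgebra.algebraMap_eq, QuadraticAlgebra.re_mul]; simp⟩
  have h2 : (∏ j, A j) ∣ (pull A B q g * star (pull A B q h)).im :=
    ⟨k.im, by rw [hk, QuadraticAlgebra.algebraMap_eq, QuadraticAlgebra.im_mul]; simp⟩
  exact ⟨(coprime_nodal hS).mul_dvd h1 hn.1, (coprime_nodal hS).mul_dvd h2 hn.2⟩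

theorem Admissible.ne_zero (hA : Admissible A B q) (j : Fin 4) : A j ≠ 0 := by
  intro h; have := hA.degA j; simp [h] at this

theorem natDegree_full (hA : Admissible A B q) (S : Finset (K × K)) :
    ((∏ j, A j) * ∏ s ∈ S, (X - C s.1)).natDegree = 8 + S.card := by
  rw [natDegree_mul, natDegree_prod, natDegree_prod]
  · simp [hA.degA]
  · exact fun s _ => X_sub_C_ne_zero _
  · exact fun j _ => hA.ne_zero j
  · exact Finset.prod_ne_zero_iff.2 fun j _ => hA.ne_zero j
  · exact Finset.prod_ne_zero_iff.2 fun s _ => X_sub_C_ne_zero _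

theorem natDegree_mul_star (hA : Admissible A B q) (g h : (Fin 5 → Fin 2) → K) :
    (pull A B q g * star (pull A B q h)).re.natDegree ≤ 18 ∧
    (pull A B q g * star (pull A B q h)).im.natDegree ≤ 16 := by
  obtain ⟨g0, g1⟩ := natDegree_pull hA.degq.le (fun j => (hA.degA j).le) hA.degB g
  obtain ⟨h0, h1⟩ := natDegree_pull hA.degq.le (fun j => (hA.degA j).le) hA.degB h
  have hq := hA.degq
  rw [re_mul_star, im_mul_star]
  constructor
  · refine (natDegree_sub_le _ _).trans (max_le (natDegree_mul_le.trans (by omega)) ?_)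
    refine natDegree_mul_le.trans ?_
    have := natDegree_mul_le (p := (pull A B q g).im) (q := (pull A B q h).im)
    omega
  · exact (natDegree_sub_le _ _).trans (max_le (natDegree_mul_le.trans (by omega))
      (natDegree_mul_le.trans (by omega)))

theorem nm_eq_zero (hA : Admissible A B q) {f : CurveRing q} (hf : nm f = 0) : f = 0 := by
  have hq0 : q ≠ 0 := by
    intro h; have := hA.degq; simp [h] at this
  have hqu : ¬ IsUnit q := fun h => by
    have := natDegree_eq_zero_of_isUnit h; rw [hA.degq] at this; omega
  obtain ⟨π, hπ, hd⟩ := WfDvdMonoid.exists_irreducible_factor hqu hq0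
  have hpr := hπ.prime
  have him : f.im = 0 := by
    by_contra him
    have hre : f.re ≠ 0 := by
      intro h
      have : f.im ^ 2 * q = 0 := by
        have := hf; rw [nm, h] at this; simpa using this
      simp [him, hq0] at this
    have heq : f.re ^ 2 = f.im ^ 2 * q := sub_eq_zero.1 hf
    have e1 := congrArg (emultiplicity π) heq
    rw [emultiplicity_pow hpr, emultiplicity_mul hpr, emultiplicity_pow hpr] at e1
    have fin1 : FiniteMultiplicity π f.re := FiniteMultiplicity.of_prime_left hpr hre
    have fin2 : FiniteMultiplicity π f.im := FiniteMultiplicity.of_prime_left hpr him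
    have hq1 : emultiplicity π q = 1 := by
      refine le_antisymm ?_ ?_
      · exact ((squarefree_iff_emultiplicity_le_one q).1 hA.sqf π).resolve_right hπ.not_isUnit
      · exact le_emultiplicity_of_pow_dvd (k := 1) (by simpa using hd)
    rw [hq1, fin1.emultiplicity_eq_multiplicity, fin2.emultiplicity_eq_multiplicity] at e1
    norm_cast at e1
    omega
  have hre : f.re = 0 := by
    have := hf
    rw [nm, him] at this
    simpa using this
  ext <;> simp [him, hre]

/-- Two sections vanishing at nine common points are proportional. -/
theorem proportional (hA : Admissible A B q) {S : Finset (K × K)} (hS : ∀ s ∈ S, IsGood A q s)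
    (hc : 9 ≤ S.card) {g h : (Fin 5 → Fin 2) → K}
    (hg : ∀ s ∈ S, evalPt q s (pull A B q g) = 0)
    (hh : ∀ s ∈ S, evalPt q s (pull A B q h) = 0) (h0 : pull A B q h ≠ 0) :
    ∃ κ : K, pull A B q g = κ • pull A B q h := by
  set U := (∏ j, A j) * ∏ s ∈ S, (X - C s.1) with hU
  have hdU : U.natDegree = 8 + S.card := natDegree_full hA S
  have hU0 : U ≠ 0 := by intro h; rw [h] at hdU; simp at hdU; omega
  obtain ⟨⟨a, ha⟩, hw⟩ := full_dvd hA hS hg hh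
  rw [← hU] at hw
  have him : (pull A B q g * star (pull A B q h)).im = 0 := by
    by_contra hne
    have := natDegree_le_of_dvd hw hne
    have := (natDegree_mul_star hA g h).2
    omega
  obtain ⟨l, hl⟩ := (full_dvd hA hS hh hh).1
  obtain ⟨m, hm⟩ := (full_dvd hA hS hg hg).1
  rw [← hU] at ha hl hm
  have hN : nm (pull A B q h) ≠ 0 := fun h => h0 (nm_eq_zero hA h)
  rw [← nm_eq] at hl hm
  have hl0 : l ≠ 0 := by rintro rfl; exact hN (by simpa using hl)
  have degl : ∀ t u : K[X], t = U * u → t.natDegree ≤ 18 → u.natDegree ≤ 1 := by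
    intro t u htu ht
    by_cases hu : u = 0
    · simp [hu]
    rw [htu, natDegree_mul hU0 hu] at ht
    omega
  have d1 := degl _ _ hl (by rw [nm_eq]; exact (natDegree_mul_star hA h h).1)
  have d2 := degl _ _ hm (by rw [nm_eq]; exact (natDegree_mul_star hA g g).1)
  have d3 := degl _ _ ha (natDegree_mul_star hA g h).1
  have hW : (pull A B q g).im * (pull A B q h).re - (pull A B q g).re * (pull A B q h).im = 0 := by
    rw [← im_mul_star]; exact him
  rw [re_mul_star] at ha
  rw [nm] at hl
  have hgl0 : l * (pull A B q g).re = a * (pull A B q h).re := by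
    refine mul_left_cancel₀ hU0 ?_
    linear_combination (pull A B q h).re * ha - (pull A B q g).re * hl
      + (pull A B q h).im * q * hW
  have hgl1 : l * (pull A B q g).im = a * (pull A B q h).im := by
    refine mul_left_cancel₀ hU0 ?_
    linear_combination (pull A B q h).im * ha - (pull A B q g).im * hl
      + (pull A B q h).re * hW
  have hlm : l * m = a ^ 2 := by
    rw [nm] at hm
    have e1 : (U * m) * (U * l) = (U * a) ^ 2 := by
      rw [← hl, ← hm, ← ha]
      linear_combination (-q * ((pull A B q g).im * (pull A B q h).re -
        (pull A B q g).re * (pull A B q h).im)) * hW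
    have : U ^ 2 * (l * m) = U ^ 2 * a ^ 2 := by linear_combination e1
    exact mul_left_cancel₀ (pow_ne_zero 2 hU0) this
  obtain ⟨κ, hκ⟩ : ∃ κ : K, a = C κ * l := by
    by_cases ha0 : a = 0
    · exact ⟨0, by simp [ha0]⟩
    have hm0 : m ≠ 0 := by
      rintro rfl; rw [mul_zero] at hlm; exact ha0 (pow_eq_zero_iff two_ne_zero |>.1 hlm.symm)
    have hdeg := congrArg natDegree hlm
    rw [natDegree_mul hl0 hm0, natDegree_pow] at hdeg
    have hla : l.natDegree = a.natDegree := by omega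
    have hdvd : l ∣ a := by
      rcases Nat.eq_zero_or_pos l.natDegree with hz | hz
      · exact (isUnit_iff_degree_eq_zero.2 (by rw [degree_eq_natDegree hl0, hz]; rfl)).dvd
      · have hl1 : l.degree = 1 := by
          rw [degree_eq_natDegree hl0, show l.natDegree = 1 by omega]; rfl
        exact (irreducible_of_degree_eq_one hl1).prime.dvd_of_dvd_pow ⟨m, hlm.symm⟩
    obtain ⟨u, rfl⟩ := hdvd
    have hu0 : u ≠ 0 := right_ne_zero_of_mul ha0
    rw [natDegree_mul hl0 hu0] at hla
    refine ⟨u.coeff 0, ?_⟩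
    rw [← eq_C_of_natDegree_eq_zero (by omega : u.natDegree = 0), mul_comm]
  refine ⟨κ, ?_⟩
  rw [hκ] at hgl0 hgl1
  ext1
  · refine mul_left_cancel₀ hl0 (hgl0.trans ?_)
    rw [QuadraticAlgebra.re_smul, smul_eq_C_mul]; ring
  · refine mul_left_cancel₀ hl0 (hgl1.trans ?_)
    rw [QuadraticAlgebra.im_smul, smul_eq_C_mul]; ring

end Vanishing

section Dimension
variable {K : Type*} [Field K] {A B : Fin 4 → K[X]} {q : K[X]}

theorem infinite_isGood [IsAlgClosed K] (hA : Admissible A B q) : {s | IsGood A q s}.Infinite := by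
  have hne : (∏ j, A j) ≠ 0 := Finset.prod_ne_zero_iff.2 fun j _ => hA.ne_zero j
  have hfin : {x : K | (∏ j, A j).IsRoot x}.Finite := finite_setOfPred_isRoot hne
  have hinf : {x : K | (∏ j, A j).IsRoot x}ᶜ.Infinite := hfin.infinite_compl
  refine Set.Infinite.of_image Prod.fst (hinf.mono fun x hx => ?_)
  obtain ⟨y, hy⟩ := IsAlgClosed.exists_pow_nat_eq (q.eval x) (n := 2) (by norm_num)
  refine ⟨(x, y), ⟨hy, fun j h => hx ?_⟩, rfl⟩
  simp only [Set.mem_ofPred_eq, IsRoot, eval_prod]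
  exact Finset.prod_eq_zero (Finset.mem_univ j) h

theorem exists_superset_isGood [IsAlgClosed K] (hA : Admissible A B q) {S : Finset (K × K)}
    (hS : ∀ s ∈ S, IsGood A q s) {n : ℕ} (hn0 : 0 < n) (hn : S.card ≤ n) :
    ∃ S' : Finset (K × K), S ⊆ S' ∧ (∀ s ∈ S', IsGood A q s) ∧ S'.card = n := by
  obtain ⟨T, hST, hT, hc⟩ := (infinite_isGood hA).exists_superset_ncard_eq
    (s := (S : Set (K × K))) hS S.finite_toSet (k := n) (by simpa using hn)
  have hTf : T.Finite := Set.finite_of_ncard_pos (by omega)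
  refine ⟨hTf.toFinset, ?_, ?_, ?_⟩
  · intro s hs; simpa using hST hs
  · intro s hs; exact hT (by simpa using hs)
  · rw [← Set.ncard_eq_toFinset_card T hTf, hc]

theorem finrank_range_pull_le [IsAlgClosed K] (hA : Admissible A B q) :
    Module.finrank K (LinearMap.range (pull A B q)) ≤ 10 := by
  obtain ⟨S, -, hS, hc⟩ := exists_superset_isGood (A := A) (B := B) (q := q) hA (S := ∅) (by simp)
    (n := 9) (by norm_num) (by simp)
  let φ : LinearMap.range (pull A B q) →ₗ[K] (S → K) :=
    LinearMap.pi fun s => (evalPt q s.1).comp (LinearMap.range (pull A B q)).subtype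
  have h1 : Module.finrank K (LinearMap.ker φ) ≤ 1 := by
    by_cases hb : ∃ h : LinearMap.ker φ, h ≠ 0
    · obtain ⟨v, hv⟩ := hb
      have hval : ∀ w : LinearMap.ker φ, ∀ s ∈ S, evalPt q s w.1.1 = 0 := fun w s hs =>
        congrFun (LinearMap.mem_ker.1 w.2) ⟨s, hs⟩
      obtain ⟨g, hg⟩ := v.1.2
      refine finrank_le_one v fun w => ?_
      obtain ⟨g', hg'⟩ := w.1.2
      obtain ⟨κ, hκ⟩ := proportional hA hS hc.ge (g := g') (h := g)
        (by rw [hg']; exact hval w) (by rw [hg]; exact hval v) (by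
          rw [hg]; intro h; exact hv (Subtype.ext (Subtype.ext h)))
      rw [hg, hg'] at hκ
      exact ⟨κ, Subtype.ext (Subtype.ext hκ.symm)⟩
    · push Not at hb
      have : Subsingleton (LinearMap.ker φ) := ⟨fun a b => (hb a).trans (hb b).symm⟩
      simp [Module.finrank_zero_of_subsingleton]
  have h2 := φ.finrank_range_add_finrank_ker
  have h3 : Module.finrank K (LinearMap.range φ) ≤ 9 := by
    refine (Submodule.finrank_le _).trans ?_
    simp [hc]
  omega

/-- The joint value-and-derivative map at the points `p i` on sections. -/
def Spans (A B : Fin 4 → K[X]) (q : K[X]) (p : Fin 5 → K × K) : Prop :=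
  ∀ b c : Fin 5 → K, ∃ g, ∀ i, evalPt q (p i) (pull A B q g) = b i ∧
    derivPt q (p i) (pull A B q g) = c i

theorem Spans.le_finrank {p : Fin 5 → K × K} (hp : Spans A B q p) :
    10 ≤ Module.finrank K (LinearMap.range (pull A B q)) ∧
    (Module.finrank K (LinearMap.range (pull A B q)) ≤ 10 → ∀ g,
      (∀ i, evalPt q (p i) (pull A B q g) = 0 ∧ derivPt q (p i) (pull A B q g) = 0) →
      pull A B q g = 0) := by
  let φ : LinearMap.range (pull A B q) →ₗ[K] (Fin 5 ⊕ Fin 5 → K) :=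
    LinearMap.pi (Sum.elim (fun i => (evalPt q (p i)).comp (LinearMap.range (pull A B q)).subtype)
      (fun i => (derivPt q (p i)).comp (LinearMap.range (pull A B q)).subtype))
  have hsurj : Function.Surjective φ := by
    intro b
    obtain ⟨g, hg⟩ := hp (fun i => b (Sum.inl i)) (fun i => b (Sum.inr i))
    refine ⟨⟨pull A B q g, g, rfl⟩, ?_⟩
    ext i
    rcases i with i | i
    · exact (hg i).1
    · exact (hg i).2
  have hr : Module.finrank K (LinearMap.range φ) = 10 := by
    rw [LinearMap.range_eq_top.2 hsurj, finrank_top]; simp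
  have h2 := φ.finrank_range_add_finrank_ker
  refine ⟨by omega, fun hle g hg => ?_⟩
  have hk : LinearMap.ker φ = ⊥ := Submodule.finrank_eq_zero.1 (by omega)
  have : (⟨pull A B q g, g, rfl⟩ : LinearMap.range (pull A B q)) ∈ LinearMap.ker φ := by
    rw [LinearMap.mem_ker]
    ext i
    rcases i with i | i
    · exact (hg i).1
    · exact (hg i).2
  rw [hk, Submodule.mem_bot] at this
  exact congrArg Subtype.val this

theorem exists_section {p : Fin 5 → K × K} (hp : Spans A B q p) {ι : Type*} [Fintype ι]
    (hι : Fintype.card ι ≤ 9) (ψ : ι → CurveRing q →ₗ[K] K) :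
    ∃ g, pull A B q g ≠ 0 ∧ ∀ i, ψ i (pull A B q g) = 0 := by
  let φ : LinearMap.range (pull A B q) →ₗ[K] (ι → K) :=
    LinearMap.pi fun i => (ψ i).comp (LinearMap.range (pull A B q)).subtype
  have hk : LinearMap.ker φ ≠ ⊥ := LinearMap.ker_ne_bot_of_finrank_lt (by
    have := hp.le_finrank.1
    rw [Module.finrank_fintype_fun_eq_card]; omega)
  obtain ⟨⟨f, g, rfl⟩, hf, hne⟩ := Submodule.exists_mem_ne_zero_of_ne_bot hk
  exact ⟨g, fun h => hne (by ext1; exact h), fun i => congrFun hf i⟩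

/-- There is a section vanishing on at most eight points, not proportional to a given one. -/
theorem exists_section_not_proportional {p : Fin 5 → K × K} (hp : Spans A B q p)
    {S : Finset (K × K)} (hc : S.card ≤ 8) {h : CurveRing q} (hh : h ≠ 0) :
    ∃ g, pull A B q g ≠ 0 ∧ (∀ s ∈ S, evalPt q s (pull A B q g) = 0) ∧
      ∀ κ : K, pull A B q g ≠ κ • h := by
  obtain ⟨ℓ, hℓ⟩ : ∃ ℓ : Module.Dual K (CurveRing q), ℓ h ≠ 0 := by
    by_contra hcon
    push Not at hcon
    exact hh ((Module.forall_dual_apply_eq_zero_iff K h).1 hcon)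
  obtain ⟨g, hg, hv⟩ := exists_section hp (ι := Option S) (by simp; omega)
    (fun o => o.elim ℓ (fun s => evalPt q s.1))
  refine ⟨g, hg, fun s hs => hv (some ⟨s, hs⟩), fun κ hκ => ?_⟩
  have := hv none
  rw [hκ] at this
  simp only [Option.elim, map_smul, smul_eq_mul, mul_eq_zero, hℓ, or_false] at this
  exact hg (by rw [hκ, this, zero_smul])

theorem eq_zero_of_sum_evalPt [IsAlgClosed K] (hA : Admissible A B q) {p : Fin 5 → K × K}
    (hp : Spans A B q p) {S : Finset (K × K)} (hS : ∀ s ∈ S, IsGood A q s) (hc : S.card ≤ 9)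
    (d : K × K → K) (hd : ∀ g, ∑ s ∈ S, d s * evalPt q s (pull A B q g) = 0) :
    ∀ s ∈ S, d s = 0 := by
  classical
  intro s₀ hs₀
  obtain ⟨S', hSS, hS', hc'⟩ := exists_superset_isGood hA hS (n := 9) (by norm_num) hc
  obtain ⟨h, hh, hv⟩ := exists_section hp (ι := S') (by simp [hc']) (fun s => evalPt q s.1)
  obtain ⟨g, hg, hgv, hgn⟩ := exists_section_not_proportional hp (S := S'.erase s₀)
    (by rw [Finset.card_erase_of_mem (hSS hs₀), hc']) hh
  have hne : evalPt q s₀ (pull A B q g) ≠ 0 := by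
    intro h0
    obtain ⟨κ, hκ⟩ := proportional hA hS' hc'.ge (g := g) (h := h) (fun s hs => by
      by_cases hss : s = s₀
      · rw [hss, h0]
      · exact hgv s (Finset.mem_erase.2 ⟨hss, hs⟩)) (fun s hs => hv ⟨s, hs⟩) hh
    exact hgn κ hκ
  have := hd g
  rw [Finset.sum_eq_single_of_mem s₀ hs₀ (fun s hs hss => by
    rw [hgv s (Finset.mem_erase.2 ⟨hss, hSS hs⟩), mul_zero])] at this
  exact (mul_eq_zero.1 this).resolve_right hne

/-- Two weighted five-point configurations on the curve inducing the same functional on sections. -/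
def Related (A B : Fin 4 → K[X]) (q : K[X]) (p : Fin 5 → K × K) (d : Fin 5 → K)
    (r : Fin 5 → K × K) (e : Fin 5 → K) : Prop :=
  ∀ g, ∑ i, d i * evalPt q (p i) (pull A B q g) = ∑ k, e k * evalPt q (r k) (pull A B q g)

theorem Related.exists_perm [DecidableEq K] [IsAlgClosed K] (hA : Admissible A B q)
    {p₀ : Fin 5 → K × K}
    (hp₀ : Spans A B q p₀) {p r : Fin 5 → K × K} {d e : Fin 5 → K} (hrel : Related A B q p d r e)
    (hp : ∀ i, IsGood A q (p i)) (hr : ∀ k, IsGood A q (r k)) (hinj : Function.Injective p)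
    (hd : ∀ i, d i ≠ 0)
    (hc : (Finset.univ.image p ∪ Finset.univ.image r).card ≤ 9) :
    ∃ σ : Equiv.Perm (Fin 5), r = p ∘ σ ∧ e = d ∘ σ := by
  set E := Finset.univ.image p ∪ Finset.univ.image r with hE
  have hpE : ∀ i, p i ∈ E := fun i => Finset.mem_union_left _ (Finset.mem_image_of_mem _ (by simp))
  have hrE : ∀ i, r i ∈ E := fun i => Finset.mem_union_right _ (Finset.mem_image_of_mem _ (by simp))
  have hz := eq_zero_of_sum_evalPt hA hp₀ (S := E) (fun s hs => by
      rcases Finset.mem_union.1 hs with h | h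
      · obtain ⟨i, -, rfl⟩ := Finset.mem_image.1 h; exact hp i
      · obtain ⟨i, -, rfl⟩ := Finset.mem_image.1 h; exact hr i) hc
    (fun s => (∑ i, if p i = s then d i else 0) - ∑ k, if r k = s then e k else 0) (fun g => by
      simp only [sub_mul, Finset.sum_sub_distrib, Finset.sum_mul, ite_mul, zero_mul]
      rw [Finset.sum_comm, Finset.sum_comm (s := E)]
      simp only [Finset.sum_ite_eq, hpE, hrE, if_true]
      exact sub_eq_zero.2 (hrel g))
  have hex : ∀ i, ∃ k, r k = p i := by
    intro i
    by_contra hcon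
    push Not at hcon
    have := hz (p i) (hpE i)
    simp only [hcon, if_false, Finset.sum_const_zero, sub_zero, hinj.eq_iff,
      Finset.sum_ite_eq', Finset.mem_univ, if_true] at this
    exact hd i this
  choose τ hτ using hex
  have hτi : Function.Injective τ := fun i j hij => hinj (by rw [← hτ i, ← hτ j, hij])
  let σ := Equiv.ofBijective τ (Finite.injective_iff_bijective.1 hτi)
  have hr' : r = p ∘ σ.symm := by
    funext k
    have := hτ (σ.symm k)
    rw [Function.comp_apply, ← this]
    exact congrArg r (σ.apply_symm_apply k).symm
  refine ⟨σ.symm, hr', ?_⟩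
  funext k
  have := hz (r k) (hrE k)
  rw [hr'] at this
  simp only [hinj.eq_iff, Function.comp_apply, EmbeddingLike.apply_eq_iff_eq,
    Finset.sum_ite_eq', Finset.mem_univ, if_true] at this
  exact (sub_eq_zero.1 this).symm

/-- Either the two configurations agree up to order or their ten points are distinct. -/
theorem Related.dichotomy [DecidableEq K] [IsAlgClosed K] (hA : Admissible A B q)
    {p : Fin 5 → K × K}
    (hp₀ : Spans A B q p) {r : Fin 5 → K × K} {d e : Fin 5 → K} (hrel : Related A B q p d r e)
    (hp : ∀ i, IsGood A q (p i)) (hr : ∀ k, IsGood A q (r k)) (hinj : Function.Injective p)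
    (hd : ∀ i, d i ≠ 0) :
    (∃ σ : Equiv.Perm (Fin 5), r = p ∘ σ ∧ e = d ∘ σ) ∨
      (Function.Injective r ∧ ∀ i k, p i ≠ r k) := by
  by_cases hc : (Finset.univ.image p ∪ Finset.univ.image r).card ≤ 9
  · exact Or.inl (hrel.exists_perm hA hp₀ hp hr hinj hd hc)
  · right
    have h1 := Finset.card_union_add_card_inter (Finset.univ.image p) (Finset.univ.image r)
    have h2 : (Finset.univ.image p).card = 5 := by
      rw [Finset.card_image_of_injective _ hinj]; simp
    have h3 : (Finset.univ.image r).card ≤ 5 := Finset.card_image_le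
    have h4 : (Finset.univ.image r).card = (Finset.univ : Finset (Fin 5)).card := by simp; omega
    have h5 : Finset.univ.image p ∩ Finset.univ.image r = ∅ := Finset.card_eq_zero.1 (by omega)
    refine ⟨fun x y hxy => Finset.card_image_iff.1 h4 (by simp) (by simp) hxy,
      fun i k hik => ?_⟩
    have : p i ∈ Finset.univ.image p ∩ Finset.univ.image r :=
      Finset.mem_inter.2 ⟨Finset.mem_image_of_mem _ (by simp),
        hik ▸ Finset.mem_image_of_mem _ (by simp)⟩
    rw [h5] at this
    simp at this

end Dimension

section Residual
variable {K : Type*} [Field K] {A B : Fin 4 → K[X]} {q : K[X]}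

theorem local_ratio [DecidableEq K] {E : Finset (K × K)} (hE : ∀ s ∈ E, IsGood A q s)
    {s : K × K}
    (hs : s ∈ E) {h G : CurveRing q} {c κ : K} (hc : c ≠ 0)
    (hN : nm h = C c * ((∏ j, A j) * ∏ s ∈ E, (X - C s.1))) (hh : evalPt q s h = 0)
    (hG : ∀ t ∈ E, t ≠ s → t.1 = s.1 → evalPt q t G = 0) (x' : K)
    (hW : C κ * nm h = C c * ((G * star h).im * ((X - C s.1) * (X - C x')))) :
    κ * derivPt q s h = c * (s.1 - x') * evalPt q s G := by
  have hq := (hE s hs).1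
  have hUA : (∏ j, A j).eval s.1 ≠ 0 := by
    rw [eval_prod]; exact Finset.prod_ne_zero_iff.2 fun j _ => (hE s hs).2 j
  have hX : (X - C s.1 : K[X]) ≠ 0 := X_sub_C_ne_zero _
  by_cases h1 : h.im.eval s.1 = 0
  · have h0 : h.re.eval s.1 = 0 := by
      rw [evalPt_apply, h1] at hh; simpa using hh
    obtain ⟨k0, hk0⟩ := dvd_iff_isRoot.2 h0
    obtain ⟨k1, hk1⟩ := dvd_iff_isRoot.2 h1
    have hN1 : (X - C s.1) * (k0 ^ 2 - k1 ^ 2 * q) =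
        C c * ((∏ j, A j) * ∏ s ∈ E.erase s, (X - C s.1)) := by
      refine mul_left_cancel₀ hX ?_
      rw [nm, hk0, hk1, ← Finset.mul_prod_erase E _ hs] at hN
      linear_combination hN
    obtain ⟨t, ht, hts⟩ : ∃ t ∈ E.erase s, t.1 = s.1 := by
      have := congrArg (eval s.1) hN1
      simp only [eval_mul, eval_sub, eval_X, eval_C, sub_self, zero_mul] at this
      rcases mul_eq_zero.1 this.symm with h | h
      · exact absurd h hc
      · rcases mul_eq_zero.1 h with h | h
        · exact absurd h hUA
        · rw [eval_prod, Finset.prod_eq_zero_iff] at h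
          obtain ⟨t, ht, h⟩ := h
          simp only [eval_sub, eval_X, eval_C] at h
          exact ⟨t, ht, (sub_eq_zero.1 h).symm⟩
    have htE := Finset.mem_of_mem_erase ht
    have htne := Finset.ne_of_mem_erase ht
    have conj : ∀ u ∈ E, u ≠ s → u.1 = s.1 → u.2 = -s.2 := by
      intro u hu hus hu1
      have e := (hE u hu).1
      rw [hu1, ← hq] at e
      rcases sq_eq_sq_iff_eq_or_eq_neg.1 e with e | e
      · exact absurd (Prod.ext hu1 e) hus
      · exact e
    have ht2 := conj t htE htne hts
    have hN2 : (k0 ^ 2 - k1 ^ 2 * q) =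
        C c * ((∏ j, A j) * ∏ s ∈ (E.erase s).erase t, (X - C s.1)) := by
      refine mul_left_cancel₀ hX ?_
      rw [hN1, ← Finset.mul_prod_erase (E.erase s) _ ht, hts]
      ring
    have hk : k0.eval s.1 - k1.eval s.1 * s.2 ≠ 0 := by
      intro hk
      have := congrArg (eval s.1) hN2
      have hz : (k0 ^ 2 - k1 ^ 2 * q).eval s.1 = 0 := by
        simp only [eval_sub, eval_mul, eval_pow, ← hq]
        linear_combination (k0.eval s.1 + k1.eval s.1 * s.2) * hk
      rw [hz] at this
      simp only [eval_mul, eval_C] at this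
      rcases mul_eq_zero.1 this.symm with h | h
      · exact hc h
      · rcases mul_eq_zero.1 h with h | h
        · exact hUA h
        · rw [eval_prod, Finset.prod_eq_zero_iff] at h
          obtain ⟨u, hu, h⟩ := h
          simp only [eval_sub, eval_X, eval_C] at h
          have hus := Finset.mem_of_mem_erase hu
          have hu2 := conj u (Finset.mem_of_mem_erase hus) (Finset.ne_of_mem_erase hus)
            (sub_eq_zero.1 h).symm
          exact Finset.ne_of_mem_erase hu (Prod.ext ((sub_eq_zero.1 h).symm.trans hts.symm)
            (hu2.trans ht2.symm))
    have hGt := hG t htE htne hts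
    rw [evalPt_apply, hts, ht2] at hGt
    have hW1 : C κ * (k0 ^ 2 - k1 ^ 2 * q) = C c * ((G.im * k0 - G.re * k1) * (X - C x')) := by
      refine mul_left_cancel₀ (pow_ne_zero 2 hX) ?_
      rw [nm, im_mul_star, hk0, hk1] at hW
      linear_combination hW
    have hW2 := congrArg (eval s.1) hW1
    simp only [eval_mul, eval_sub, eval_pow, eval_C, eval_X, ← hq] at hW2
    have hder : derivPt q s h = 2 * s.2 * (k0.eval s.1 + k1.eval s.1 * s.2) := by
      rw [derivPt_apply, hk0, hk1]
      simp
    rw [hder, evalPt_apply]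
    refine mul_left_cancel₀ hk ?_
    linear_combination 2 * s.2 * hW2 - (c * (s.1 - x') * (k0.eval s.1 + k1.eval s.1 * s.2)) * hGt
  · have hd := congrArg (fun f => eval s.1 (derivative f)) hW
    simp only [derivative_mul, derivative_C, eval_add, eval_mul, eval_C, zero_mul, zero_add,
      eval_sub, eval_X, sub_self, derivative_sub, derivative_X, nm, derivative_pow, eval_pow,
      im_mul_star, eval_zero, add_zero, mul_zero] at hd
    rw [evalPt_apply] at hh ⊢
    rw [derivPt_apply]
    refine mul_left_cancel₀ h1 ?_
    simp only [← hq] at hd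
    norm_num at hd
    have e0 : h.re.eval s.1 = - (h.im.eval s.1 * s.2) := by linear_combination hh
    rw [e0] at hd
    linear_combination (-1 : K) * hd

theorem exists_nm_eq (hA : Admissible A B q) {E : Finset (K × K)} (hE : ∀ s ∈ E, IsGood A q s)
    (hc : E.card = 10) {h : (Fin 5 → Fin 2) → K} (h0 : pull A B q h ≠ 0)
    (hv : ∀ s ∈ E, evalPt q s (pull A B q h) = 0) :
    ∃ c : K, c ≠ 0 ∧ nm (pull A B q h) = C c * ((∏ j, A j) * ∏ s ∈ E, (X - C s.1)) := by
  obtain ⟨l, hl⟩ := (full_dvd hA hE hv hv).1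
  have hd := (natDegree_mul_star hA h h).1
  rw [← nm_eq] at hl hd
  have hN : nm (pull A B q h) ≠ 0 := fun h => h0 (nm_eq_zero hA h)
  have hl0 : l ≠ 0 := by rintro rfl; exact hN (by simpa using hl)
  have hU := natDegree_full hA E
  have hU0 : (∏ j, A j) * ∏ s ∈ E, (X - C s.1) ≠ 0 := by
    intro h; rw [h] at hU; simp at hU; omega
  rw [hl, natDegree_mul hU0 hl0, hU] at hd
  refine ⟨l.coeff 0, ?_, ?_⟩
  · intro h
    exact hl0 (by rw [eq_C_of_natDegree_eq_zero (by omega : l.natDegree = 0), h, C_0])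
  · rw [← eq_C_of_natDegree_eq_zero (by omega : l.natDegree = 0), hl, mul_comm]

theorem card_le_of_vanish (hA : Admissible A B q) {E : Finset (K × K)}
    (hE : ∀ s ∈ E, IsGood A q s) {h : (Fin 5 → Fin 2) → K} (h0 : pull A B q h ≠ 0)
    (hv : ∀ s ∈ E, evalPt q s (pull A B q h) = 0) : E.card ≤ 10 := by
  have hl := (full_dvd hA hE hv hv).1
  have hd := (natDegree_mul_star hA h h).1
  rw [← nm_eq] at hl hd
  have hN : nm (pull A B q h) ≠ 0 := fun h => h0 (nm_eq_zero hA h)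
  have := natDegree_le_of_dvd hl hN
  rw [natDegree_full hA E] at this
  omega

theorem exists_im_eq (hA : Admissible A B q) {E : Finset (K × K)} (hE : ∀ s ∈ E, IsGood A q s)
    (hc : E.card = 8) {g h : (Fin 5 → Fin 2) → K}
    (hg : ∀ s ∈ E, evalPt q s (pull A B q g) = 0)
    (hv : ∀ s ∈ E, evalPt q s (pull A B q h) = 0) :
    ∃ c : K, (pull A B q g * star (pull A B q h)).im =
      C c * ((∏ j, A j) * ∏ s ∈ E, (X - C s.1)) := by
  obtain ⟨l, hl⟩ := (full_dvd hA hE hg hv).2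
  by_cases hl0 : l = 0
  · exact ⟨0, by rw [hl, hl0]; simp⟩
  have hd := (natDegree_mul_star hA g h).2
  have hU := natDegree_full hA E
  have hU0 : (∏ j, A j) * ∏ s ∈ E, (X - C s.1) ≠ 0 := by
    intro h; rw [h] at hU; simp at hU; omega
  rw [hl, natDegree_mul hU0 hl0, hU] at hd
  refine ⟨l.coeff 0, ?_⟩
  rw [← eq_C_of_natDegree_eq_zero (by omega : l.natDegree = 0), hl, mul_comm]

/-- When ten distinct points carry a relation, the section vanishing on them has derivatives at
the first five points inversely proportional to the weights. -/
theorem Related.exists_section (hA : Admissible A B q)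
    {p : Fin 5 → K × K} (hspan : Spans A B q p) {r : Fin 5 → K × K} {d e : Fin 5 → K}
    (hrel : Related A B q p d r e) (hp : ∀ i, IsGood A q (p i)) (hr : ∀ k, IsGood A q (r k))
    (hinj : Function.Injective fun i => (p i).1) (hrinj : Function.Injective r)
    (hdisj : ∀ i k, p i ≠ r k) (he : ∀ k, e k ≠ 0) :
    ∃ h, pull A B q h ≠ 0 ∧ (∀ i, evalPt q (p i) (pull A B q h) = 0) ∧
      (∀ k, evalPt q (r k) (pull A B q h) = 0) ∧
      ∃ l : K, ∀ i, d i * derivPt q (p i) (pull A B q h) = l := by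
  classical
  have hpinj : Function.Injective p := fun i j hij => hinj (congrArg Prod.fst hij)
  set E := Finset.univ.image p ∪ Finset.univ.image r with hEdef
  have hpE : ∀ i, p i ∈ E := fun i => Finset.mem_union_left _ (Finset.mem_image_of_mem _ (by simp))
  have hrE : ∀ i, r i ∈ E := fun i => Finset.mem_union_right _ (Finset.mem_image_of_mem _ (by simp))
  have hE : ∀ s ∈ E, IsGood A q s := fun s hs => by
    rcases Finset.mem_union.1 hs with h | h
    · obtain ⟨i, -, rfl⟩ := Finset.mem_image.1 h; exact hp i
    · obtain ⟨i, -, rfl⟩ := Finset.mem_image.1 h; exact hr i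
  have hEc : E.card = 10 := by
    rw [hEdef, Finset.card_union_of_disjoint, Finset.card_image_of_injective _ hpinj,
      Finset.card_image_of_injective _ hrinj]
    · simp
    · rw [Finset.disjoint_left]
      intro s h1 h2
      obtain ⟨i, -, rfl⟩ := Finset.mem_image.1 h1
      obtain ⟨k, -, h⟩ := Finset.mem_image.1 h2
      exact hdisj i k h.symm
  obtain ⟨h, h0, hv'⟩ := BinarySegre.exists_section hspan (ι := (E.erase (r 0) : Finset (K × K)))
    (by rw [Fintype.card_coe, Finset.card_erase_of_mem (hrE 0), hEc]) (fun s => evalPt q s.1)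
  have hv1 : ∀ s ∈ E, s ≠ r 0 → evalPt q s (pull A B q h) = 0 := fun s hs hne =>
    hv' ⟨s, Finset.mem_erase.2 ⟨hne, hs⟩⟩
  have hv0 : evalPt q (r 0) (pull A B q h) = 0 := by
    have := hrel h
    rw [Finset.sum_eq_zero (fun i _ => by rw [hv1 _ (hpE i) (hdisj i 0), mul_zero]),
      Finset.sum_eq_single 0 (fun k _ hk => by
        rw [hv1 _ (hrE k) (fun hh => hk (hrinj hh)), mul_zero]) (by simp)] at this
    exact (mul_eq_zero.1 this.symm).resolve_left (he 0)
  have hv : ∀ s ∈ E, evalPt q s (pull A B q h) = 0 := fun s hs => by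
    by_cases hh : s = r 0
    · rw [hh, hv0]
    · exact hv1 s hs hh
  obtain ⟨c, hc, hN⟩ := exists_nm_eq hA hE hEc h0 hv
  refine ⟨h, h0, fun i => hv _ (hpE i), fun k => hv _ (hrE k),
    d 0 * derivPt q (p 0) (pull A B q h), fun i => ?_⟩
  by_cases hi0 : i = 0
  · rw [hi0]
  have hpi : p i ≠ p 0 := fun hh => hi0 (hpinj hh)
  have hp0' : p 0 ∈ E.erase (p i) := Finset.mem_erase.2 ⟨hpi.symm, hpE 0⟩
  set E8 := (E.erase (p i)).erase (p 0) with hE8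
  have hE8c : E8.card = 8 := by
    rw [hE8, Finset.card_erase_of_mem hp0', Finset.card_erase_of_mem (hpE i), hEc]
  have hE8E : ∀ s ∈ E8, s ∈ E := fun s hs => Finset.mem_of_mem_erase (Finset.mem_of_mem_erase hs)
  obtain ⟨g, hg0, hg, hgn⟩ := exists_section_not_proportional hspan hE8c.le h0
  have hmem : ∀ s ∈ E, s ≠ p i → s ≠ p 0 → s ∈ E8 := fun s hs h1 h2 =>
    Finset.mem_erase.2 ⟨h2, Finset.mem_erase.2 ⟨h1, hs⟩⟩
  obtain ⟨κ, hκ⟩ := exists_im_eq hA (fun s hs => hE s (hE8E s hs)) hE8c hg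
    (fun s hs => hv s (hE8E s hs))
  have hU : ∏ s ∈ E, (X - C s.1) = (X - C (p i).1) * ((X - C (p 0).1) * ∏ s ∈ E8, (X - C s.1)) := by
    rw [hE8, Finset.mul_prod_erase _ (fun s : K × K => X - C s.1) hp0',
      Finset.mul_prod_erase _ (fun s : K × K => X - C s.1) (hpE i)]
  have hx : (p i).1 ≠ (p 0).1 := fun hh => hi0 (hinj hh)
  have e1 := local_ratio hE (hpE i) hc hN (hv _ (hpE i)) (G := pull A B q g) (κ := κ)
    (fun t ht h1 h2 => hg t (hmem t ht h1 (by rintro rfl; exact hx h2.symm))) (p 0).1 (by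
      rw [hN, hκ, hU]; ring)
  have e2 := local_ratio hE (hpE 0) hc hN (hv _ (hpE 0)) (G := pull A B q g) (κ := κ)
    (fun t ht h1 h2 => hg t (hmem t ht (by rintro rfl; exact hx h2) h1)) (p i).1 (by
      rw [hN, hκ, hU]; ring)
  have e3 : d i * evalPt q (p i) (pull A B q g) + d 0 * evalPt q (p 0) (pull A B q g) = 0 := by
    have := hrel g
    rw [Finset.sum_eq_zero (s := Finset.univ) (f := fun k => e k * _) (fun k _ => by
      rw [hg _ (hmem _ (hrE k) (hdisj i k).symm (hdisj 0 k).symm), mul_zero])] at this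
    rw [← this, ← Finset.sum_subset (Finset.subset_univ {i, 0}), Finset.sum_pair hi0]
    intro j _ hj
    simp only [Finset.mem_insert, Finset.mem_singleton, not_or] at hj
    rw [hg _ (hmem _ (hpE j) (hpinj.ne hj.1) (hpinj.ne hj.2)), mul_zero]
  have hκ0 : κ ≠ 0 := by
    rintro rfl
    have z1 : evalPt q (p i) (pull A B q g) = 0 := by
      rw [zero_mul] at e1
      exact (mul_eq_zero.1 e1.symm).resolve_left (mul_ne_zero hc (sub_ne_zero.2 hx))
    have z2 : evalPt q (p 0) (pull A B q g) = 0 := by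
      rw [zero_mul] at e2
      exact (mul_eq_zero.1 e2.symm).resolve_left (mul_ne_zero hc (sub_ne_zero.2 hx.symm))
    obtain ⟨κ, hκ⟩ := proportional hA hE (by omega) (g := g) (h := h) (fun s hs => by
      by_cases h1 : s = p i
      · rw [h1, z1]
      by_cases h2 : s = p 0
      · rw [h2, z2]
      exact hg s (hmem s hs h1 h2)) hv h0
    exact hgn κ hκ
  refine mul_left_cancel₀ hκ0 ?_
  linear_combination d i * e1 - d 0 * e2 + c * ((p i).1 - (p 0).1) * e3

theorem Related.symm_trans {p r r' : Fin 5 → K × K} {d e e' : Fin 5 → K}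
    (h : Related A B q p d r e) (h' : Related A B q p d r' e') : Related A B q r e r' e' :=
  fun g => (h g).symm.trans (h' g)

/-- There is at most one configuration related to, and disjoint from, a given one. -/
theorem Related.unique [IsAlgClosed K] (hA : Admissible A B q)
    {p : Fin 5 → K × K} (hspan : Spans A B q p) {r r' : Fin 5 → K × K} {d e e' : Fin 5 → K}
    (hrel : Related A B q p d r e) (hrel' : Related A B q p d r' e')
    (hp : ∀ i, IsGood A q (p i)) (hr : ∀ k, IsGood A q (r k)) (hr' : ∀ k, IsGood A q (r' k))
    (hinj : Function.Injective fun i => (p i).1) (hrinj : Function.Injective r)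
    (hrinj' : Function.Injective r') (hdisj : ∀ i k, p i ≠ r k) (hdisj' : ∀ i k, p i ≠ r' k)
    (hd : ∀ i, d i ≠ 0) (he : ∀ k, e k ≠ 0) (he' : ∀ k, e' k ≠ 0) :
    ∃ σ : Equiv.Perm (Fin 5), r' = r ∘ σ ∧ e' = e ∘ σ := by
  classical
  obtain ⟨h, h0, hvp, hvr, l, hl⟩ := hrel.exists_section hA hspan hp hr hinj hrinj hdisj he
  obtain ⟨h', h0', hvp', hvr', l', hl'⟩ :=
    hrel'.exists_section hA hspan hp hr' hinj hrinj' hdisj' he'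
  have hker := hspan.le_finrank.2 (finrank_range_pull_le hA)
  have hpinj : Function.Injective p := fun i j hij => hinj (congrArg Prod.fst hij)
  have hl0 : l ≠ 0 := by
    rintro rfl
    exact h0 (hker h fun i => ⟨hvp i, (mul_eq_zero.1 (hl i)).resolve_left (hd i)⟩)
  have hprop : pull A B q (l' • h - l • h') = 0 := hker _ fun i => by
    simp only [map_sub, map_smul, hvp, hvp', smul_eq_mul, mul_zero, sub_zero, true_and]
    refine (mul_eq_zero.1 (?_ : d i * _ = 0)).resolve_left (hd i)
    linear_combination l' * hl i - l * hl' i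
  have hvr2 : ∀ k, evalPt q (r' k) (pull A B q h) = 0 := by
    have hl0' : l' ≠ 0 := by
      rintro rfl
      exact h0' (hker h' fun i => ⟨hvp' i, (mul_eq_zero.1 (hl' i)).resolve_left (hd i)⟩)
    intro k
    have := congrArg (evalPt q (r' k)) hprop
    simp only [map_sub, map_smul, hvr', smul_eq_mul, mul_zero, sub_zero, map_zero] at this
    exact (mul_eq_zero.1 this).resolve_left hl0'
  have hsub : Finset.univ.image r' ⊆ Finset.univ.image r := by
    intro s hs
    obtain ⟨k, -, rfl⟩ := Finset.mem_image.1 hs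
    by_contra hn
    have hcard : (insert (r' k) (Finset.univ.image p ∪ Finset.univ.image r)).card = 11 := by
      rw [Finset.card_insert_of_notMem, Finset.card_union_of_disjoint,
        Finset.card_image_of_injective _ hpinj, Finset.card_image_of_injective _ hrinj]
      · simp
      · rw [Finset.disjoint_left]
        intro s h1 h2
        obtain ⟨i, -, rfl⟩ := Finset.mem_image.1 h1
        obtain ⟨k, -, h⟩ := Finset.mem_image.1 h2
        exact hdisj i k h.symm
      · rw [Finset.mem_union, not_or]
        refine ⟨fun h1 => ?_, hn⟩
        obtain ⟨i, -, h⟩ := Finset.mem_image.1 h1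
        exact hdisj' i k h
    have := card_le_of_vanish hA (E := insert (r' k) (Finset.univ.image p ∪ Finset.univ.image r))
      (fun s hs => by
        rcases Finset.mem_insert.1 hs with rfl | hs
        · exact hr' k
        · rcases Finset.mem_union.1 hs with h | h
          · obtain ⟨i, -, rfl⟩ := Finset.mem_image.1 h; exact hp i
          · obtain ⟨i, -, rfl⟩ := Finset.mem_image.1 h; exact hr i) h0 (fun s hs => by
        rcases Finset.mem_insert.1 hs with rfl | hs
        · exact hvr2 k
        · rcases Finset.mem_union.1 hs with h | h
          · obtain ⟨i, -, rfl⟩ := Finset.mem_image.1 h; exact hvp i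
          · obtain ⟨i, -, rfl⟩ := Finset.mem_image.1 h; exact hvr i)
    omega
  refine (hrel.symm_trans hrel').exists_perm hA hspan hr hr' hrinj he ?_
  rw [Finset.union_eq_left.2 hsub, Finset.card_image_of_injective _ hrinj]
  simp

end Residual

section Existence
variable {K : Type*} [Field K] {A B : Fin 4 → K[X]} {q : K[X]}

theorem eval_im_mul_star {s : K × K} {h : CurveRing q} (hh : evalPt q s h = 0) (G : CurveRing q) :
    (G * star h).im.eval s.1 = -h.im.eval s.1 * evalPt q s G := by
  rw [evalPt_apply] at hh ⊢
  simp only [im_mul_star, eval_sub, eval_mul]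
  linear_combination G.im.eval s.1 * hh

theorem eval_derivative_nm {s : K × K} (hs : s.2 ^ 2 = q.eval s.1) {h : CurveRing q}
    (hh : evalPt q s h = 0) :
    (derivative (nm h)).eval s.1 = -h.im.eval s.1 * derivPt q s h := by
  rw [evalPt_apply] at hh
  rw [derivPt_apply, nm]
  simp only [derivative_sub, derivative_mul, derivative_pow, eval_sub, eval_mul, eval_add,
    eval_pow, eval_C, ← hs]
  norm_num
  linear_combination 2 * h.re.derivative.eval s.1 * hh

theorem exists_eq_prod_X_sub_C [IsAlgClosed K] {M : K[X]} {n : ℕ}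
    (hn : M.natDegree = n) : ∃ r : Fin n → K, M = C M.leadingCoeff * ∏ k, (X - C (r k)) := by
  classical
  have hroots : M.roots.toList.length = n := by
    rw [Multiset.length_toList, ← (IsAlgClosed.splits M).natDegree_eq_card_roots, hn]
  subst hroots
  refine ⟨M.roots.toList.get, ?_⟩
  conv_lhs => rw [(IsAlgClosed.splits M).eq_prod_roots]
  congr 1
  have e : (fun k => X - C (M.roots.toList.get k)) = (fun a => X - C a) ∘ M.roots.toList.get := rfl
  rw [← List.prod_ofFn, e, ← List.map_ofFn, List.ofFn_get]
  conv_lhs => rw [← Multiset.coe_toList M.roots, Multiset.map_coe, Multiset.prod_coe]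

theorem exists_residual [IsAlgClosed K] (hA : Admissible A B q) {p : Fin 5 → K × K}
    (hp : ∀ i, IsGood A q (p i)) (hinj : Function.Injective fun i => (p i).1) {d : Fin 5 → K}
    {h : (Fin 5 → Fin 2) → K}
    (hdeg : (nm (pull A B q h)).natDegree = 18) (hsep : (nm (pull A B q h)).Separable)
    (hv : ∀ i, evalPt q (p i) (pull A B q h) = 0) {l : K} (hl0 : l ≠ 0)
    (hl : ∀ i, d i * derivPt q (p i) (pull A B q h) = l) :
    ∃ (r : Fin 5 → K × K) (e : Fin 5 → K), (∀ k, IsGood A q (r k)) ∧ (∀ k, e k ≠ 0) ∧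
      Related A B q p d r e ∧ ∀ i k, (p i).1 ≠ (r k).1 := by
  classical
  have hpinj : Function.Injective p := fun i j hij => hinj (congrArg Prod.fst hij)
  set N := nm (pull A B q h) with hN
  have hN0 : N ≠ 0 := by intro h; rw [h] at hdeg; simp at hdeg
  have himg : ∀ s ∈ Finset.univ.image p, ∃ i, p i = s := fun s hs => by
    obtain ⟨i, -, h⟩ := Finset.mem_image.1 hs; exact ⟨i, h⟩
  have hS : ∀ s ∈ Finset.univ.image p, IsGood A q s := fun s hs => by
    obtain ⟨i, rfl⟩ := himg s hs; exact hp i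
  have hSv : ∀ s ∈ Finset.univ.image p, evalPt q s (pull A B q h) = 0 := fun s hs => by
    obtain ⟨i, rfl⟩ := himg s hs; exact hv i
  obtain ⟨M, hM⟩ := (full_dvd hA hS hSv hSv).1
  rw [← nm_eq, ← hN] at hM
  have hU := natDegree_full hA (Finset.univ.image p)
  rw [Finset.card_image_of_injective _ hpinj, Finset.card_univ, Fintype.card_fin] at hU
  rw [Finset.prod_image (fun i _ j _ hij => hpinj hij)] at hM hU
  have hM0 : M ≠ 0 := by rintro rfl; exact hN0 (by simpa using hM)
  have hMd : M.natDegree = 5 := by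
    have := hdeg
    rw [hM, natDegree_mul (left_ne_zero_of_mul (hM ▸ hN0)) hM0, hU] at this
    omega
  obtain ⟨r1, hMprod⟩ := exists_eq_prod_X_sub_C hMd
  set c := M.leadingCoeff
  have hc : c ≠ 0 := leadingCoeff_ne_zero.2 hM0
  let v : Fin 5 ⊕ Fin 5 → K := Sum.elim (fun i => (p i).1) r1
  have hNv : N = (C c * ∏ j, A j) * ∏ o, (X - C (v o)) := by
    rw [Fintype.prod_sum_type]
    simp only [v, Sum.elim_inl, Sum.elim_inr]
    rw [hM, hMprod]
    ring
  have hvinj : Function.Injective v :=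
    separable_prod_X_sub_C_iff.1 (hsep.of_dvd ⟨_, hNv.trans (mul_comm _ _)⟩)
  have hroot : ∀ o, N.eval (v o) = 0 := fun o => by
    rw [hNv, eval_mul, eval_prod]
    refine mul_eq_zero_of_right _ (Finset.prod_eq_zero (Finset.mem_univ o) (by simp))
  have hN' : ∀ o, (derivative N).eval (v o) ≠ 0 := fun o h => by
    obtain ⟨a, b, hab⟩ := hsep
    have := congrArg (eval (v o)) hab
    rw [eval_add, eval_mul, eval_mul, h, hroot, eval_one] at this
    simp at this
  have hder : ∀ o, (derivative N).eval (v o) = c * (∏ j, A j).eval (v o) *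
      ∏ o' ∈ Finset.univ.erase o, (v o - v o') := fun o => by
    rw [hNv, ← Finset.mul_prod_erase _ _ (Finset.mem_univ o)]
    simp [derivative_mul, eval_prod]
  have hUA : ∀ o, (∏ j, A j).eval (v o) ≠ 0 := fun o h => hN' o (by rw [hder, h]; ring)
  have hone : ∀ k, (pull A B q h).im.eval (r1 k) ≠ 0 := by
    intro k hk
    have h1 := hroot (Sum.inr k)
    refine hN' (Sum.inr k) ?_
    simp only [v, Sum.elim_inr] at h1 ⊢
    rw [hN, nm, eval_sub, eval_mul, eval_pow, eval_pow, hk] at h1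
    have h2 : (pull A B q h).re.eval (r1 k) = 0 := by simpa using h1
    rw [hN, nm]
    simp [derivative_mul, derivative_pow, hk, h2]
  let r : Fin 5 → K × K := fun k =>
    (r1 k, -(pull A B q h).re.eval (r1 k) / (pull A B q h).im.eval (r1 k))
  let P : Fin 5 ⊕ Fin 5 → K × K := Sum.elim p r
  have hPv : ∀ o, (P o).1 = v o := by rintro (i | k) <;> rfl
  have hrv : ∀ k, evalPt q (r k) (pull A B q h) = 0 := fun k => by
    have := hone k
    simp only [evalPt_apply, r]
    field_simp
    ring
  have hPv0 : ∀ o, evalPt q (P o) (pull A B q h) = 0 := by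
    rintro (i | k)
    · exact hv i
    · exact hrv k
  have hrc : ∀ k, (r k).2 ^ 2 = q.eval (r k).1 := fun k => by
    have h1 := hroot (Sum.inr k)
    have h2 := hone k
    simp only [v, Sum.elim_inr] at h1
    rw [hN, nm, eval_sub, eval_mul, eval_pow, eval_pow] at h1
    simp only [r]
    field_simp
    linear_combination h1
  have hPg : ∀ o, IsGood A q (P o) := by
    rintro (i | k)
    · exact hp i
    · refine ⟨hrc k, fun j hj => hUA (Sum.inr k) ?_⟩
      rw [eval_prod]
      exact Finset.prod_eq_zero (Finset.mem_univ j) hj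
  have hτ : ∀ o, (derivative N).eval (v o) =
      -(pull A B q h).im.eval (v o) * derivPt q (P o) (pull A B q h) := fun o => by
    rw [← hPv]; exact eval_derivative_nm (hPg o).1 (hPv0 o)
  have hτ0 : ∀ o, derivPt q (P o) (pull A B q h) ≠ 0 := fun o h => hN' o (by rw [hτ, h, mul_zero])
  refine ⟨r, fun k => -l / derivPt q (r k) (pull A B q h), fun k => hPg (Sum.inr k),
    fun k => div_ne_zero (neg_ne_zero.2 hl0) (hτ0 (Sum.inr k)), fun g => ?_, fun i k hik => ?_⟩
  · obtain ⟨W', hW'⟩ : (∏ j, A j) ∣ (pull A B q g * star (pull A B q h)).im := by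
      have := (full_dvd hA (S := ∅) (by simp) (g := g) (h := h) (by simp) (by simp)).2
      simpa using this
    have hW'd : W'.degree < (8 + 1 : ℕ) := by
      by_cases hW0 : W' = 0
      · rw [hW0, degree_zero]; exact WithBot.bot_lt_coe _
      have hd := (natDegree_mul_star hA g h).2
      have hUd := natDegree_full hA (∅ : Finset (K × K))
      simp only [Finset.prod_empty, mul_one, Finset.card_empty, add_zero] at hUd
      rw [hW', natDegree_mul (Finset.prod_ne_zero_iff.2 fun j _ => hA.ne_zero j) hW0, hUd] at hd
      rw [degree_eq_natDegree hW0]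
      exact_mod_cast (by omega : W'.natDegree < 9)
    have hL := Lagrange.coeff_eq_sum (s := Finset.univ) (v := v) hvinj.injOn (P := W')
      (hW'd.trans (by simp; norm_num))
    have h9 : W'.coeff (Finset.card (Finset.univ : Finset (Fin 5 ⊕ Fin 5)) - 1) = 0 :=
      coeff_eq_zero_of_degree_lt (by simpa using hW'd)
    rw [h9] at hL
    have hterm : ∀ o, W'.eval (v o) / ∏ o' ∈ Finset.univ.erase o, (v o - v o') =
        c * (evalPt q (P o) (pull A B q g) / derivPt q (P o) (pull A B q h)) := fun o => by
      have e1 := eval_im_mul_star (hPv0 o) (pull A B q g)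
      rw [hW', hPv, eval_mul] at e1
      have e2 := hder o
      have e3 : ∏ o' ∈ Finset.univ.erase o, (v o - v o') ≠ 0 := fun h => hN' o (by
        rw [hder, h, mul_zero])
      rw [hτ] at e2
      have := hτ0 o
      rw [← mul_div_assoc, div_eq_div_iff e3 this]
      refine mul_left_cancel₀ (hUA o) ?_
      linear_combination derivPt q (P o) (pull A B q h) * e1
        + evalPt q (P o) (pull A B q g) * e2
    simp only [hterm] at hL
    rw [← Finset.mul_sum, Fintype.sum_sum_type] at hL
    have hL' := (mul_eq_zero.1 hL.symm).resolve_left hc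
    simp only [P, Sum.elim_inl, Sum.elim_inr] at hL'
    have e1 : ∀ i, d i * evalPt q (p i) (pull A B q g) =
        l * (evalPt q (p i) (pull A B q g) / derivPt q (p i) (pull A B q h)) := fun i => by
      have := hτ0 (Sum.inl i)
      simp only [P, Sum.elim_inl] at this
      rw [← hl i]; field_simp
    have e2 : ∀ k, -l / derivPt q (r k) (pull A B q h) * evalPt q (r k) (pull A B q g) =
        -l * (evalPt q (r k) (pull A B q g) / derivPt q (r k) (pull A B q h)) := fun i => by
      ring
    simp only [e1, e2, ← Finset.mul_sum]
    linear_combination l * hL'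
  · have : v (Sum.inl i) = v (Sum.inr k) := hik
    exact absurd (hvinj this) (by simp)

end Existence

section Invariants
variable {R : Type*} [CommRing R]

/-- The bracket of two vectors of the plane. -/
def br (a b : Fin 2 → R) : R := a 0 * b 1 - a 1 * b 0

/-- A basis of the `SL₂`-invariant multilinear forms in six vectors of the plane. -/
def inv6 (u : Fin 5 → Fin 2 → R) (x : Fin 2 → R) : Fin 5 → R :=
  ![br (u 0) (u 1) * br (u 2) (u 3) * br (u 4) x,
    br (u 0) (u 1) * br (u 2) x * br (u 3) (u 4),
    br (u 1) (u 2) * br (u 3) (u 4) * br x (u 0),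
    br (u 0) (u 3) * br (u 1) (u 2) * br (u 4) x,
    br (u 0) x * br (u 1) (u 4) * br (u 2) (u 3)]

/-- The determinantal covariant of five pure tensors, evaluated at a sixth one. -/
def Phi (u : Fin 5 → Fin 5 → Fin 2 → R) (x : Fin 5 → Fin 2 → R) : R :=
  Matrix.det (Matrix.of fun j r => inv6 (fun i => u i j) (x j) r)

/-- The matrices expressing the action of the adjacent transpositions on `inv6`. -/
def swapMat : Fin 4 → Matrix (Fin 5) (Fin 5) R :=
  ![!![-1, 0, 0, 0, 0; 0, -1, 0, 0, 0; 0, -1, 1, 0, 0; 1, 0, 0, 1, 0; 1, 0, 0, 0, 1],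
    !![1, 0, 0, 1, 0; 0, 1, -1, 0, 0; 0, 0, -1, 0, 0; 0, 0, 0, -1, 0; 0, 0, -1, 0, 1],
    !![-1, 0, 0, 0, 0; 1, 1, 0, 0, 0; 0, 0, 1, 0, -1; 1, 0, 0, 1, 0; 0, 0, 0, 0, -1],
    !![1, 1, 0, 0, 0; 0, -1, 0, 0, 0; 0, 0, -1, 0, 0; 0, 0, -1, 1, 0; 0, 0, -1, 0, 1]]

theorem det_swapMat (k : Fin 4) : (swapMat k : Matrix (Fin 5) (Fin 5) R).det = 1 := by
  fin_cases k <;> simp [swapMat, Matrix.det_succ_row_zero, Fin.sum_univ_succ, Fin.succAbove]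

theorem inv6_swap (k : Fin 4) (u : Fin 5 → Fin 2 → R) (x : Fin 2 → R) :
    inv6 (u ∘ Equiv.swap k.castSucc k.succ) x = (swapMat k).mulVec (inv6 u x) := by
  have e0 : ∀ (k : Fin 4) (i : Fin 5), (u ∘ Equiv.swap k.castSucc k.succ) i =
    u (Equiv.swap k.castSucc k.succ i) := fun _ _ => rfl
  fin_cases k
  · have h : u ∘ Equiv.swap (0 : Fin 4).castSucc (0 : Fin 4).succ = ![u 1, u 0, u 2, u 3, u 4] := by
      funext i; fin_cases i <;> rfl
    simp only [Fin.zero_eta, h]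
    funext r
    fin_cases r <;> simp [inv6, br, swapMat, Matrix.mulVec, dotProduct, Fin.sum_univ_succ] <;> ring
  · have h : u ∘ Equiv.swap (1 : Fin 4).castSucc (1 : Fin 4).succ = ![u 0, u 2, u 1, u 3, u 4] := by
      funext i; fin_cases i <;> rfl
    simp only [Fin.mk_one, h]
    funext r
    fin_cases r <;> simp [inv6, br, swapMat, Matrix.mulVec, dotProduct, Fin.sum_univ_succ] <;> ring
  · have h : u ∘ Equiv.swap (2 : Fin 4).castSucc (2 : Fin 4).succ = ![u 0, u 1, u 3, u 2, u 4] := by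
      funext i; fin_cases i <;> rfl
    simp only [Fin.reduceFinMk, h]
    funext r
    fin_cases r <;> simp [inv6, br, swapMat, Matrix.mulVec, dotProduct, Fin.sum_univ_succ] <;> ring
  · have h : u ∘ Equiv.swap (3 : Fin 4).castSucc (3 : Fin 4).succ = ![u 0, u 1, u 2, u 4, u 3] := by
      funext i; fin_cases i <;> rfl
    simp only [Fin.reduceFinMk, h]
    funext r
    fin_cases r <;> simp [inv6, br, swapMat, Matrix.mulVec, dotProduct, Fin.sum_univ_succ] <;> ring

theorem Phi_perm (σ : Equiv.Perm (Fin 5)) (u : Fin 5 → Fin 5 → Fin 2 → R) (x : Fin 5 → Fin 2 → R) :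
    Phi (u ∘ σ) x = Phi u x := by
  have hσ : σ ∈ Submonoid.closure (Set.range fun i : Fin 4 => Equiv.swap i.castSucc i.succ) := by
    rw [Equiv.Perm.mclosure_swap_castSucc_succ]; trivial
  induction hσ using Submonoid.closure_induction generalizing u with
  | mem σ hσ =>
    obtain ⟨k, rfl⟩ := hσ
    have : (Matrix.of fun j r => inv6 (fun i => (u ∘ Equiv.swap k.castSucc k.succ) i j) (x j) r) =
        (Matrix.of fun j r => inv6 (fun i => u i j) (x j) r) * (swapMat k).transpose := by
      ext j r
      have := congrFun (inv6_swap k (fun i => u i j) (x j)) r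
      rw [Matrix.mul_apply]
      simp only [Matrix.of_apply, Matrix.transpose_apply]
      refine Eq.trans this ?_
      simp [Matrix.mulVec, dotProduct, mul_comm]
    rw [Phi, this, Matrix.det_mul, Matrix.det_transpose, det_swapMat, mul_one, Phi]
  | one => rfl
  | mul σ τ _ _ h1 h2 =>
    rw [Equiv.Perm.coe_mul, ← Function.comp_assoc, h2, h1]

theorem Phi_eq_zero_of_eq {u : Fin 5 → Fin 5 → Fin 2 → R} {a b : Fin 5} (hab : a ≠ b)
    (h : u a = u b) (x : Fin 5 → Fin 2 → R) : Phi u x = 0 := by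
  have hσ : ∀ a b : Fin 5, a ≠ b →
      (Equiv.swap 0 a * Equiv.swap 1 (Equiv.swap 0 a b)) 0 = a ∧
      (Equiv.swap 0 a * Equiv.swap 1 (Equiv.swap 0 a b)) 1 = b := by decide
  obtain ⟨σ, h0, h1⟩ : ∃ σ : Equiv.Perm (Fin 5), σ 0 = a ∧ σ 1 = b := ⟨_, hσ a b hab⟩
  rw [← Phi_perm σ]
  refine Matrix.det_eq_zero_of_column_eq_zero 0 fun j => ?_
  simp only [inv6, br, Matrix.of_apply, Function.comp_apply, h0, h1, h]
  simp [mul_comm]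

theorem inv6_eq_sum (u : Fin 5 → Fin 2 → R) (x : Fin 2 → R) :
    inv6 u x = ∑ α, x α • inv6 u (Pi.single α 1) := by
  funext r; fin_cases r <;> simp [inv6, br] <;> ring

theorem inv6_update (u : Fin 5 → Fin 2 → R) (a : Fin 5) (t x : Fin 2 → R) :
    inv6 (Function.update u a t) x =
      ∑ α, t α • inv6 (Function.update u a (Pi.single α 1)) x := by
  funext r
  fin_cases a <;> fin_cases r <;> simp [inv6, br, Function.update] <;> ring

/-- The slot-wise expansion of the covariant in one of its five pure tensor arguments. -/
theorem Phi_update (u : Fin 5 → Fin 5 → Fin 2 → R) (a : Fin 5) (t x : Fin 5 → Fin 2 → R) :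
    Phi (Function.update u a t) x = ∑ α : Fin 5 → Fin 2, (∏ j, t j (α j)) *
      Phi (Function.update u a (fun j => Pi.single (α j) 1)) x := by
  have key : ∀ t : Fin 5 → Fin 2 → R, Phi (Function.update u a t) x =
      Matrix.detRowAlternating (fun j =>
        inv6 (Function.update (fun i => u i j) a (t j)) (x j)) := by
    intro t
    rw [Phi]
    congr 1
    ext j r
    simp only [Matrix.of_apply]
    congr 1
    funext i
    by_cases h : i = a
    · subst h; simp
    · simp [Function.update_of_ne h]
  rw [key]
  simp only [key]
  have : (fun j => inv6 (Function.update (fun i => u i j) a (t j)) (x j)) = fun j =>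
      ∑ α, t j α • inv6 (Function.update (fun i => u i j) a (Pi.single α 1)) (x j) :=
    funext fun j => inv6_update _ _ _ _
  rw [this, ← AlternatingMap.coe_multilinearMap, MultilinearMap.map_sum]
  refine Finset.sum_congr rfl fun α _ => ?_
  rw [MultilinearMap.map_smul_univ, smul_eq_mul]

/-- Two families of five pure tensors have the same sum. -/
def SameTensor (v w : Fin 5 → Fin 5 → Fin 2 → R) : Prop :=
  ∀ α : Fin 5 → Fin 2, ∑ i, ∏ j, v i j (α j) = ∑ i, ∏ j, w i j (α j)

theorem sum_comp_eq_of_update {I T : Type*} [Fintype I] {v w : I → T} {n : ℕ}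
    (F : (Fin n → T) → R)
    (h : ∀ a u, ∑ i, F (Function.update u a (v i)) = ∑ i, F (Function.update u a (w i))) :
    ∑ ι : Fin n → I, F (v ∘ ι) = ∑ ι : Fin n → I, F (w ∘ ι) := by
  induction n with
  | zero =>
    refine Finset.sum_congr rfl fun ι _ => congrArg F (Subsingleton.elim _ _)
  | succ n ih =>
    have hc : ∀ v : I → T, ∑ ι : Fin (n + 1) → I, F (v ∘ ι) =
        ∑ i, ∑ ι : Fin n → I, F (Fin.cons (v i) (v ∘ ι)) := by
      intro v
      rw [← (Fin.consEquiv fun _ => I).sum_comp, Fintype.sum_prod_type]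
      refine Finset.sum_congr rfl fun i _ => Finset.sum_congr rfl fun ι _ => congrArg F ?_
      funext k
      refine Fin.cases ?_ (fun k => ?_) k <;> simp [Fin.consEquiv]
    rw [hc, hc]
    have h1 : ∀ i, ∑ ι : Fin n → I, F (Fin.cons (v i) (v ∘ ι)) =
        ∑ ι : Fin n → I, F (Fin.cons (v i) (w ∘ ι)) := fun i =>
      ih (fun u => F (Fin.cons (v i) u)) fun a u => by
        simpa only [Fin.cons_update] using h a.succ (Fin.cons (v i) u)
    simp only [h1]
    rcases isEmpty_or_nonempty I with hI | ⟨⟨i₀⟩⟩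
    · simp
    rw [Finset.sum_comm, Finset.sum_comm (s := Finset.univ) (t := Finset.univ) (γ := I)]
    refine Finset.sum_congr rfl fun ι _ => ?_
    simpa only [Fin.update_cons_zero] using h 0 (Fin.cons (v i₀) (w ∘ ι))

theorem sum_Phi_comp (v : Fin 5 → Fin 5 → Fin 2 → R) (x : Fin 5 → Fin 2 → R) :
    ∑ ι : Fin 5 → Fin 5, Phi (v ∘ ι) x = (120 : R) * Phi v x := by
  classical
  have h0 : ∀ ι ∈ (Finset.univ : Finset (Fin 5 → Fin 5)), ι ∉ Finset.univ.map
      ⟨fun σ : Equiv.Perm (Fin 5) => (σ : Fin 5 → Fin 5), DFunLike.coe_injective⟩ →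
      Phi (v ∘ ι) x = 0 := by
    intro ι _ hι
    have : ¬ Function.Injective ι := fun hi => hι (by
      simp only [Finset.mem_map, Finset.mem_univ, true_and]
      exact ⟨Equiv.ofBijective ι (Finite.injective_iff_bijective.1 hi), rfl⟩)
    simp only [Function.Injective, not_forall] at this
    obtain ⟨a, b, hab, hne⟩ := this
    exact Phi_eq_zero_of_eq (u := v ∘ ι) hne (by simp [hab]) x
  rw [← Finset.sum_subset (Finset.subset_univ _) h0, Finset.sum_map]
  simp only [Function.Embedding.coeFn_mk, Phi_perm, Finset.sum_const, Finset.card_univ,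
    Fintype.card_perm, Fintype.card_fin, nsmul_eq_mul]
  norm_num [Nat.factorial]

end Invariants

section Field
variable {K : Type*} [Field K]

theorem SameTensor.Phi_eq [CharZero K] {v w : Fin 5 → Fin 5 → Fin 2 → K} (h : SameTensor v w)
    (x : Fin 5 → Fin 2 → K) : Phi v x = Phi w x := by
  have key := sum_comp_eq_of_update (v := v) (w := w) (fun u => Phi u x) fun a u => by
    have : ∀ v : Fin 5 → Fin 5 → Fin 2 → K, ∑ i, Phi (Function.update u a (v i)) x =
        ∑ α : Fin 5 → Fin 2, (∑ i, ∏ j, v i j (α j)) *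
          Phi (Function.update u a (fun j => Pi.single (α j) 1)) x := by
      intro v
      rw [Finset.sum_congr rfl fun i _ => Phi_update u a (v i) x, Finset.sum_comm]
      simp only [Finset.sum_mul]
    rw [this, this]
    simp only [h _]
  rw [sum_Phi_comp, sum_Phi_comp] at key
  exact mul_left_cancel₀ (by norm_num) key

theorem Phi_update_eq_zero (v : Fin 5 → Fin 5 → Fin 2 → K) (i j : Fin 5) (z : Fin 2 → K) :
    Phi v (Function.update (v i) j z) = 0 := by
  set σ := Equiv.swap 4 i
  have hσ : v i = (v ∘ σ) 4 := by simp [σ]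
  rw [← Phi_perm σ, hσ]
  generalize v ∘ σ = u
  set M : Matrix (Fin 5) (Fin 5) K :=
    Matrix.of fun k r => inv6 (fun i => u i k) (Function.update (u 4) j z k) r with hM
  change M.det = 0
  have hself : ∀ a : Fin 2 → K, br a a = 0 := fun a => by simp [br, mul_comm]
  have h0 : ∀ k, k ≠ j → M k 0 = 0 ∧ M k 3 = 0 := by
    intro k hk
    simp [hM, Function.update_of_ne hk, inv6, hself]
  by_cases hz : M j 0 = 0
  · refine Matrix.det_eq_zero_of_column_eq_zero 0 fun k => ?_
    by_cases hk : k = j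
    · rw [hk, hz]
    · exact (h0 k hk).1
  · refine Matrix.exists_mulVec_eq_zero_iff.1 ⟨![M j 3, 0, 0, -M j 0, 0], fun h => hz ?_, ?_⟩
    · simpa using congrFun h 3
    · funext k
      by_cases hk : k = j
      · subst hk
        simp [Matrix.mulVec, dotProduct, Fin.sum_univ_succ]
        ring
      · have := h0 k hk
        simp [Matrix.mulVec, dotProduct, Fin.sum_univ_succ, this.1, this.2]

theorem SameTensor.Phi_update_eq_zero [CharZero K] {v w : Fin 5 → Fin 5 → Fin 2 → K}
    (h : SameTensor v w) (i j : Fin 5) (z : Fin 2 → K) :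
    Phi v (Function.update (w i) j z) = 0 := by
  rw [h.Phi_eq, BinarySegre.Phi_update_eq_zero]

end Field

section Pencil
variable {R : Type*} [CommRing R]

/-- The matrix with five given rows. -/
def rows5 {T : Type*} (a b c d e : T) : Fin 5 → T := ![a, b, c, d, e]

/-- The determinant as an alternating map in five rows. -/
@[irreducible]
def rowDet : (Fin 5 → R) [⋀^Fin 5]→ₗ[R] R := Matrix.detRowAlternating

theorem det_of_rows (m : Fin 5 → Fin 5 → R) : Matrix.det (Matrix.of m) = rowDet m := by
  unfold rowDet Matrix.det
  exact congrArg _ rfl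

/-- The `5 × 5` determinant of five row vectors. -/
def det5 (a b c d e : Fin 5 → R) : R :=
  rowDet (rows5 a b c d e)

theorem det5_eq_det (a b c d e : Fin 5 → R) :
    det5 a b c d e = Matrix.det (n := Fin 5) (Matrix.of (rows5 a b c d e)) :=
  (det_of_rows _).symm

theorem det5_cramer (ψ : (Fin 5 → R) →ₗ[R] R) (a b c d e y : Fin 5 → R) :
    det5 y b c d e * ψ a + det5 a y c d e * ψ b + det5 a b y d e * ψ c + det5 a b c y e * ψ d
      + det5 a b c d y * ψ e = det5 a b c d e * ψ y := by
  set M : Matrix (Fin 5) (Fin 5) R := Matrix.of (rows5 a b c d e) with hM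
  have h := congrArg ψ (Matrix.mulVec_cramer M.transpose y)
  rw [Matrix.mulVec_transpose, Matrix.vecMul_eq_sum, map_sum, map_smul, Matrix.det_transpose] at h
  simp only [map_smul, Matrix.cramer_transpose_apply, smul_eq_mul, Fin.sum_univ_five] at h
  have e0 : (M.updateRow 0 y).det = det5 y b c d e := by
    rw [det5_eq_det]
    congr 1
    ext i j; fin_cases i <;> simp [hM, rows5, Matrix.updateRow_apply]
  have e1 : (M.updateRow 1 y).det = det5 a y c d e := by
    rw [det5_eq_det]
    congr 1
    ext i j; fin_cases i <;> simp [hM, rows5, Matrix.updateRow_apply]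
  have e2 : (M.updateRow 2 y).det = det5 a b y d e := by
    rw [det5_eq_det]
    congr 1
    ext i j; fin_cases i <;> simp [hM, rows5, Matrix.updateRow_apply]
  have e3 : (M.updateRow 3 y).det = det5 a b c y e := by
    rw [det5_eq_det]
    congr 1
    ext i j; fin_cases i <;> simp [hM, rows5, Matrix.updateRow_apply]
  have e4 : (M.updateRow 4 y).det = det5 a b c d y := by
    rw [det5_eq_det]
    congr 1
    ext i j; fin_cases i <;> simp [hM, rows5, Matrix.updateRow_apply]
  rw [e0, e1, e2, e3, e4, hM, ← det5_eq_det] at h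
  exact h

/-- `det5` as a linear form in its third argument. -/
def det5Form (a b d e : Fin 5 → R) : (Fin 5 → R) →ₗ[R] R :=
  rowDet.toMultilinearMap.toLinearMap (rows5 a b 0 d e) 2

theorem det5Form_apply (a b c d e : Fin 5 → R) : det5Form a b d e c = det5 a b c d e := by
  have h : Function.update (rows5 a b 0 d e) 2 c = (rows5 a b c d e) := by
    funext i; fin_cases i <;> simp [rows5, Function.update]
  rw [det5, ← h, det5Form, MultilinearMap.toLinearMap_apply, AlternatingMap.coe_multilinearMap]

theorem det5_add_two (a x y c d e : Fin 5 → R) :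
    det5 a (x + y) c d e = det5 a x c d e + det5 a y c d e := by
  have h : ∀ z, (rows5 a z c d e) = Function.update (rows5 a 0 c d e) 1 z := by
    intro z; funext i; fin_cases i <;> simp [rows5, Function.update]
  unfold det5
  rw [h, h x, h y, AlternatingMap.map_update_add]

theorem det5_eq_zero_of_eq {m : Fin 5 → Fin 5 → R} {i j : Fin 5} (hij : i ≠ j) (h : m i = m j) :
    rowDet m = 0 :=
  rowDet.map_eq_zero_of_eq m h hij

theorem det5_swap (m : Fin 5 → Fin 5 → R) {i j : Fin 5} (hij : i ≠ j) :
    rowDet (m ∘ Equiv.swap i j) =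
      - rowDet m :=
  rowDet.map_swap m hij

/-- The four-term relation among the brackets of four lines. -/
theorem four_lines (p u b0 b1 c0 c1 d0 d1 : Fin 5 → R) :
    det5 p u b0 c0 c1 * det5 p u b1 d0 d1 - det5 p u b1 c0 c1 * det5 p u b0 d0 d1 =
    det5 p u c0 d0 d1 * det5 p u c1 b0 b1 - det5 p u c1 d0 d1 * det5 p u c0 b0 b1 := by
  have h := det5_cramer (det5Form p u d0 d1) p u b0 c0 c1 b1
  have hp : det5 p u p d0 d1 = 0 := det5_eq_zero_of_eq (i := 0) (j := 2) (by decide) rfl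
  have hu : det5 p u u d0 d1 = 0 := det5_eq_zero_of_eq (i := 1) (j := 2) (by decide) rfl
  simp only [det5Form_apply, hp, hu] at h
  have s1 : det5 p u b0 b1 c1 = det5 p u c1 b0 b1 := by
    have e1 := det5_swap (rows5 p u b0 b1 c1) (i := 2) (j := 4) (by decide)
    have e2 := det5_swap (rows5 p u c1 b1 b0) (i := 3) (j := 4) (by decide)
    have f1 : (rows5 p u b0 b1 c1) ∘ Equiv.swap 2 4 = (rows5 p u c1 b1 b0) := by
      funext i; fin_cases i <;> rfl
    have f2 : (rows5 p u c1 b1 b0) ∘ Equiv.swap 3 4 = (rows5 p u c1 b0 b1) := by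
      funext i; fin_cases i <;> rfl
    rw [f1] at e1
    rw [f2] at e2
    unfold det5
    rw [e2, e1, neg_neg]
  have s2 : det5 p u b0 c0 b1 = - det5 p u c0 b0 b1 := by
    have e1 := det5_swap (rows5 p u c0 b0 b1) (i := 2) (j := 3) (by decide)
    have f1 : (rows5 p u c0 b0 b1) ∘ Equiv.swap 2 3 = (rows5 p u b0 c0 b1) := by
      funext i; fin_cases i <;> rfl
    rw [f1] at e1
    unfold det5
    exact e1
  rw [s1, s2] at h
  linear_combination -h

/-- The coefficients of the quadratic form `t ↦ det (t f; t g)` of a pencil of `2 × 2` forms. -/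
def pencilA (f g : Fin 2 → Fin 2 → R) : R := f 1 0 * g 1 1 - f 1 1 * g 1 0
/-- See `pencilA`. -/
def pencilB (f g : Fin 2 → Fin 2 → R) : R :=
  f 0 0 * g 1 1 - f 0 1 * g 1 0 + (f 1 0 * g 0 1 - f 1 1 * g 0 0)
/-- See `pencilA`. -/
def pencilC (f g : Fin 2 → Fin 2 → R) : R := f 0 0 * g 0 1 - f 0 1 * g 0 0

/-- The pencil associated to slots `b`, `c` and a vector `p`. -/
def slotForm (l : Fin 5 → Fin 2 → Fin 5 → R) (p : Fin 5 → R) (b c : Fin 5) (α β : Fin 2) : R :=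
  det5 p (l 1 α) (l b β) (l c 0) (l c 1)

theorem slotForm_cycle (l : Fin 5 → Fin 2 → Fin 5 → R) (p : Fin 5 → R) (b c d : Fin 5) :
    pencilA (slotForm l p b c) (slotForm l p b d) = pencilA (slotForm l p c d) (slotForm l p c b) ∧
    pencilB (slotForm l p b c) (slotForm l p b d) = pencilB (slotForm l p c d) (slotForm l p c b) ∧
    pencilC (slotForm l p b c) (slotForm l p b d) = pencilC (slotForm l p c d) (slotForm l p c b) := by
  have key := fun u => four_lines p u (l b 0) (l b 1) (l c 0) (l c 1) (l d 0) (l d 1)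
  have k0 := key (l 1 0)
  have k1 := key (l 1 1)
  have k2 := key (l 1 0 + l 1 1)
  simp only [det5_add_two] at k2
  simp only [pencilA, pencilB, pencilC, slotForm]
  exact ⟨k1, by linear_combination k2 - k0 - k1, k0⟩

theorem pencil_disc (f g : Fin 2 → Fin 2 → R) :
    pencilB f g ^ 2 - 4 * pencilA f g * pencilC f g =
    pencilB (fun β α => f α β) (fun β α => g α β) ^ 2 -
      4 * pencilA (fun β α => f α β) (fun β α => g α β) *
        pencilC (fun β α => f α β) (fun β α => g α β) := by
  simp only [pencilA, pencilB, pencilC]; ring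

/-- A bilinear form on the plane. -/
def bil (f : Fin 2 → Fin 2 → R) (t s : Fin 2 → R) : R :=
  t 0 * f 0 0 * s 0 + t 0 * f 0 1 * s 1 + t 1 * f 1 0 * s 0 + t 1 * f 1 1 * s 1

theorem pencil_root (f g : Fin 2 → Fin 2 → R) {t s : Fin 2 → R} (hf : bil f t s = 0)
    (hg : bil g t s = 0) (a : Fin 2) :
    s a * (pencilA f g * t 1 ^ 2 + pencilB f g * t 0 * t 1 + pencilC f g * t 0 ^ 2) = 0 := by
  simp only [bil, pencilA, pencilB, pencilC] at *
  fin_cases a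
  · simp only [Fin.zero_eta]
    linear_combination (t 1 * g 1 1 + t 0 * g 0 1) * hf - (t 1 * f 1 1 + t 0 * f 0 1) * hg
  · simp only [Fin.mk_one]
    linear_combination -(t 1 * g 1 0 + t 0 * g 0 0) * hf + (t 1 * f 1 0 + t 0 * f 0 0) * hg

theorem pencil_same_root (f g : Fin 2 → Fin 2 → R) {t s : Fin 2 → R} (hf : bil f t s = 0)
    (hg : bil g t s = 0) :
    s 0 * (2 * pencilA f g * t 1 + pencilB f g * t 0) =
    t 0 * (2 * -pencilA (fun β α => f α β) (fun β α => g α β) * s 1 +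
      -pencilB (fun β α => f α β) (fun β α => g α β) * s 0) := by
  simp only [bil, pencilA, pencilB] at *
  linear_combination (2 * g 1 1) * hf - (2 * f 1 1) * hg

end Pencil

section Lines
variable {R : Type*} [CommRing R]

theorem det5_lin0 (b c d e x y : Fin 5 → R) (r s : R) :
    det5 (r • x + s • y) b c d e = r * det5 x b c d e + s * det5 y b c d e := by
  have h : ∀ z, rows5 z b c d e = Function.update (rows5 0 b c d e) 0 z := by
    intro z; funext i; fin_cases i <;> simp [rows5, Function.update]
  unfold det5
  rw [h, h x, h y, AlternatingMap.map_update_add, AlternatingMap.map_update_smul,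
    AlternatingMap.map_update_smul, smul_eq_mul, smul_eq_mul]

theorem det5_lin1 (a c d e x y : Fin 5 → R) (r s : R) :
    det5 a (r • x + s • y) c d e = r * det5 a x c d e + s * det5 a y c d e := by
  have h : ∀ z, rows5 a z c d e = Function.update (rows5 a 0 c d e) 1 z := by
    intro z; funext i; fin_cases i <;> simp [rows5, Function.update]
  unfold det5
  rw [h, h x, h y, AlternatingMap.map_update_add, AlternatingMap.map_update_smul,
    AlternatingMap.map_update_smul, smul_eq_mul, smul_eq_mul]

theorem det5_lin2 (a b d e x y : Fin 5 → R) (r s : R) :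
    det5 a b (r • x + s • y) d e = r * det5 a b x d e + s * det5 a b y d e := by
  have h : ∀ z, rows5 a b z d e = Function.update (rows5 a b 0 d e) 2 z := by
    intro z; funext i; fin_cases i <;> simp [rows5, Function.update]
  unfold det5
  rw [h, h x, h y, AlternatingMap.map_update_add, AlternatingMap.map_update_smul,
    AlternatingMap.map_update_smul, smul_eq_mul, smul_eq_mul]

theorem det5_lin3 (a b c e x y : Fin 5 → R) (r s : R) :
    det5 a b c (r • x + s • y) e = r * det5 a b c x e + s * det5 a b c y e := by
  have h : ∀ z, rows5 a b c z e = Function.update (rows5 a b c 0 e) 3 z := by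
    intro z; funext i; fin_cases i <;> simp [rows5, Function.update]
  unfold det5
  rw [h, h x, h y, AlternatingMap.map_update_add, AlternatingMap.map_update_smul,
    AlternatingMap.map_update_smul, smul_eq_mul, smul_eq_mul]

theorem det5_lin4 (a b c d x y : Fin 5 → R) (r s : R) :
    det5 a b c d (r • x + s • y) = r * det5 a b c d x + s * det5 a b c d y := by
  have h : ∀ z, rows5 a b c d z = Function.update (rows5 a b c d 0) 4 z := by
    intro z; funext i; fin_cases i <;> simp [rows5, Function.update]
  unfold det5
  rw [h, h x, h y, AlternatingMap.map_update_add, AlternatingMap.map_update_smul,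
    AlternatingMap.map_update_smul, smul_eq_mul, smul_eq_mul]

/-- The linear map with columns `l j 0`, `l j 1`. -/
def lin (l : Fin 5 → Fin 2 → Fin 5 → R) (j : Fin 5) (x : Fin 2 → R) : Fin 5 → R :=
  x 0 • l j 0 + x 1 • l j 1

/-- Any three of the five lines span the space. -/
def Spread (l : Fin 5 → Fin 2 → Fin 5 → R) : Prop :=
  ∀ a b c, a ≠ b → a ≠ c → b ≠ c → det5 (l a 0) (l a 1) (l b 0) (l b 1) (l c 0) ≠ 0

theorem bil_slotForm (l : Fin 5 → Fin 2 → Fin 5 → R) (p : Fin 5 → R) (b c : Fin 5)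
    (t s : Fin 2 → R) :
    bil (slotForm l p b c) t s = det5 p (lin l 1 t) (lin l b s) (l c 0) (l c 1) := by
  simp only [lin, det5_lin1, det5_lin2, bil, slotForm]
  ring

end Lines

section Field
variable {K : Type*} [Field K] {l : Fin 5 → Fin 2 → Fin 5 → K} {w : Fin 5 → Fin 2 → K}

theorem vecMul_eq_sum_rows (c : Fin 5 → K) (m : Fin 5 → Fin 5 → K) :
    Matrix.vecMul c (Matrix.of m) = ∑ k, c k • m k := by
  rw [Matrix.vecMul_eq_sum]; rfl

theorem eq_zero_of_sum_rows {c : Fin 5 → K} {m : Fin 5 → Fin 5 → K}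
    (hm : rowDet m ≠ 0) (h : ∑ k, c k • m k = 0) : c = 0 := by
  rw [← det_of_rows] at hm
  rw [← vecMul_eq_sum_rows] at h
  exact Matrix.eq_zero_of_vecMul_eq_zero hm h

theorem sum_det_update (m : Fin 5 → Fin 5 → K) (z : Fin 5 → K)
    (h : rowDet m = 0) :
    ∑ k, rowDet (Function.update m k z) • m k = 0 := by
  have := Matrix.mulVec_cramer (Matrix.of m).transpose z
  rw [Matrix.det_transpose, det_of_rows, h, zero_smul, Matrix.mulVec_transpose,
    vecMul_eq_sum_rows] at this
  rw [← this]
  refine Finset.sum_congr rfl fun k _ => ?_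
  rw [Matrix.cramer_transpose_apply, ← det_of_rows]
  rfl

/-- If replacing a vector by any other vector of its line never gives a basis,
then no four of the vectors are independent. -/
theorem Spread.det_update_eq_zero (hl : Spread l) (hw : ∀ j, w j ≠ 0)
    (h : ∀ j z, rowDet
      (Function.update (fun k => lin l k (w k)) j (lin l j z)) = 0) (d : Fin 5) (z : Fin 5 → K) :
    rowDet (Function.update (fun k => lin l k (w k)) d z) = 0 := by
  set m : Fin 5 → Fin 5 → K := fun k => lin l k (w k) with hm
  by_contra hd
  have hm0 : rowDet m = 0 := by
    have := h 0 (w 0)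
    rwa [show lin l 0 (w 0) = m 0 from rfl, Function.update_eq_self] at this
  set c : Fin 5 → K := fun k => rowDet (Function.update m k z) with hc
  have hcs : ∑ k, c k • m k = 0 := sum_det_update m z hm0
  have hcd : c d ≠ 0 := hd
  have hφ : ∀ j, c j ≠ 0 → ∀ e,
      rowDet (Function.update m d (lin l j e)) = 0 := by
    intro j hj e
    set c' : Fin 5 → K := fun k => rowDet (Function.update m k (lin l j e))
      with hc'
    have hcs' : ∑ k, c' k • m k = 0 := sum_det_update m _ hm0
    have hz : (c d • c' - c' d • c) = 0 := by
      refine eq_zero_of_sum_rows (m := Function.update m d z) hd ?_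
      have : ∀ k, (c d • c' - c' d • c) k • Function.update m d z k =
          c d • (c' k • m k) - c' d • (c k • m k) := by
        intro k
        by_cases hk : k = d
        · subst hk; simp [smul_smul, mul_comm]
        · rw [Function.update_of_ne hk]
          simp [sub_smul, smul_smul]
      simp only [this, Finset.sum_sub_distrib, ← Finset.smul_sum, hcs, hcs', smul_zero, sub_zero]
    have hzj := congrFun hz j
    have hj0 : c' j = 0 := h j e
    simp only [Pi.sub_apply, Pi.smul_apply, smul_eq_mul, hj0, mul_zero, zero_sub, neg_eq_zero,
      Pi.zero_apply, mul_eq_zero] at hzj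
    exact hzj.resolve_right hj
  have hl0 : ∀ j, lin l j (Pi.single 0 1) = l j 0 := fun j => by simp [lin]
  have hl1 : ∀ j, lin l j (Pi.single 1 1) = l j 1 := fun j => by simp [lin]
  by_cases htwo : ∃ a b, a ≠ d ∧ b ≠ d ∧ a ≠ b ∧ c a ≠ 0 ∧ c b ≠ 0
  · obtain ⟨a, b, had, hbd, hab, ha, hb⟩ := htwo
    set ψ : (Fin 5 → K) →ₗ[K] K :=
      rowDet.toMultilinearMap.toLinearMap m d with hψ
    have hψa : ∀ y, ψ y = rowDet (Function.update m d y) := fun y => by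
      rw [hψ, MultilinearMap.toLinearMap_apply, AlternatingMap.coe_multilinearMap]
    have hcr := det5_cramer ψ (l a 0) (l a 1) (l b 0) (l b 1) (l d 0) z
    have h1 := hφ a ha (Pi.single 0 1)
    have h2 := hφ a ha (Pi.single 1 1)
    have h3 := hφ b hb (Pi.single 0 1)
    have h4 := hφ b hb (Pi.single 1 1)
    have h5 := hφ d hcd (Pi.single 0 1)
    rw [hl0, ← hψa] at h1 h3 h5
    rw [hl1, ← hψa] at h2 h4
    rw [h1, h2, h3, h4, h5] at hcr
    simp only [mul_zero, add_zero] at hcr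
    rcases mul_eq_zero.1 hcr.symm with h6 | h6
    · exact hl a b d hab had hbd h6
    · exact hd (by rw [← hψa, h6])
  · obtain ⟨a, had, ha⟩ : ∃ a, a ≠ d ∧ ∀ k, k ≠ a → k ≠ d → c k = 0 := by
      by_cases hone : ∃ a, a ≠ d ∧ c a ≠ 0
      · obtain ⟨a, had, ha⟩ := hone
        refine ⟨a, had, fun k hka hkd => ?_⟩
        by_contra hk
        exact htwo ⟨a, k, had, hkd, hka.symm, ha, hk⟩
      · obtain ⟨a, had⟩ := exists_ne d
        refine ⟨a, had, fun k _ hkd => ?_⟩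
        by_contra hk
        exact hone ⟨k, hkd, hk⟩
    rw [Finset.sum_eq_add a d had (fun k _ hk => by rw [ha k hk.1 hk.2, zero_smul])
      (by simp) (by simp)] at hcs
    obtain ⟨e, hea, hed⟩ : ∃ e, e ≠ a ∧ e ≠ d := by
      exact (by decide : ∀ a d : Fin 5, ∃ e, e ≠ a ∧ e ≠ d) a d
    have := eq_zero_of_sum_rows (c := rows5 (c d * w d 0) (c d * w d 1) (c a * w a 0)
      (c a * w a 1) 0) (hl d a e had.symm hed.symm hea.symm) (by
        rw [← hcs]
        simp only [Fin.sum_univ_five, rows5, hm, lin]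
        simp [smul_smul]
        abel)
    apply hw d
    have t0 := congrFun this 0
    have t1 := congrFun this 1
    simp only [rows5, Matrix.cons_val_zero, Matrix.cons_val_one, Pi.zero_apply, mul_eq_zero,
      hcd, false_or] at t0 t1
    funext i; fin_cases i
    · exact t0
    · exact t1

theorem bil_eq_zero {m : Fin 5 → Fin 5 → K} (hm : m = fun k => lin l k (w k))
    (h : ∀ d z, rowDet (Function.update m d z) = 0) {b c d : Fin 5}
    (hinj : Function.Injective (rows5 0 1 b c d : Fin 5 → Fin 5)) (hc : w c ≠ 0) :
    bil (slotForm l (lin l 0 (w 0)) b c) (w 1) (w b) = 0 := by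
  have key : ∀ z, det5 (m 0) (m 1) (m b) (m c) z = 0 := by
    intro z
    set σ : Equiv.Perm (Fin 5) := Equiv.ofBijective _ (Finite.injective_iff_bijective.1 hinj)
    have h1 := rowDet.map_perm (Function.update m d z) σ
    rw [h d z, smul_zero] at h1
    have hne : ∀ i : Fin 5, i ≠ 4 → rows5 0 1 b c d i ≠ d := fun i hi e => hi (hinj e)
    have h0 : (0 : Fin 5) ≠ d := hne 0 (by decide)
    have h1' : (1 : Fin 5) ≠ d := hne 1 (by decide)
    have hb : b ≠ d := hne 2 (by decide)
    have hc : c ≠ d := hne 3 (by decide)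
    have : Function.update m d z ∘ σ = rows5 (m 0) (m 1) (m b) (m c) z := by
      funext i
      change Function.update m d z (rows5 0 1 b c d i) = _
      fin_cases i
      · exact Function.update_of_ne h0 _ _
      · exact Function.update_of_ne h1' _ _
      · exact Function.update_of_ne hb _ _
      · exact Function.update_of_ne hc _ _
      · exact Function.update_self _ _ _
    rw [det5, ← this, ← h1]
  rw [bil_slotForm]
  subst hm
  have k0 := key (l c 0)
  have k1 := key (l c 1)
  have hz : ∀ a a' a'' y, det5 (R := K) a a' a'' y y = 0 := fun a a' a'' y =>
    det5_eq_zero_of_eq (m := rows5 a a' a'' y y) (i := 3) (j := 4) (by decide) rfl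
  have hsw : ∀ a a' a'' y z, det5 (R := K) a a' a'' y z = - det5 a a' a'' z y := by
    intro a a' a'' y z
    have h1 := hz a a' a'' ((1 : K) • y + (1 : K) • z)
    rw [det5_lin3, det5_lin4, det5_lin4, hz, hz] at h1
    linear_combination h1
  simp only [show ∀ x, lin l c x = x 0 • l c 0 + x 1 • l c 1 from fun _ => rfl, det5_lin3,
    hz] at k0 k1
  rw [hsw] at k0
  by_contra hne
  apply hc
  funext i
  fin_cases i
  · simpa [hne] using k1
  · simpa [hne] using k0

end Field

section Curve
variable {R S : Type*} [CommRing R] [CommRing S]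

theorem map_det5 (φ : R →+* S) (a b c d e : Fin 5 → R) :
    φ (det5 a b c d e) = det5 (φ ∘ a) (φ ∘ b) (φ ∘ c) (φ ∘ d) (φ ∘ e) := by
  rw [det5_eq_det, det5_eq_det, RingHom.map_det]
  congr 1
  ext i j
  fin_cases i <;> simp [rows5]

theorem map_pencil (φ : R →+* S) (f g : Fin 2 → Fin 2 → R) :
    φ (pencilA f g) = pencilA (fun α β => φ (f α β)) (fun α β => φ (g α β)) ∧
    φ (pencilB f g) = pencilB (fun α β => φ (f α β)) (fun α β => φ (g α β)) ∧
    φ (pencilC f g) = pencilC (fun α β => φ (f α β)) (fun α β => φ (g α β)) := by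
  simp [pencilA, pencilB, pencilC]

/-- The pencil associated to slots `b`, `c`, as a polynomial in the coordinate of slot `0`. -/
noncomputable def slotPoly (l : Fin 5 → Fin 2 → Fin 5 → R) (b c : Fin 5) (α β : Fin 2) : R[X] :=
  C (slotForm l (l 0 0) b c α β) + C (slotForm l (l 0 1) b c α β) * X

theorem slotPoly_eq (l : Fin 5 → Fin 2 → Fin 5 → R) (b c : Fin 5) :
    slotPoly l b c = slotForm (fun j α => C ∘ l j α)
      ((1 : R[X]) • (C ∘ l 0 0) + (X : R[X]) • (C ∘ l 0 1)) b c := by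
  funext α β
  rw [slotPoly, slotForm, slotForm, slotForm, det5_lin0, map_det5, map_det5]
  ring

theorem eval_slotPoly (l : Fin 5 → Fin 2 → Fin 5 → R) (b c : Fin 5) (α β : Fin 2) (x : R) :
    (slotPoly l b c α β).eval x =
      slotForm l ((1 : R) • l 0 0 + x • l 0 1) b c α β := by
  rw [slotPoly, slotForm, slotForm, slotForm, det5_lin0, eval_add, eval_mul, eval_C, eval_C, eval_X]
  ring

theorem map_slotPoly (φ : R →+* S) (l : Fin 5 → Fin 2 → Fin 5 → R) (b c : Fin 5) (α β : Fin 2) :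
    (slotPoly l b c α β).map φ = slotPoly (fun j α => φ ∘ l j α) b c α β := by
  rw [slotPoly, Polynomial.map_add, Polynomial.map_mul, map_C, map_C, map_X, slotPoly]
  simp only [slotForm]
  rw [map_det5 φ, map_det5 φ]

theorem natDegree_slotPoly (l : Fin 5 → Fin 2 → Fin 5 → R) (b c : Fin 5) (α β : Fin 2) :
    (slotPoly l b c α β).natDegree ≤ 1 := by
  rw [slotPoly, add_comm]
  exact natDegree_linear_le

/-- The coefficients of the quadratic equations satisfied by the slots `1, …, 4`. -/
noncomputable def curveA (l : Fin 5 → Fin 2 → Fin 5 → R) : Fin 4 → R[X] :=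
  ![pencilA (slotPoly l 2 3) (slotPoly l 2 4),
    -pencilA (fun β α => slotPoly l 2 3 α β) (fun β α => slotPoly l 2 4 α β),
    -pencilA (fun β α => slotPoly l 3 4 α β) (fun β α => slotPoly l 3 2 α β),
    -pencilA (fun β α => slotPoly l 4 2 α β) (fun β α => slotPoly l 4 3 α β)]

/-- See `curveA`. -/
noncomputable def curveB (l : Fin 5 → Fin 2 → Fin 5 → R) : Fin 4 → R[X] :=
  ![pencilB (slotPoly l 2 3) (slotPoly l 2 4),
    -pencilB (fun β α => slotPoly l 2 3 α β) (fun β α => slotPoly l 2 4 α β),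
    -pencilB (fun β α => slotPoly l 3 4 α β) (fun β α => slotPoly l 3 2 α β),
    -pencilB (fun β α => slotPoly l 4 2 α β) (fun β α => slotPoly l 4 3 α β)]

/-- See `curveA`. -/
noncomputable def curveC (l : Fin 5 → Fin 2 → Fin 5 → R) : Fin 4 → R[X] :=
  ![pencilC (slotPoly l 2 3) (slotPoly l 2 4),
    -pencilC (fun β α => slotPoly l 2 3 α β) (fun β α => slotPoly l 2 4 α β),
    -pencilC (fun β α => slotPoly l 3 4 α β) (fun β α => slotPoly l 3 2 α β),
    -pencilC (fun β α => slotPoly l 4 2 α β) (fun β α => slotPoly l 4 3 α β)]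

/-- The common discriminant of the quadratic equations. -/
noncomputable def curveQ (l : Fin 5 → Fin 2 → Fin 5 → R) : R[X] :=
  curveB l 0 ^ 2 - 4 * curveA l 0 * curveC l 0

theorem slotPoly_cycle (l : Fin 5 → Fin 2 → Fin 5 → R) (b c d : Fin 5) :
    pencilA (slotPoly l b c) (slotPoly l b d) = pencilA (slotPoly l c d) (slotPoly l c b) ∧
    pencilB (slotPoly l b c) (slotPoly l b d) = pencilB (slotPoly l c d) (slotPoly l c b) ∧
    pencilC (slotPoly l b c) (slotPoly l b d) = pencilC (slotPoly l c d) (slotPoly l c b) := by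
  simp only [slotPoly_eq]
  exact slotForm_cycle _ _ b c d

theorem curve_disc (l : Fin 5 → Fin 2 → Fin 5 → R) (j : Fin 4) :
    curveB l j ^ 2 - 4 * curveA l j * curveC l j = curveQ l := by
  have h1 := slotPoly_cycle l 2 3 4
  have h2 := slotPoly_cycle l 3 4 2
  have d1 := pencil_disc (slotPoly l 2 3) (slotPoly l 2 4)
  have d2 := pencil_disc (slotPoly l 3 4) (slotPoly l 3 2)
  have d3 := pencil_disc (slotPoly l 4 2) (slotPoly l 4 3)
  rw [← h1.1, ← h1.2.1, ← h1.2.2] at d2 h2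
  rw [← h2.1, ← h2.2.1, ← h2.2.2] at d3
  simp only [curveQ, curveB, curveA, curveC]
  fin_cases j
  · rfl
  · simp
    linear_combination -d1
  · simp
    linear_combination -d2
  · simp
    linear_combination -d3

theorem curveA_dvd (l : Fin 5 → Fin 2 → Fin 5 → R) (j : Fin 4) :
    curveA l j ∣ curveB l j ^ 2 - curveQ l :=
  ⟨4 * curveC l j, by rw [← curve_disc l j]; ring⟩

theorem natDegree_pencil {f g : Fin 2 → Fin 2 → R[X]} (hf : ∀ α β, (f α β).natDegree ≤ 1)
    (hg : ∀ α β, (g α β).natDegree ≤ 1) :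
    (pencilA f g).natDegree ≤ 2 ∧ (pencilB f g).natDegree ≤ 2 ∧ (pencilC f g).natDegree ≤ 2 := by
  have h : ∀ α β γ δ, (f α β * g γ δ).natDegree ≤ 2 := fun α β γ δ =>
    natDegree_mul_le.trans (by have := hf α β; have := hg γ δ; omega)
  refine ⟨natDegree_sub_le_of_le (h _ _ _ _) (h _ _ _ _), ?_,
    natDegree_sub_le_of_le (h _ _ _ _) (h _ _ _ _)⟩
  exact natDegree_add_le_of_degree_le (natDegree_sub_le_of_le (h _ _ _ _) (h _ _ _ _))
    (natDegree_sub_le_of_le (h _ _ _ _) (h _ _ _ _))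

theorem natDegree_curve (l : Fin 5 → Fin 2 → Fin 5 → R) (j : Fin 4) :
    (curveA l j).natDegree ≤ 2 ∧ (curveB l j).natDegree ≤ 2 ∧ (curveC l j).natDegree ≤ 2 := by
  have h := fun b c d => natDegree_pencil (natDegree_slotPoly l b c) (natDegree_slotPoly l b d)
  have h' := fun b c d => natDegree_pencil (f := fun β α => slotPoly l b c α β)
    (g := fun β α => slotPoly l b d α β) (fun α β => natDegree_slotPoly l b c β α)
    (fun α β => natDegree_slotPoly l b d β α)
  fin_cases j
  · exact h 2 3 4
  · simpa [curveA, curveB, curveC] using h' 2 3 4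
  · simpa [curveA, curveB, curveC] using h' 3 4 2
  · simpa [curveA, curveB, curveC] using h' 4 2 3

theorem natDegree_curveQ (l : Fin 5 → Fin 2 → Fin 5 → R) : (curveQ l).natDegree ≤ 4 := by
  obtain ⟨hA, hB, hC⟩ := natDegree_curve l 0
  have h4 : (4 * curveA l 0).natDegree ≤ 2 := natDegree_mul_le.trans (by simpa using hA)
  have h1 : (curveB l 0 ^ 2).natDegree ≤ 4 := natDegree_pow_le.trans (by omega)
  have h2 : (4 * curveA l 0 * curveC l 0).natDegree ≤ 4 := natDegree_mul_le.trans (by omega)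
  rw [curveQ]
  exact natDegree_sub_le_of_le h1 h2

theorem map_curve (φ : R →+* S) (l : Fin 5 → Fin 2 → Fin 5 → R) (j : Fin 4) :
    (curveA l j).map φ = curveA (fun j α => φ ∘ l j α) j ∧
    (curveB l j).map φ = curveB (fun j α => φ ∘ l j α) j ∧
    (curveC l j).map φ = curveC (fun j α => φ ∘ l j α) j := by
  fin_cases j <;>
    simp [curveA, curveB, curveC, ← coe_mapRingHom, map_pencil] <;>
    simp [map_slotPoly]

theorem map_curveQ (φ : R →+* S) (l : Fin 5 → Fin 2 → Fin 5 → R) :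
    (curveQ l).map φ = curveQ (fun j α => φ ∘ l j α) := by
  obtain ⟨h1, h2, h3⟩ := map_curve φ l 0
  simp [curveQ, h1, h2, h3]

end Curve

section Field
variable {K : Type*} [Field K] {l : Fin 5 → Fin 2 → Fin 5 → K} {w : Fin 5 → Fin 2 → K}

theorem eq_smul_of_root [NeZero (2 : K)] {a b y : K} {t : Fin 2 → K} (ha : a ≠ 0)
    (hy : y * t 0 = 2 * a * t 1 + b * t 0) (h0 : t 0 ≠ 0) :
    ∃ c ≠ (0 : K), t = c • ![2 * a, y - b] := by
  have h2 : (2 : K) ≠ 0 := NeZero.ne _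
  refine ⟨t 0 / (2 * a), div_ne_zero h0 (mul_ne_zero h2 ha), ?_⟩
  funext i
  fin_cases i
  · simp; field_simp
  · simp; field_simp; linear_combination -hy

/-- Every decomposition of a general tensor consists of points of the curve. -/
theorem Spread.exists_curve_point [NeZero (2 : K)] (hl : Spread l) (hw : ∀ j, w j ≠ 0)
    (h : ∀ j z, rowDet (Function.update (fun k => lin l k (w k)) j (lin l j z)) = 0)
    (h0 : w 0 0 ≠ 0) (hA : ∀ j, (curveA l j).eval (w 0 1 / w 0 0) ≠ 0) :
    ∃ y, y ^ 2 = (curveQ l).eval (w 0 1 / w 0 0) ∧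
      ∀ j : Fin 4, ∃ c ≠ (0 : K), w j.succ =
        c • ![2 * (curveA l j).eval (w 0 1 / w 0 0), y - (curveB l j).eval (w 0 1 / w 0 0)] := by
  set x := w 0 1 / w 0 0 with hx
  have hd := hl.det_update_eq_zero hw h
  have hbil : ∀ b c d : Fin 5, Function.Injective (rows5 0 1 b c d : Fin 5 → Fin 5) →
      bil (fun α β => (slotPoly l b c α β).eval x) (w 1) (w b) = 0 := by
    intro b c d hinj
    have h1 := bil_eq_zero rfl hd hinj (hw c)
    have h2 : lin l 0 (w 0) = w 0 0 • ((1 : K) • l 0 0 + x • l 0 1) +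
        (0 : K) • (0 : Fin 5 → K) := by
      rw [lin, smul_add, smul_smul, smul_smul, hx, mul_div_cancel₀ _ h0]; simp
    have h3 : ∀ α β, slotForm l (lin l 0 (w 0)) b c α β =
        w 0 0 * (slotPoly l b c α β).eval x := by
      intro α β
      rw [h2, slotForm, det5_lin0, eval_slotPoly, slotForm]
      ring
    have h4 : w 0 0 * bil (fun α β => (slotPoly l b c α β).eval x) (w 1) (w b) = 0 := by
      rw [← h1]
      simp only [bil, h3]
      ring
    exact (mul_eq_zero.1 h4).resolve_left h0
  have hne : ∀ j, ∃ a, w j a ≠ 0 := fun j => Function.ne_iff.1 (hw j)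
  have b23 := hbil 2 3 4 (by decide)
  have b24 := hbil 2 4 3 (by decide)
  have b34 := hbil 3 4 2 (by decide)
  have b32 := hbil 3 2 4 (by decide)
  have b42 := hbil 4 2 3 (by decide)
  have b43 := hbil 4 3 2 (by decide)
  set f := fun b c α β => (slotPoly l b c α β).eval x with hf
  have ev := fun f g => map_pencil (evalRingHom x) f g
  have c1 := slotPoly_cycle l 2 3 4
  have c2 := slotPoly_cycle l 3 4 2
  have r1 := pencil_root (f 2 3) (f 2 4) b23 b24
  have s2 := pencil_same_root (f 2 3) (f 2 4) b23 b24
  have s3 := pencil_same_root (f 3 4) (f 3 2) b34 b32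
  have s4 := pencil_same_root (f 4 2) (f 4 3) b42 b43
  have A0 : (curveA l 0).eval x = pencilA (f 2 3) (f 2 4) := (ev _ _).1
  have B0 : (curveB l 0).eval x = pencilB (f 2 3) (f 2 4) := (ev _ _).2.1
  have C0 : (curveC l 0).eval x = pencilC (f 2 3) (f 2 4) := (ev _ _).2.2
  have A0' : (curveA l 0).eval x = pencilA (f 3 4) (f 3 2) := by
    change eval x (pencilA _ _) = _; rw [c1.1]; exact (ev _ _).1
  have B0' : (curveB l 0).eval x = pencilB (f 3 4) (f 3 2) := by
    change eval x (pencilB _ _) = _; rw [c1.2.1]; exact (ev _ _).2.1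
  have A0'' : (curveA l 0).eval x = pencilA (f 4 2) (f 4 3) := by
    change eval x (pencilA _ _) = _; rw [c1.1, c2.1]; exact (ev _ _).1
  have B0'' : (curveB l 0).eval x = pencilB (f 4 2) (f 4 3) := by
    change eval x (pencilB _ _) = _; rw [c1.2.1, c2.2.1]; exact (ev _ _).2.1
  have neg_ev : ∀ p : K[X], (-p).eval x = -p.eval x := fun p => eval_neg p x
  have A1 : (curveA l 1).eval x = -pencilA (fun β α => f 2 3 α β) (fun β α => f 2 4 α β) :=
    (neg_ev _).trans (congrArg Neg.neg (ev _ _).1)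
  have B1 : (curveB l 1).eval x = -pencilB (fun β α => f 2 3 α β) (fun β α => f 2 4 α β) :=
    (neg_ev _).trans (congrArg Neg.neg (ev _ _).2.1)
  have A2 : (curveA l 2).eval x = -pencilA (fun β α => f 3 4 α β) (fun β α => f 3 2 α β) :=
    (neg_ev _).trans (congrArg Neg.neg (ev _ _).1)
  have B2 : (curveB l 2).eval x = -pencilB (fun β α => f 3 4 α β) (fun β α => f 3 2 α β) :=
    (neg_ev _).trans (congrArg Neg.neg (ev _ _).2.1)
  have A3 : (curveA l 3).eval x = -pencilA (fun β α => f 4 2 α β) (fun β α => f 4 3 α β) :=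
    (neg_ev _).trans (congrArg Neg.neg (ev _ _).1)
  have B3 : (curveB l 3).eval x = -pencilB (fun β α => f 4 2 α β) (fun β α => f 4 3 α β) :=
    (neg_ev _).trans (congrArg Neg.neg (ev _ _).2.1)
  rw [← A0, ← B0, ← A1, ← B1] at s2
  rw [← A0', ← B0', ← A2, ← B2] at s3
  rw [← A0'', ← B0'', ← A3, ← B3] at s4
  rw [← A0, ← B0, ← C0] at r1
  obtain ⟨a, ha⟩ := hne 2
  have r1' := (mul_eq_zero.1 (r1 a)).resolve_left ha
  have hnot : ∀ j, w j 0 = 0 → w j 1 ≠ 0 := by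
    intro j e0 e1
    obtain ⟨a, ha⟩ := hne j
    fin_cases a
    · exact ha e0
    · exact ha e1
  have h2 : (2 : K) ≠ 0 := NeZero.ne _
  have t0 : w 1 0 ≠ 0 := by
    intro e
    rw [e] at r1'
    have : (curveA l 0).eval x * w 1 1 ^ 2 = 0 := by linear_combination r1'
    rcases mul_eq_zero.1 this with h5 | h5
    · exact hA 0 h5
    · exact hnot 1 e (pow_eq_zero_iff two_ne_zero |>.1 h5)
  set y := (2 * (curveA l 0).eval x * w 1 1 + (curveB l 0).eval x * w 1 0) / w 1 0 with hy
  have hy0 : y * w 1 0 = 2 * (curveA l 0).eval x * w 1 1 + (curveB l 0).eval x * w 1 0 := by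
    rw [hy, div_mul_cancel₀ _ t0]
  have hslot : ∀ (j : Fin 4) (b : Fin 5),
      w b 0 * (2 * (curveA l 0).eval x * w 1 1 + (curveB l 0).eval x * w 1 0) =
        w 1 0 * (2 * (curveA l j).eval x * w b 1 + (curveB l j).eval x * w b 0) →
      ∃ c ≠ (0 : K), w b = c • ![2 * (curveA l j).eval x, y - (curveB l j).eval x] := by
    intro j b hb
    have hb' : y * w b 0 = 2 * (curveA l j).eval x * w b 1 + (curveB l j).eval x * w b 0 := by
      apply mul_left_cancel₀ t0
      linear_combination w b 0 * hy0 + hb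
    refine eq_smul_of_root (hA j) hb' fun e => ?_
    rw [e] at hb'
    have : 2 * (curveA l j).eval x * w b 1 = 0 := by linear_combination -hb'
    rcases mul_eq_zero.1 this with h5 | h5
    · exact mul_ne_zero h2 (hA j) h5
    · exact hnot b e h5
  refine ⟨y, ?_, ?_⟩
  · apply mul_left_cancel₀ (pow_ne_zero 2 t0)
    have hq : (curveQ l).eval x = (curveB l 0).eval x ^ 2 -
        4 * (curveA l 0).eval x * (curveC l 0).eval x := by simp [curveQ]
    rw [hq]
    linear_combination (y * w 1 0 + 2 * (curveA l 0).eval x * w 1 1 +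
      (curveB l 0).eval x * w 1 0) * hy0 + 4 * (curveA l 0).eval x * r1'
  · intro j
    fin_cases j
    · exact hslot 0 1 (by ring)
    · exact hslot 1 2 s2
    · exact hslot 2 3 s3
    · exact hslot 3 4 s4

end Field

section Tensor
variable {K : Type*} [Field K]

/-- A coordinate of a tensor. -/
noncomputable def tensorCoord (α : Fin 5 → Fin 2) : (⨂[K] _ : Fin 5, (Fin 2 → K)) →ₗ[K] K :=
  PiTensorProduct.lift
    ((MultilinearMap.mkPiAlgebra K (Fin 5) K).compLinearMap fun j => LinearMap.proj (α j))

theorem tensorCoord_tprod (α : Fin 5 → Fin 2) (w : Fin 5 → Fin 2 → K) :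
    tensorCoord α (⨂ₜ[K] j, w j) = ∏ j, w j (α j) := by
  simp [tensorCoord]

theorem tprod_eq_sum (w : Fin 5 → Fin 2 → K) :
    (⨂ₜ[K] j, w j) =
      ∑ α : Fin 5 → Fin 2, (∏ j, w j (α j)) • ⨂ₜ[K] j, (Pi.single (α j) 1 : Fin 2 → K) := by
  have h : w = fun j => ∑ a, w j a • (Pi.single a 1 : Fin 2 → K) := by
    funext j
    exact pi_eq_sum_univ' (w j)
  conv_lhs => rw [h]
  rw [MultilinearMap.map_sum]
  exact Finset.sum_congr rfl fun α _ => MultilinearMap.map_smul_univ _ _ _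

theorem sameTensor_iff (v w : Fin 5 → Fin 5 → Fin 2 → K) :
    SameTensor v w ↔ ∑ i, (⨂ₜ[K] j, v i j) = ∑ i, ⨂ₜ[K] j, w i j := by
  constructor
  · intro h
    simp only [tprod_eq_sum (v _), tprod_eq_sum (w _)]
    rw [Finset.sum_comm, Finset.sum_comm (γ := Fin 5)]
    refine Finset.sum_congr rfl fun α _ => ?_
    rw [← Finset.sum_smul, ← Finset.sum_smul, h α]
  · intro h α
    have := congrArg (tensorCoord α) h
    simpa only [map_sum, tensorCoord_tprod] using this

/-- The multiset of pure tensors given by a family of vectors. -/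
noncomputable def pures (w : Fin 5 → Fin 5 → Fin 2 → K) :
    Multiset (⨂[K] _ : Fin 5, (Fin 2 → K)) :=
  Finset.univ.val.map fun k => ⨂ₜ[K] j, w k j

theorem sum_pures (w : Fin 5 → Fin 5 → Fin 2 → K) : (pures w).sum = ∑ k, ⨂ₜ[K] j, w k j := rfl

theorem mem_pures {w : Fin 5 → Fin 5 → Fin 2 → K} {t} :
    t ∈ pures w ↔ ∃ k, (⨂ₜ[K] j, w k j) = t := by
  rw [pures, Multiset.mem_map]
  exact exists_congr fun k => and_iff_right (Finset.mem_univ k)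

theorem tprod_ne_zero {w : Fin 5 → Fin 2 → K} : (⨂ₜ[K] j, w j) ≠ 0 ↔ ∀ j, w j ≠ 0 := by
  constructor
  · intro h j hj
    exact h (MultilinearMap.map_coord_zero _ j hj)
  · intro h h0
    choose α hα using fun j => Function.ne_iff.1 (h j)
    have := congrArg (tensorCoord α) h0
    rw [tensorCoord_tprod, map_zero] at this
    exact Finset.prod_ne_zero_iff.2 (fun j _ => hα j) this

theorem exists_pures {D : Multiset (⨂[K] _ : Fin 5, (Fin 2 → K))} (hc : Multiset.card D = 5)
    (hD : ∀ t ∈ D, t ≠ 0 ∧ ∃ w : Fin 5 → Fin 2 → K, t = ⨂ₜ[K] j, w j) :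
    ∃ w : Fin 5 → Fin 5 → Fin 2 → K, D = pures w ∧ ∀ k j, w k j ≠ 0 := by
  obtain ⟨L, rfl⟩ : ∃ L : List _, D = (L : Multiset _) := ⟨D.toList, (Multiset.coe_toList D).symm⟩
  have hL : L.length = 5 := hc
  have hmem : ∀ k : Fin 5, L.get (k.cast hL.symm) ∈ (L : Multiset _) := fun k =>
    Multiset.mem_coe.2 (List.get_mem _ _)
  choose h0 w hw using fun k => hD _ (hmem k)
  refine ⟨w, ?_, fun k => tprod_ne_zero.1 (hw k ▸ h0 k)⟩
  rw [pures, Fin.univ_val_map]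
  simp only [← hw]
  congr 1
  apply List.ext_get
  · simp [hL]
  · intro n h1 h2
    simp only [List.get_eq_getElem, List.getElem_ofFn, Fin.val_cast]

theorem pures_perm {w w' : Fin 5 → Fin 5 → Fin 2 → K} (σ : Equiv.Perm (Fin 5))
    (h : ∀ k, (⨂ₜ[K] j, w' k j) = ⨂ₜ[K] j, w (σ k) j) : pures w' = pures w := by
  simp only [pures, h]
  refine (Multiset.map_map (fun k => ⨂ₜ[K] j, w k j) σ _).symm.trans ?_
  exact congrArg _ (Multiset.map_univ_val_equiv σ)

/-- The unipotent map `x ↦ (x₀ - s x₁, x₁)`. -/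
def shear (s : K) : (Fin 2 → K) →ₗ[K] (Fin 2 → K) where
  toFun x := ![x 0 - s * x 1, x 1]
  map_add' x y := by funext i; fin_cases i <;> simp; ring
  map_smul' c x := by funext i; fin_cases i <;> simp; ring

theorem shear_apply (s : K) (x : Fin 2 → K) : shear s x = ![x 0 - s * x 1, x 1] := rfl

theorem shear_neg_shear (s : K) (x : Fin 2 → K) : shear (-s) (shear s x) = x := by
  funext i; fin_cases i <;> simp [shear_apply]

theorem br_shear (s : K) (x y : Fin 2 → K) : br (shear s x) (shear s y) = br x y := by
  simp [br, shear_apply]; ring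

theorem shear_ne_zero {s : K} {x : Fin 2 → K} (hx : x ≠ 0) : shear s x ≠ 0 := by
  intro h
  apply hx
  rw [← shear_neg_shear s x, h, map_zero]

/-- The action of a tuple of unipotent maps on families of vectors. -/
def shears (t : Fin 5 → K) (v : Fin 5 → Fin 5 → Fin 2 → K) : Fin 5 → Fin 5 → Fin 2 → K :=
  fun i j => shear (t j) (v i j)

theorem shears_add (t t' : Fin 5 → K) (v : Fin 5 → Fin 5 → Fin 2 → K) :
    shears t (shears t' v) = shears (t + t') v := by
  funext i j a
  fin_cases a <;> simp [shears, shear_apply]; ring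

theorem pures_shears (t : Fin 5 → K) (v : Fin 5 → Fin 5 → Fin 2 → K) :
    pures (shears t v) = (pures v).map (PiTensorProduct.map fun j => shear (t j)) := by
  simp [pures, shears, PiTensorProduct.map_tprod]

theorem pures_shears_injective {t : Fin 5 → K} {v w : Fin 5 → Fin 5 → Fin 2 → K}
    (h : pures (shears t v) = pures (shears t w)) : pures v = pures w := by
  have e : ∀ v, shears (-t) (shears t v) = v := fun v => by
    rw [shears_add]; funext i j a; fin_cases a <;> simp [shears, shear_apply]
  rw [← e v, ← e w, pures_shears (-t), h, ← pures_shears]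

theorem SameTensor.shears {v w : Fin 5 → Fin 5 → Fin 2 → K} (h : SameTensor v w) (t : Fin 5 → K) :
    SameTensor (shears t v) (shears t w) := by
  rw [sameTensor_iff, ← sum_pures, ← sum_pures, pures_shears, pures_shears, Multiset.sum_hom,
    Multiset.sum_hom, sum_pures, sum_pures, (sameTensor_iff v w).1 h]

end Tensor

section Slots
variable {R S : Type*} [CommRing R] [CommRing S]

/-- The matrices of the covariants `inv6`, slot by slot. -/
def slots (v : Fin 5 → Fin 5 → Fin 2 → R) : Fin 5 → Fin 2 → Fin 5 → R :=
  fun j α => inv6 (fun i => v i j) (Pi.single α 1)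

theorem lin_slots (v : Fin 5 → Fin 5 → Fin 2 → R) (j : Fin 5) (x : Fin 2 → R) :
    lin (slots v) j x = inv6 (fun i => v i j) x := by
  rw [inv6_eq_sum, Fin.sum_univ_two]; rfl

theorem Phi_eq_rowDet (v : Fin 5 → Fin 5 → Fin 2 → R) (x : Fin 5 → Fin 2 → R) :
    Phi v x = rowDet (fun k => lin (slots v) k (x k)) := by
  simp only [lin_slots]
  rw [Phi]
  exact det_of_rows fun j => inv6 (fun i => v i j) (x j)

theorem map_br (φ : R →+* S) (a b : Fin 2 → R) : φ (br a b) = br (φ ∘ a) (φ ∘ b) := by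
  simp [br]

theorem map_slots (φ : R →+* S) (v : Fin 5 → Fin 5 → Fin 2 → R) (j : Fin 5) (α : Fin 2) :
    φ ∘ slots v j α = slots (fun i j α => φ (v i j α)) j α := by
  have h : φ ∘ (Pi.single α 1 : Fin 2 → R) = Pi.single α 1 := by
    funext b; fin_cases α <;> fin_cases b <;> simp
  funext r
  fin_cases r <;> simp [slots, inv6, map_br, h] <;> rfl

end Slots

section Chart
variable {K : Type*} [Field K]

/-- The affine coordinates on the curve of the members of a decomposition. -/
noncomputable def chartPt (l : Fin 5 → Fin 2 → Fin 5 → K) (w : Fin 5 → Fin 2 → K) : K × K :=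
  (w 0 1 / w 0 0, 2 * (curveA l 0).eval (w 0 1 / w 0 0) * (w 1 1 / w 1 0) +
    (curveB l 0).eval (w 0 1 / w 0 0))

/-- The pure tensors given by `w` lie in the domain of the affine chart of the curve. -/
def InChart (l : Fin 5 → Fin 2 → Fin 5 → K) (w : Fin 5 → Fin 5 → Fin 2 → K) : Prop :=
  ∀ k, w k 0 0 ≠ 0 ∧ ∀ j, (curveA l j).eval (w k 0 1 / w k 0 0) ≠ 0

theorem evalPt_curveVec_zero (A B : Fin 4 → K[X]) (q : K[X]) (s : K × K) :
    (fun a => evalPt q s (curveVec A B q 0 a)) = ![1, s.1] := by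
  funext a
  fin_cases a <;>
    simp [curveVec, evalPt_apply, QuadraticAlgebra.re_one, QuadraticAlgebra.im_one]

theorem evalPt_curveVec_succ (A B : Fin 4 → K[X]) (q : K[X]) (s : K × K) (j : Fin 4) :
    (fun a => evalPt q s (curveVec A B q j.succ a)) =
      ![2 * (A j).eval s.1, s.2 - (B j).eval s.1] := by
  funext a
  fin_cases a <;> simp [curveVec, evalPt_apply]
  ring

variable {v w : Fin 5 → Fin 5 → Fin 2 → K}

theorem SameTensor.exists_scalar [CharZero K] (h : SameTensor v w) (hl : Spread (slots v))
    (hw : ∀ k j, w k j ≠ 0) (hc : InChart (slots v) w) (k : Fin 5) :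
    IsGood (curveA (slots v)) (curveQ (slots v)) (chartPt (slots v) (w k)) ∧
    ∃ e ≠ (0 : K), ∀ α : Fin 5 → Fin 2, ∏ j, w k j (α j) =
      e * ∏ j, evalPt (curveQ (slots v)) (chartPt (slots v) (w k))
        (curveVec (curveA (slots v)) (curveB (slots v)) (curveQ (slots v)) j (α j)) := by
  set l := slots v with hl_def
  obtain ⟨y, hy, hj⟩ := hl.exists_curve_point (hw k) (fun j z => by
    have := h.Phi_update_eq_zero k j z
    rw [Phi_eq_rowDet] at this
    rw [← this]
    congr 1
    funext m
    by_cases hm : m = j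
    · subst hm; simp [hl_def]
    · simp [Function.update_of_ne hm, hl_def]) (hc k).1 (hc k).2
  choose c hc0 hcj using hj
  have hA := (hc k).2
  set x := w k 0 1 / w k 0 0 with hx
  have h10 : w k 1 0 = c 0 * (2 * (curveA l 0).eval x) := by
    have := congrFun (hcj 0) 0
    simpa using this
  have h11 : w k 1 1 = c 0 * (y - (curveB l 0).eval x) := by
    have := congrFun (hcj 0) 1
    simpa using this
  have hpt : chartPt l (w k) = (x, y) := by
    rw [chartPt, ← hx, h10, h11]
    have := hA 0
    have := hc0 0
    congr 1
    field_simp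
    ring
  rw [hpt]
  refine ⟨⟨hy, hA⟩, w k 0 0 * ∏ j, c j, mul_ne_zero (hc k).1
    (Finset.prod_ne_zero_iff.2 fun j _ => hc0 j), fun α => ?_⟩
  rw [Fin.prod_univ_succ, Fin.prod_univ_succ (n := 4)]
  have e0 : w k 0 (α 0) = w k 0 0 * evalPt (curveQ l) (x, y)
      (curveVec (curveA l) (curveB l) (curveQ l) 0 (α 0)) := by
    have := congrFun (evalPt_curveVec_zero (curveA l) (curveB l) (curveQ l) (x, y)) (α 0)
    simp only at this
    rw [this]
    have h0 := (hc k).1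
    generalize α 0 = a
    fin_cases a
    · simp
    · simp [hx]; field_simp
  have e1 : ∀ j : Fin 4, w k j.succ (α j.succ) = c j * evalPt (curveQ l) (x, y)
      (curveVec (curveA l) (curveB l) (curveQ l) j.succ (α j.succ)) := by
    intro j
    have := congrFun (evalPt_curveVec_succ (curveA l) (curveB l) (curveQ l) (x, y) j) (α j.succ)
    simp only at this
    rw [this, hcj j]
    simp
  rw [e0, Finset.prod_congr rfl fun j _ => e1 j, Finset.prod_mul_distrib]
  ring

theorem sum_evalPt_pull {A B : Fin 4 → K[X]} {q : K[X]} {p : Fin 5 → K × K} {d : Fin 5 → K}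
    (hp : ∀ i, (p i).2 ^ 2 = q.eval (p i).1)
    (hv : ∀ i (α : Fin 5 → Fin 2), ∏ j, v i j (α j) =
      d i * ∏ j, evalPt q (p i) (curveVec A B q j (α j))) (g : (Fin 5 → Fin 2) → K) :
    ∑ i, d i * evalPt q (p i) (pull A B q g) = ∑ α, g α * ∑ i, ∏ j, v i j (α j) := by
  simp only [evalPt_pull A B q _ (hp _), multiEval, hv, Finset.mul_sum, Algebra.algebraMap_self,
    RingHom.id_apply]
  rw [Finset.sum_comm]
  exact Finset.sum_congr rfl fun _ _ => Finset.sum_congr rfl fun _ _ => by ring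

theorem related_iff_sameTensor {A B : Fin 4 → K[X]} {q : K[X]} {p r : Fin 5 → K × K}
    {d e : Fin 5 → K} (hp : ∀ i, (p i).2 ^ 2 = q.eval (p i).1)
    (hr : ∀ i, (r i).2 ^ 2 = q.eval (r i).1)
    (hv : ∀ i (α : Fin 5 → Fin 2), ∏ j, v i j (α j) =
      d i * ∏ j, evalPt q (p i) (curveVec A B q j (α j)))
    (hw : ∀ i (α : Fin 5 → Fin 2), ∏ j, w i j (α j) =
      e i * ∏ j, evalPt q (r i) (curveVec A B q j (α j))) :
    Related A B q p d r e ↔ SameTensor v w := by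
  simp only [Related, sum_evalPt_pull hp hv, sum_evalPt_pull hr hw]
  constructor
  · intro h α
    simpa [Pi.single_apply] using h (Pi.single α 1)
  · intro h g
    exact Finset.sum_congr rfl fun α _ => by rw [h α]

end Chart

section Generic
variable {K : Type*} [Field K] {v w w' : Fin 5 → Fin 5 → Fin 2 → K}

/-- The genericity assumptions on a family of vectors. -/
structure Generic (v : Fin 5 → Fin 5 → Fin 2 → K) : Prop where
  spread : Spread (slots v)
  adm : Admissible (curveA (slots v)) (curveB (slots v)) (curveQ (slots v))
  ne_zero : ∀ i j, v i j 0 ≠ 0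
  chart : InChart (slots v) v
  inj : Function.Injective fun i => v i 0 1 / v i 0 0
  spans : Spans (curveA (slots v)) (curveB (slots v)) (curveQ (slots v))
    fun i => chartPt (slots v) (v i)
  exists_section : ∃ h, ∃ l : K, l ≠ 0 ∧
    (nm (pull (curveA (slots v)) (curveB (slots v)) (curveQ (slots v)) h)).natDegree = 18 ∧
    (nm (pull (curveA (slots v)) (curveB (slots v)) (curveQ (slots v)) h)).Separable ∧
    ∀ i, evalPt (curveQ (slots v)) (chartPt (slots v) (v i))
        (pull (curveA (slots v)) (curveB (slots v)) (curveQ (slots v)) h) = 0 ∧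
      (∏ j, v i j 0) * derivPt (curveQ (slots v)) (chartPt (slots v) (v i))
        (pull (curveA (slots v)) (curveB (slots v)) (curveQ (slots v)) h) =
      l * ∏ j, evalPt (curveQ (slots v)) (chartPt (slots v) (v i))
        (curveVec (curveA (slots v)) (curveB (slots v)) (curveQ (slots v)) j 0)

theorem SameTensor.refl (v : Fin 5 → Fin 5 → Fin 2 → K) : SameTensor v v := fun _ => rfl

theorem Generic.vec_ne_zero (hv : Generic v) (i j : Fin 5) : v i j ≠ 0 := fun h =>
  hv.ne_zero i j (congrFun h 0)

theorem pures_eq_of_perm {A B : Fin 4 → K[X]} {q : K[X]} {p r : Fin 5 → K × K} {d e : Fin 5 → K}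
    (hv : ∀ i (α : Fin 5 → Fin 2), ∏ j, v i j (α j) =
      d i * ∏ j, evalPt q (p i) (curveVec A B q j (α j)))
    (hw : ∀ i (α : Fin 5 → Fin 2), ∏ j, w i j (α j) =
      e i * ∏ j, evalPt q (r i) (curveVec A B q j (α j)))
    {σ : Equiv.Perm (Fin 5)} (h1 : r = p ∘ σ) (h2 : e = d ∘ σ) : pures w = pures v := by
  refine pures_perm σ fun k => ?_
  rw [tprod_eq_sum, tprod_eq_sum (v _)]
  refine Finset.sum_congr rfl fun α _ => ?_
  rw [hw, hv, h1, h2]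
  rfl

theorem div_eq_div_of_tprod_eq {x y : Fin 5 → Fin 2 → K} (hx : x 0 0 ≠ 0) (hy : ∀ j, y j 0 ≠ 0)
    (h : (⨂ₜ[K] j, x j) = ⨂ₜ[K] j, y j) : x 0 1 / x 0 0 = y 0 1 / y 0 0 := by
  have key : ∀ a, x 0 a * ∏ j : Fin 4, x j.succ 0 = y 0 a * ∏ j : Fin 4, y j.succ 0 := by
    intro a
    have := congrArg (tensorCoord (Fin.cons a fun _ => 0)) h
    rw [tensorCoord_tprod, tensorCoord_tprod, Fin.prod_univ_succ, Fin.prod_univ_succ (n := 4)] at this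
    simpa using this
  have hY : ∏ j : Fin 4, y j.succ 0 ≠ 0 := Finset.prod_ne_zero_iff.2 fun j _ => hy _
  have k0 := key 0
  have k1 := key 1
  rw [div_eq_div_iff hx (hy 0)]
  apply mul_right_cancel₀ hY
  linear_combination x 0 1 * (-k0) + x 0 0 * k1

variable [CharZero K] [IsAlgClosed K]

theorem Generic.exists_other (hv : Generic v) :
    ∃ w, (∀ k j, w k j ≠ 0) ∧ SameTensor v w ∧ pures w ≠ pures v := by
  have hc := (SameTensor.refl v).exists_scalar hv.spread hv.vec_ne_zero hv.chart
  choose hp d hd0 hd using hc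
  obtain ⟨h, l, hl0, hdeg, hsep, hs⟩ := hv.exists_section
  set A := curveA (slots v)
  set B := curveB (slots v)
  set q := curveQ (slots v)
  set p := fun i => chartPt (slots v) (v i) with hp_def
  obtain ⟨r, e, hr, he, hrel, hne⟩ := exists_residual hv.adm hp hv.inj hdeg hsep
    (d := d) (fun i => (hs i).1) hl0 (fun i => by
      have h1 := (hs i).2
      have h2 := hd i 0
      simp only [Pi.zero_apply] at h2
      have h3 : ∏ j, evalPt q (p i) (curveVec A B q j 0) ≠ 0 := by
        intro h0
        refine Finset.prod_ne_zero_iff.2 (fun j _ => hv.ne_zero i j) (h2.trans ?_)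
        rw [h0, mul_zero]
      apply mul_right_cancel₀ h3
      rw [← h1, h2]
      ring)
  let w : Fin 5 → Fin 5 → Fin 2 → K := fun k => Fin.cons
    (fun a => e k * evalPt q (r k) (curveVec A B q 0 a))
    (fun j a => evalPt q (r k) (curveVec A B q j.succ a))
  have hw : ∀ k (α : Fin 5 → Fin 2), ∏ j, w k j (α j) =
      e k * ∏ j, evalPt q (r k) (curveVec A B q j (α j)) := by
    intro k α
    rw [Fin.prod_univ_succ, Fin.prod_univ_succ (n := 4)]
    simp only [w, Fin.cons_zero, Fin.cons_succ]
    ring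
  have e0 : ∀ k a, evalPt q (r k) (curveVec A B q 0 a) = (![1, (r k).1] : Fin 2 → K) a :=
    fun k a => congrFun (evalPt_curveVec_zero A B q (r k)) a
  have e1 : ∀ k (j : Fin 4), evalPt q (r k) (curveVec A B q j.succ 0) ≠ 0 := by
    intro k j
    have := congrFun (evalPt_curveVec_succ A B q (r k) j) 0
    simp only [Matrix.cons_val_zero] at this
    rw [this]
    exact mul_ne_zero two_ne_zero ((hr k).2 j)
  have hw0 : ∀ k j, w k j 0 ≠ 0 := by
    intro k j
    refine Fin.cases ?_ (fun j => ?_) j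
    · simp only [w, Fin.cons_zero, e0]
      simpa using he k
    · simpa only [w, Fin.cons_succ] using e1 k j
  refine ⟨w, fun k j h => hw0 k j (congrFun h 0),
    (related_iff_sameTensor (fun i => (hp i).1) (fun k => (hr k).1) hd hw).1 hrel, fun heq => ?_⟩
  have hmem : (⨂ₜ[K] j, w 0 j) ∈ pures v := heq ▸ mem_pures.2 ⟨0, rfl⟩
  obtain ⟨i, hi⟩ := mem_pures.1 hmem
  have := div_eq_div_of_tprod_eq (hv.ne_zero i 0) (hw0 0) hi
  apply hne i 0
  change v i 0 1 / v i 0 0 = _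
  rw [this]
  simp only [w, Fin.cons_zero, e0]
  have := he 0
  simp
  field_simp

theorem Generic.pures_eq (hv : Generic v) (hw : ∀ k j, w k j ≠ 0) (hw' : ∀ k j, w' k j ≠ 0)
    (h : SameTensor v w) (h' : SameTensor v w') (hc : InChart (slots v) w)
    (hc' : InChart (slots v) w') : pures w = pures v ∨ pures w' = pures v ∨ pures w' = pures w := by
  classical
  choose hp d hd0 hd using (SameTensor.refl v).exists_scalar hv.spread hv.vec_ne_zero hv.chart
  choose hr e he0 he using h.exists_scalar hv.spread hw hc
  choose hr' e' he0' he' using h'.exists_scalar hv.spread hw' hc'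
  have rel := (related_iff_sameTensor (fun i => (hp i).1) (fun i => (hr i).1) hd he).2 h
  have rel' := (related_iff_sameTensor (fun i => (hp i).1) (fun i => (hr' i).1) hd he').2 h'
  have hinj : Function.Injective fun i => chartPt (slots v) (v i) := fun i j hij =>
    hv.inj (congrArg Prod.fst hij)
  rcases rel.dichotomy hv.adm hv.spans hp hr hinj hd0 with ⟨σ, h1, h2⟩ | ⟨h1, h2⟩
  · exact Or.inl (pures_eq_of_perm hd he h1 h2)
  rcases rel'.dichotomy hv.adm hv.spans hp hr' hinj hd0 with ⟨σ, h1', h2'⟩ | ⟨h1', h2'⟩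
  · exact Or.inr (Or.inl (pures_eq_of_perm hd he' h1' h2'))
  obtain ⟨σ, h3, h4⟩ := rel.unique hv.adm hv.spans rel' hp hr hr' hv.inj h1 h1' h2 h2' hd0 he0 he0'
  exact Or.inr (Or.inr (pures_eq_of_perm he he' h3 h4))

end Generic

section Shear
variable {K : Type*} [Field K]

/-- The effect of `shears` on `slots`. -/
def shearSlots (t : Fin 5 → K) (l : Fin 5 → Fin 2 → Fin 5 → K) : Fin 5 → Fin 2 → Fin 5 → K :=
  fun j => ![l j 0, (1 : K) • l j 1 + t j • l j 0]

theorem inv6_shear (s : K) (u : Fin 5 → Fin 2 → K) (x : Fin 2 → K) :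
    inv6 (fun i => shear s (u i)) (shear s x) = inv6 u x := by
  simp only [inv6, br_shear]

theorem slots_shears (t : Fin 5 → K) (v : Fin 5 → Fin 5 → Fin 2 → K) :
    slots (shears t v) = shearSlots t (slots v) := by
  funext j α
  have h0 : (Pi.single 0 1 : Fin 2 → K) = shear (t j) (Pi.single 0 1) := by
    funext a; fin_cases a <;> simp [shear_apply]
  have h1 : (Pi.single 1 1 : Fin 2 → K) = shear (t j) ![t j, 1] := by
    funext a; fin_cases a <;> simp [shear_apply]
  fin_cases α
  · change inv6 (fun i => shear (t j) (v i j)) (Pi.single 0 1) = _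
    rw [h0, inv6_shear]; rfl
  · change inv6 (fun i => shear (t j) (v i j)) (Pi.single 1 1) = _
    rw [h1, inv6_shear, ← lin_slots]
    simp [lin, shearSlots, add_comm]

theorem slotForm_shearSlots (t : Fin 5 → K) (l : Fin 5 → Fin 2 → Fin 5 → K) (p : Fin 5 → K)
    (b c : Fin 5) :
    slotForm (shearSlots t l) p b c = ![![slotForm l p b c 0 0,
      slotForm l p b c 0 1 + t b * slotForm l p b c 0 0],
      ![slotForm l p b c 1 0 + t 1 * slotForm l p b c 0 0,
      slotForm l p b c 1 1 + t 1 * slotForm l p b c 0 1 + t b * slotForm l p b c 1 0 +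
        t 1 * t b * slotForm l p b c 0 0]] := by
  have h0 : ∀ a b' c', det5 p a b' c' c' = 0 := fun a b' c' =>
    det5_eq_zero_of_eq (i := 3) (j := 4) (by decide) rfl
  have s0 : ∀ j, shearSlots t l j 0 = l j 0 := fun _ => rfl
  have s1 : ∀ j, shearSlots t l j 1 = (1 : K) • l j 1 + t j • l j 0 := fun _ => rfl
  funext α β
  fin_cases α <;> fin_cases β
  · change slotForm _ p b c 0 0 = slotForm l p b c 0 0
    simp only [slotForm, s0, s1, det5_lin4, h0]; ring
  · change slotForm _ p b c 0 1 = slotForm l p b c 0 1 + t b * slotForm l p b c 0 0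
    simp only [slotForm, s0, s1, det5_lin4, det5_lin2, h0]; ring
  · change slotForm _ p b c 1 0 = slotForm l p b c 1 0 + t 1 * slotForm l p b c 0 0
    simp only [slotForm, s0, s1, det5_lin4, det5_lin1, h0]; ring
  · change slotForm _ p b c 1 1 = slotForm l p b c 1 1 + t 1 * slotForm l p b c 0 1 +
      t b * slotForm l p b c 1 0 + t 1 * t b * slotForm l p b c 0 0
    simp only [slotForm, s0, s1, det5_lin4, det5_lin2, det5_lin1, h0]; ring

theorem slotPoly_shearSlots (t : Fin 5 → K) (ht : t 0 = 0) (l : Fin 5 → Fin 2 → Fin 5 → K)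
    (b c : Fin 5) :
    slotPoly (shearSlots t l) b c = ![![slotPoly l b c 0 0,
      slotPoly l b c 0 1 + C (t b) * slotPoly l b c 0 0],
      ![slotPoly l b c 1 0 + C (t 1) * slotPoly l b c 0 0,
      slotPoly l b c 1 1 + C (t 1) * slotPoly l b c 0 1 + C (t b) * slotPoly l b c 1 0 +
        C (t 1 * t b) * slotPoly l b c 0 0]] := by
  have h0 : shearSlots t l 0 0 = l 0 0 := rfl
  have h1 : shearSlots t l 0 1 = l 0 1 := by simp [shearSlots, ht]
  funext α β
  rw [slotPoly, h0, h1, slotForm_shearSlots, slotForm_shearSlots]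
  fin_cases α <;> fin_cases β <;> simp [slotPoly] <;> ring

theorem curveA_shearSlots (t : Fin 5 → K) (ht : t 0 = 0) (l : Fin 5 → Fin 2 → Fin 5 → K)
    (j : Fin 4) :
    curveA (shearSlots t l) j =
      curveA l j + C (t j.succ) * curveB l j + C (t j.succ) ^ 2 * curveC l j := by
  simp only [curveA, curveB, curveC, slotPoly_shearSlots t ht]
  fin_cases j <;> simp [pencilA, pencilB, pencilC] <;> ring

theorem exists_eval_shears (P : MvPolynomial (Fin 5 × Fin 5 × Fin 2) K)
    (v : Fin 5 → Fin 5 → Fin 2 → K) (τ : Fin 5 → K) :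
    ∃ f : K[X], ∀ s, f.eval s =
      MvPolynomial.eval (fun p => shears (s • τ) v p.1 p.2.1 p.2.2) P := by
  refine ⟨MvPolynomial.eval₂ C (fun p => (![C (v p.1 p.2.1 0) - X * C (τ p.2.1) *
    C (v p.1 p.2.1 1), C (v p.1 p.2.1 1)] : Fin 2 → K[X]) p.2.2) P, fun s => ?_⟩
  rw [← coe_evalRingHom, MvPolynomial.hom_eval₂, MvPolynomial.eval, MvPolynomial.coe_eval₂Hom]
  congr 1
  · ext; simp
  · funext p
    obtain ⟨i, j, a⟩ := p
    fin_cases a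
    · simp only [shears, shear_apply]
      simp [mul_comm s]
    · simp [shears, shear_apply]

theorem exists_eval_ne_zero [Infinite K] {f : K[X]} (hf : f ≠ 0) : ∃ s, f.eval s ≠ 0 := by
  by_contra! h
  exact hf (Polynomial.funext fun s => by simpa using h s)

variable {P : MvPolynomial (Fin 5 × Fin 5 × Fin 2) K}
  {v w w' : Fin 5 → Fin 5 → Fin 2 → K}

theorem Generic.quadratic_ne_zero (hv : Generic v) (x : K) (j : Fin 4) :
    C ((curveA (slots v) j).eval x) + C ((curveB (slots v) j).eval x) * X +
      C ((curveC (slots v) j).eval x) * X ^ 2 ≠ 0 := by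
  intro h
  have h0 : (curveA (slots v) j).eval x = 0 := by
    have := congrArg (fun f => coeff f 0) h
    simpa [coeff_C] using this
  have h1 : (curveB (slots v) j).eval x = 0 := by
    have := congrArg (fun f => coeff f 1) h
    simpa [coeff_C, coeff_X_pow] using this
  have h2 : (curveC (slots v) j).eval x = 0 := by
    have := congrArg (fun f => coeff f 2) h
    simpa [coeff_C, coeff_X] using this
  have d0 := dvd_iff_isRoot.2 h0
  have d1 := dvd_iff_isRoot.2 h1
  have d2 := dvd_iff_isRoot.2 h2
  have hd : (X - C x) * (X - C x) ∣ curveQ (slots v) := by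
    rw [← curve_disc _ j, sq]
    exact dvd_sub (mul_dvd_mul d1 d1) (mul_dvd_mul (dvd_mul_of_dvd_right d0 _) d2)
  exact (irreducible_X_sub_C x).not_isUnit (hv.adm.sqf _ hd)

theorem exists_inChart [Infinite K] (hP : ∀ v : Fin 5 → Fin 5 → Fin 2 → K,
      MvPolynomial.eval (fun p => v p.1 p.2.1 p.2.2) P ≠ 0 → Generic v)
    (hv : MvPolynomial.eval (fun p => v p.1 p.2.1 p.2.2) P ≠ 0)
    {u : Fin 2 → Fin 5 → Fin 5 → Fin 2 → K} (hu : ∀ m k j, u m k j ≠ 0) :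
    ∃ t, Generic (shears t v) ∧ ∀ m, InChart (slots (shears t v)) (shears t (u m)) := by
  obtain ⟨f, hf⟩ := exists_eval_shears P v (Pi.single 0 1)
  have hf0 : f ≠ 0 := by
    rintro rfl
    apply hv
    have := hf 0
    rw [eval_zero] at this
    rw [this]
    congr
    funext p
    obtain ⟨i, j, a⟩ := p
    fin_cases a <;> simp [shears, shear_apply]
  have hlin : ∀ m k, C (u m k 0 0) - X * C (u m k 0 1) ≠ 0 := by
    intro m k h
    apply hu m k 0
    funext a
    have h0 := congrArg (fun f => coeff f 0) h
    have h1 := congrArg (fun f => coeff f 1) h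
    fin_cases a
    · simpa using h0
    · simpa [coeff_C] using h1
  obtain ⟨s, hs⟩ := exists_eval_ne_zero (mul_ne_zero hf0 (Finset.prod_ne_zero_iff.2
    fun m _ => Finset.prod_ne_zero_iff.2 fun k _ => hlin m k))
  rw [eval_mul, mul_ne_zero_iff, hf, eval_prod, Finset.prod_ne_zero_iff] at hs
  obtain ⟨hs1, hs2⟩ := hs
  set t₁ : Fin 5 → K := s • Pi.single 0 1 with ht₁
  set v₁ := shears t₁ v with hv₁
  have hu0 : ∀ m k, shears t₁ (u m) k 0 0 ≠ 0 := by
    intro m k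
    have := hs2 m (Finset.mem_univ m)
    rw [eval_prod, Finset.prod_ne_zero_iff] at this
    have h1 : t₁ 0 = s := by simp [ht₁]
    change u m k 0 0 - t₁ 0 * u m k 0 1 ≠ 0
    rw [h1]
    simpa only [eval_sub, eval_mul, eval_X, eval_C] using this k (Finset.mem_univ k)
  have hg₁ := hP v₁ hs1
  obtain ⟨f', hf'⟩ := exists_eval_shears P v₁ (fun j => if j = 0 then 0 else 1)
  have hf0' : f' ≠ 0 := by
    rintro rfl
    apply hs1
    have := hf' 0
    rw [eval_zero] at this
    rw [this]
    congr
    funext p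
    obtain ⟨i, j, a⟩ := p
    fin_cases a <;> simp [shears, shear_apply]
  obtain ⟨s', hs'⟩ := exists_eval_ne_zero (mul_ne_zero hf0' (Finset.prod_ne_zero_iff.2
    fun m _ => Finset.prod_ne_zero_iff.2 fun k _ => Finset.prod_ne_zero_iff.2 fun j _ =>
      hg₁.quadratic_ne_zero (shears t₁ (u m) k 0 1 / shears t₁ (u m) k 0 0) j))
  rw [eval_mul, mul_ne_zero_iff, hf', eval_prod, Finset.prod_ne_zero_iff] at hs'
  obtain ⟨hs1', hs2'⟩ := hs'
  set t₂ : Fin 5 → K := s' • fun j => if j = 0 then 0 else 1 with ht₂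
  have ht20 : t₂ 0 = 0 := by simp [ht₂]
  have ht2s : ∀ j : Fin 4, t₂ j.succ = s' := by simp [ht₂]
  have hx : ∀ m k a, shears t₂ (shears t₁ (u m)) k 0 a = shears t₁ (u m) k 0 a := by
    intro m k a
    fin_cases a <;> simp [shears, shear_apply, ht20]
  refine ⟨t₂ + t₁, ?_, fun m k => ?_⟩
  · rw [← shears_add]
    exact hP _ hs1'
  · rw [← shears_add, ← shears_add, hx, hx]
    refine ⟨hu0 m k, fun j => ?_⟩
    have := hs2' m (Finset.mem_univ m)
    rw [eval_prod, Finset.prod_ne_zero_iff] at this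
    have := this k (Finset.mem_univ k)
    rw [eval_prod, Finset.prod_ne_zero_iff] at this
    have := this j (Finset.mem_univ j)
    rw [slots_shears t₂, curveA_shearSlots t₂ ht20, ht2s]
    convert this using 1
    simp
    ring

theorem pures_eq_of_generic [CharZero K] [IsAlgClosed K] (hP : ∀ v : Fin 5 → Fin 5 → Fin 2 → K,
      MvPolynomial.eval (fun p => v p.1 p.2.1 p.2.2) P ≠ 0 → Generic v)
    (hv : MvPolynomial.eval (fun p => v p.1 p.2.1 p.2.2) P ≠ 0)
    (hw : ∀ k j, w k j ≠ 0) (hw' : ∀ k j, w' k j ≠ 0)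
    (h : SameTensor v w) (h' : SameTensor v w') :
    pures w = pures v ∨ pures w' = pures v ∨ pures w' = pures w := by
  obtain ⟨t, hg, hc⟩ := exists_inChart hP hv (u := ![w, w']) (fun m => by
    fin_cases m
    · exact hw
    · exact hw')
  have := hg.pures_eq (fun k j => shear_ne_zero (hw k j)) (fun k j => shear_ne_zero (hw' k j))
    (h.shears t) (h'.shears t) (hc 0) (hc 1)
  exact this.imp pures_shears_injective (Or.imp pures_shears_injective pures_shears_injective)

end Shear

section ClearDenominators
variable {σ τ : Type} [Fintype τ] [DecidableEq τ]

theorem exists_clear_denominators (f : τ → σ) (Q : MvPolynomial (σ ⊕ τ) ℤ) :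
    ∃ (P : MvPolynomial σ ℤ) (N : ℕ), ∀ (K : Type) [Field K] (v : σ → K),
      (∀ t, v (f t) ≠ 0) → MvPolynomial.eval₂ (Int.castRingHom K) v P =
        (∏ t, v (f t)) ^ N *
          MvPolynomial.eval₂ (Int.castRingHom K) (Sum.elim v fun t => (v (f t))⁻¹) Q := by
  induction Q using MvPolynomial.induction_on with
  | C a => exact ⟨MvPolynomial.C a, 0, fun K _ v _ => by
      rw [MvPolynomial.eval₂_C, MvPolynomial.eval₂_C, pow_zero, one_mul]⟩
  | add Q₁ Q₂ h₁ h₂ =>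
    obtain ⟨P₁, N₁, h₁⟩ := h₁
    obtain ⟨P₂, N₂, h₂⟩ := h₂
    refine ⟨P₁ * (∏ t, MvPolynomial.X (f t)) ^ N₂ + P₂ * (∏ t, MvPolynomial.X (f t)) ^ N₁,
      N₁ + N₂, fun K _ v hv => ?_⟩
    have hX : MvPolynomial.eval₂ (Int.castRingHom K) v (∏ t, MvPolynomial.X (f t)) =
        ∏ t, v (f t) := by
      rw [MvPolynomial.eval₂_prod]; simp
    rw [MvPolynomial.eval₂_add, MvPolynomial.eval₂_mul, MvPolynomial.eval₂_mul,
      MvPolynomial.eval₂_pow, MvPolynomial.eval₂_pow, hX, h₁ K v hv, h₂ K v hv,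
      MvPolynomial.eval₂_add]
    ring
  | mul_X Q s h =>
    obtain ⟨P, N, h⟩ := h
    cases s with
    | inl s =>
      refine ⟨P * MvPolynomial.X s, N, fun K _ v hv => ?_⟩
      rw [MvPolynomial.eval₂_mul, MvPolynomial.eval₂_mul, h K v hv, MvPolynomial.eval₂_X,
        MvPolynomial.eval₂_X, Sum.elim_inl, mul_assoc]
    | inr t =>
      refine ⟨P * ∏ t' ∈ Finset.univ.erase t, MvPolynomial.X (f t'), N + 1, fun K _ v hv => ?_⟩
      rw [MvPolynomial.eval₂_mul, MvPolynomial.eval₂_mul, h K v hv, MvPolynomial.eval₂_X,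
        Sum.elim_inr, MvPolynomial.eval₂_prod, pow_succ,
        ← Finset.mul_prod_erase _ _ (Finset.mem_univ t)]
      simp only [MvPolynomial.eval₂_X]
      have := hv t
      field_simp

end ClearDenominators

/-- A natural family of functions of `v` and `u`, the latter standing for the inverses of some of
the former, is nonzero on a dense open set as soon as it does not vanish at one point over some
field. -/
theorem exists_polynomial_of_natural
    (F : ∀ (R : Type) [CommRing R], (Fin 5 → Fin 5 → Fin 2 → R) → (Fin 5 → Fin 5 → R) → R)
    (hF : ∀ (R S : Type) [CommRing R] [CommRing S] (φ : R →+* S) v u,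
      φ (F R v u) = F S (fun i j a => φ (v i j a)) (fun i j => φ (u i j)))
    {k : Type} [Field k] {v₀ : Fin 5 → Fin 5 → Fin 2 → k} (hv₀ : ∀ i j, v₀ i j 0 = 1)
    (h₀ : F k v₀ (fun _ _ => 1) ≠ 0) :
    ∃ P : MvPolynomial (Fin 5 × Fin 5 × Fin 2) ℂ, P ≠ 0 ∧
      ∀ v : Fin 5 → Fin 5 → Fin 2 → ℂ, (∀ i j, v i j 0 ≠ 0) →
        MvPolynomial.eval (fun p => v p.1 p.2.1 p.2.2) P ≠ 0 →
        F ℂ v (fun i j => (v i j 0)⁻¹) ≠ 0 := by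
  set Q : MvPolynomial ((Fin 5 × Fin 5 × Fin 2) ⊕ (Fin 5 × Fin 5)) ℤ :=
    F _ (fun i j a => MvPolynomial.X (Sum.inl (i, j, a)))
      (fun i j => MvPolynomial.X (Sum.inr (i, j))) with hQ
  have hQe : ∀ (K : Type) [Field K] (v : Fin 5 → Fin 5 → Fin 2 → K) (u : Fin 5 → Fin 5 → K),
      MvPolynomial.eval₂ (Int.castRingHom K)
        (Sum.elim (fun p => v p.1 p.2.1 p.2.2) (fun p => u p.1 p.2)) Q = F K v u := by
    intro K _ v u
    have := hF _ K (MvPolynomial.eval₂Hom (Int.castRingHom K)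
      (Sum.elim (fun p => v p.1 p.2.1 p.2.2) (fun p => u p.1 p.2)))
      (fun i j a => MvPolynomial.X (Sum.inl (i, j, a)))
      (fun i j => MvPolynomial.X (Sum.inr (i, j)))
    simpa using this
  obtain ⟨P, N, hP⟩ := exists_clear_denominators
    (fun p : Fin 5 × Fin 5 => ((p.1, p.2, 0) : Fin 5 × Fin 5 × Fin 2)) Q
  have hPQ : ∀ (K : Type) [Field K] (v : Fin 5 → Fin 5 → Fin 2 → K), (∀ i j, v i j 0 ≠ 0) →
      MvPolynomial.eval₂ (Int.castRingHom K) (fun p => v p.1 p.2.1 p.2.2) P =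
        (∏ p : Fin 5 × Fin 5, v p.1 p.2 0) ^ N * F K v (fun i j => (v i j 0)⁻¹) := by
    intro K _ v hv
    rw [hP K _ fun p => hv p.1 p.2, ← hQe K v]
  refine ⟨MvPolynomial.map (Int.castRingHom ℂ) P, fun h => h₀ ?_, fun v hv he h0 => he ?_⟩
  · have hP0 : P = 0 := by
      apply MvPolynomial.map_injective _ (RingHom.injective_int (Int.castRingHom ℂ))
      rw [h, map_zero]
    have := hPQ k v₀ fun i j => by rw [hv₀]; exact one_ne_zero
    rw [hP0, MvPolynomial.eval₂_zero] at this
    simpa [hv₀] using this.symm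
  · rw [MvPolynomial.eval_map, hPQ ℂ v hv, h0, mul_zero]

section CurveMap
variable {R S : Type*} [CommRing R] [CommRing S] (φ : R →+* S)

/-- Base change of functions on the curve. -/
noncomputable def curveMap (q : R[X]) : CurveRing q →+* CurveRing (q.map φ) where
  toFun f := ⟨f.re.map φ, f.im.map φ⟩
  map_one' := by ext <;> simp [QuadraticAlgebra.re_one, QuadraticAlgebra.im_one]
  map_zero' := by ext <;> simp
  map_add' f g := by ext <;> simp
  map_mul' f g := by ext <;> simp

theorem curveMap_re (q : R[X]) (f : CurveRing q) : (curveMap φ q f).re = f.re.map φ := rfl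
theorem curveMap_im (q : R[X]) (f : CurveRing q) : (curveMap φ q f).im = f.im.map φ := rfl

theorem curveMap_curveVec (A B : Fin 4 → R[X]) (q : R[X]) (j : Fin 5) (a : Fin 2) :
    curveMap φ q (curveVec A B q j a) =
      curveVec (fun j => (A j).map φ) (fun j => (B j).map φ) (q.map φ) j a := by
  refine Fin.cases ?_ (fun j => ?_) j
  · fin_cases a
    · simp [curveVec]
    · simp only [curveVec, Fin.cons_zero]
      ext <;> simp [curveMap_re, curveMap_im]
  · simp only [curveVec, Fin.cons_succ]
    fin_cases a <;> ext <;> simp [curveMap_re, curveMap_im]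

theorem curveMap_pull (A B : Fin 4 → R[X]) (q : R[X]) (g : (Fin 5 → Fin 2) → R) :
    curveMap φ q (pull A B q g) =
      pull (fun j => (A j).map φ) (fun j => (B j).map φ) (q.map φ) (fun α => φ (g α)) := by
  have h : ∀ c, curveMap φ q (algebraMap R _ c) = algebraMap S _ (φ c) := by
    intro c
    rw [Algebra.algebraMap_eq_smul_one, Algebra.algebraMap_eq_smul_one]
    ext <;> simp [curveMap_re, curveMap_im, QuadraticAlgebra.re_one, QuadraticAlgebra.im_one,
      Polynomial.map_smul]
  simp only [pull_apply, multiEval, map_sum, map_mul, map_prod, curveMap_curveVec, h]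

theorem map_evalPt (q : R[X]) (s : R × R) (f : CurveRing q) :
    φ (evalPt q s f) = evalPt (q.map φ) (φ s.1, φ s.2) (curveMap φ q f) := by
  simp only [evalPt_apply, curveMap_re, curveMap_im, eval_map_apply, map_add, map_mul]

theorem map_derivPt (q : R[X]) (s : R × R) (f : CurveRing q) :
    φ (derivPt q s f) = derivPt (q.map φ) (φ s.1, φ s.2) (curveMap φ q f) := by
  simp only [derivPt_apply, curveMap_re, curveMap_im, derivative_map, eval_map_apply, map_add,
    map_mul, map_ofNat]

theorem map_nm (q : R[X]) (f : CurveRing q) : (nm f).map φ = nm (curveMap φ q f) := by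
  simp [nm, curveMap_re, curveMap_im]

end CurveMap

section SectionSystem
variable {R S : Type*} [CommRing R] [CommRing S]

/-- Ten coordinates of the tensor space that restrict to a basis of the sections on the curve. -/
def monos : Fin 5 ⊕ Fin 5 → Fin 5 → Fin 2 :=
  Sum.elim
    ![![0, 0, 0, 0, 0], ![0, 0, 0, 0, 1], ![0, 0, 0, 1, 0], ![0, 0, 1, 0, 0], ![0, 1, 0, 0, 0]]
    ![![1, 0, 0, 0, 0], ![0, 0, 0, 1, 1], ![0, 0, 1, 1, 0], ![0, 1, 1, 0, 0], ![1, 0, 0, 0, 1]]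

variable (A B : Fin 4 → R[X]) (q : R[X]) (p : Fin 5 → R × R)

/-- The values and derivatives at the points `p` of the coordinates `monos`. -/
noncomputable def secMat : Matrix (Fin 5 ⊕ Fin 5) (Fin 5 ⊕ Fin 5) R :=
  Matrix.of fun r c => Sum.elim
    (fun i => evalPt q (p i) (pull A B q (Pi.single (monos c) 1)))
    (fun i => derivPt q (p i) (pull A B q (Pi.single (monos c) 1))) r

/-- The prescribed values and derivatives of the section used to produce a second decomposition. -/
noncomputable def secVec (U : Fin 5 → R) : Fin 5 ⊕ Fin 5 → R :=
  Sum.elim 0 fun i => (∏ j, evalPt q (p i) (curveVec A B q j 0)) * U i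

/-- The multilinear form with coefficients `c` in the coordinates `monos`. -/
def monoSum (c : Fin 5 ⊕ Fin 5 → R) : (Fin 5 → Fin 2) → R :=
  ∑ r, c r • Pi.single (monos r) 1

/-- The norm of the section used to produce a second decomposition. -/
noncomputable def secNm (U : Fin 5 → R) : R[X] :=
  nm (pull A B q (monoSum ((secMat A B q p).adjugate.mulVec (secVec A B q p U))))

theorem map_comp_single (φ : R →+* S) (α : Fin 5 → Fin 2) :
    (fun β => φ ((Pi.single α 1 : (Fin 5 → Fin 2) → R) β)) = Pi.single α 1 := by
  funext β
  rw [Pi.single_apply, Pi.single_apply]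
  split_ifs <;> simp

theorem map_monoSum (φ : R →+* S) (c : Fin 5 ⊕ Fin 5 → R) :
    (fun β => φ (monoSum c β)) = monoSum fun r => φ (c r) := by
  funext β
  simp only [monoSum, Finset.sum_apply, Pi.smul_apply, smul_eq_mul, map_sum, map_mul]
  refine Finset.sum_congr rfl fun r _ => ?_
  rw [← map_comp_single φ]

theorem map_secMat (φ : R →+* S) : (secMat A B q p).map φ =
    secMat (fun j => (A j).map φ) (fun j => (B j).map φ) (q.map φ)
      (fun i => (φ (p i).1, φ (p i).2)) := by
  ext r c
  rcases r with i | i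
  · simp only [secMat, Matrix.map_apply, Matrix.of_apply, Sum.elim_inl, map_evalPt, curveMap_pull,
      map_comp_single]
  · simp only [secMat, Matrix.map_apply, Matrix.of_apply, Sum.elim_inr, map_derivPt, curveMap_pull,
      map_comp_single]

theorem map_secVec (φ : R →+* S) (U : Fin 5 → R) : (fun r => φ (secVec A B q p U r)) =
    secVec (fun j => (A j).map φ) (fun j => (B j).map φ) (q.map φ)
      (fun i => (φ (p i).1, φ (p i).2)) (fun i => φ (U i)) := by
  funext r
  rcases r with i | i
  · simp [secVec]
  · simp only [secVec, Sum.elim_inr, map_mul, map_prod, map_evalPt, curveMap_curveVec]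

theorem map_secNm (φ : R →+* S) (U : Fin 5 → R) : (secNm A B q p U).map φ =
    secNm (fun j => (A j).map φ) (fun j => (B j).map φ) (q.map φ)
      (fun i => (φ (p i).1, φ (p i).2)) (fun i => φ (U i)) := by
  rw [secNm, map_nm, curveMap_pull, map_monoSum, secNm]
  congr 3
  funext r
  rw [RingHom.map_mulVec, ← RingHom.mapMatrix_apply, RingHom.map_adjugate,
    RingHom.mapMatrix_apply, map_secMat, ← map_secVec]
  rfl

end SectionSystem

section Conditions

/-- The coordinate in slot `0` of the members of `v`, where `u` stands for the inverses of the
`v i j 0`. -/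
def ptX {R : Type*} [CommRing R] (v : Fin 5 → Fin 5 → Fin 2 → R) (u : Fin 5 → Fin 5 → R)
    (i : Fin 5) : R := v i 0 1 * u i 0

/-- The points of the curve corresponding to `v`, where `u` stands for the inverses of the
`v i j 0`. -/
noncomputable def pts {R : Type*} [CommRing R] (v : Fin 5 → Fin 5 → Fin 2 → R)
    (u : Fin 5 → Fin 5 → R) (i : Fin 5) : R × R :=
  (ptX v u i, 2 * (curveA (slots v) 0).eval (ptX v u i) * (v i 1 1 * u i 1) +
    (curveB (slots v) 0).eval (ptX v u i))

/-- The product of the conditions which ensure that `v` is generic, where `u` stands for the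
inverses of the `v i j 0`. -/
noncomputable def condition (R : Type) [CommRing R] (v : Fin 5 → Fin 5 → Fin 2 → R)
    (u : Fin 5 → Fin 5 → R) : R :=
  (∏ i, ∏ k ∈ Finset.univ.erase i, (ptX v u i - ptX v u k)) *
  (∏ a, ∏ b ∈ Finset.univ.erase a, ∏ c ∈ (Finset.univ.erase a).erase b,
    det5 (slots v a 0) (slots v a 1) (slots v b 0) (slots v b 1) (slots v c 0)) *
  (∏ j, (curveA (slots v) j).coeff 2) *
  (∏ i, ∏ j, (curveA (slots v) j).eval (ptX v u i)) *
  resultant (curveQ (slots v)) (derivative (curveQ (slots v))) 4 3 *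
  (secMat (curveA (slots v)) (curveB (slots v)) (curveQ (slots v)) (pts v u)).det *
  resultant (secNm (curveA (slots v)) (curveB (slots v)) (curveQ (slots v)) (pts v u)
      fun i => ∏ j, u i j)
    (derivative (secNm (curveA (slots v)) (curveB (slots v)) (curveQ (slots v)) (pts v u)
      fun i => ∏ j, u i j)) 18 17

variable {R S : Type} [CommRing R] [CommRing S]

theorem map_pts (φ : R →+* S) (v : Fin 5 → Fin 5 → Fin 2 → R) (u : Fin 5 → Fin 5 → R) (i : Fin 5) :
    (φ (pts v u i).1, φ (pts v u i).2) =
      pts (fun i j a => φ (v i j a)) (fun i j => φ (u i j)) i := by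
  have hl : (fun j α => φ ∘ slots v j α) = slots fun i j a => φ (v i j a) := by
    funext j α
    rw [map_slots]
  simp only [pts, ptX, map_add, map_mul, map_ofNat, ← eval_map_apply, (map_curve φ _ 0).1,
    (map_curve φ _ 0).2.1, hl]

theorem map_condition (φ : R →+* S) (v : Fin 5 → Fin 5 → Fin 2 → R) (u : Fin 5 → Fin 5 → R) :
    φ (condition R v u) = condition S (fun i j a => φ (v i j a)) (fun i j => φ (u i j)) := by
  have hl : (fun j α => φ ∘ slots v j α) = slots fun i j a => φ (v i j a) := by
    funext j α
    rw [map_slots]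
  have hA : ∀ j, (curveA (slots v) j).map φ = curveA (slots fun i j a => φ (v i j a)) j :=
    fun j => by rw [(map_curve φ _ j).1, hl]
  have hB : ∀ j, (curveB (slots v) j).map φ = curveB (slots fun i j a => φ (v i j a)) j :=
    fun j => by rw [(map_curve φ _ j).2.1, hl]
  have hq : (curveQ (slots v)).map φ = curveQ (slots fun i j a => φ (v i j a)) := by
    rw [map_curveQ, hl]
  have hx : ∀ i, φ (ptX v u i) = ptX (fun i j a => φ (v i j a)) (fun i j => φ (u i j)) i :=
    fun i => by simp only [ptX, map_mul]
  have hM := map_secMat (curveA (slots v)) (curveB (slots v)) (curveQ (slots v)) (pts v u) φ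
  have hN := map_secNm (curveA (slots v)) (curveB (slots v)) (curveQ (slots v)) (pts v u) φ
    fun i => ∏ j, u i j
  simp only [hA, hB, hq, map_pts, map_prod] at hM hN
  have hr : ∀ (f : R[X]) m n, φ (resultant f (derivative f) m n) =
      resultant (f.map φ) (derivative (f.map φ)) m n := fun f m n => by
    rw [derivative_map, resultant_map_map]
  have hq' := hr (curveQ (slots v)) 4 3
  rw [hq] at hq'
  have hN' := hr (secNm (curveA (slots v)) (curveB (slots v)) (curveQ (slots v)) (pts v u)
    fun i => ∏ j, u i j) 18 17
  rw [hN] at hN'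
  simp only [condition, map_mul, map_prod, map_sub, hx, map_det5, map_slots, ← coeff_map, hA,
    ← eval_map_apply, hq', hN', RingHom.map_det, RingHom.mapMatrix_apply, hM]

end Conditions

section Conditions
variable {K : Type} [Field K] {v : Fin 5 → Fin 5 → Fin 2 → K}

theorem separable_of_resultant [CharZero K] {f : K[X]} {m : ℕ} (hf : f.natDegree ≤ m + 1)
    (h : resultant f (derivative f) (m + 1) m ≠ 0) : f.natDegree = m + 1 ∧ f.Separable := by
  have hd : f.natDegree = m + 1 := by
    by_contra hne
    have h1 : f.natDegree < m + 1 := by omega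
    have h2 : (derivative f).natDegree ≤ f.natDegree - 1 := natDegree_derivative_le f
    rcases Nat.eq_zero_or_pos m with rfl | hm
    · refine h ?_
      have : derivative f = 0 := by
        rw [eq_C_of_natDegree_eq_zero (show f.natDegree = 0 by omega), derivative_C]
      rw [this, resultant_zero_right]
      simp
    · exact h (resultant_eq_zero_of_lt_lt _ _ _ _ h1 (by omega))
  refine ⟨hd, ?_⟩
  have hd' : (derivative f).natDegree = m := by
    rw [natDegree_derivative, hd, Nat.add_sub_cancel]
  rw [← hd'] at h
  nth_rewrite 1 [hd'] at h
  rw [← hd] at h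
  by_contra hs
  exact h (resultant_eq_zero_iff.2 ⟨Or.inl fun h0 => by simp [h0] at hd, hs⟩)

theorem pull_monoSum (A B : Fin 4 → K[X]) (q : K[X]) (c : Fin 5 ⊕ Fin 5 → K) :
    pull A B q (monoSum c) = ∑ r, c r • pull A B q (Pi.single (monos r) 1) := by
  rw [monoSum, map_sum]
  simp only [map_smul]

theorem secMat_mulVec (A B : Fin 4 → K[X]) (q : K[X]) (p : Fin 5 → K × K)
    (c : Fin 5 ⊕ Fin 5 → K) :
    (secMat A B q p).mulVec c = Sum.elim (fun i => evalPt q (p i) (pull A B q (monoSum c)))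
      (fun i => derivPt q (p i) (pull A B q (monoSum c))) := by
  funext r
  rw [pull_monoSum]
  rcases r with i | i
  · simp only [Matrix.mulVec, dotProduct, secMat, Matrix.of_apply, Sum.elim_inl, map_sum, map_smul,
      smul_eq_mul, mul_comm]
  · simp only [Matrix.mulVec, dotProduct, secMat, Matrix.of_apply, Sum.elim_inr, map_sum, map_smul,
      smul_eq_mul, mul_comm]

theorem spans_of_secMat {A B : Fin 4 → K[X]} {q : K[X]} {p : Fin 5 → K × K}
    (h : (secMat A B q p).det ≠ 0) : Spans A B q p := by
  intro b c
  refine ⟨monoSum ((secMat A B q p)⁻¹.mulVec (Sum.elim b c)), fun i => ?_⟩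
  have := secMat_mulVec A B q p ((secMat A B q p)⁻¹.mulVec (Sum.elim b c))
  rw [Matrix.mulVec_mulVec, Matrix.mul_nonsing_inv _ (isUnit_iff_ne_zero.2 h),
    Matrix.one_mulVec] at this
  exact ⟨(congrFun this (Sum.inl i)).symm, (congrFun this (Sum.inr i)).symm⟩

theorem generic_of_condition [CharZero K] (hv : ∀ i j, v i j 0 ≠ 0)
    (h : condition K v (fun i j => (v i j 0)⁻¹) ≠ 0) : Generic v := by
  set u : Fin 5 → Fin 5 → K := fun i j => (v i j 0)⁻¹ with hu
  have hX : ∀ i, ptX v u i = v i 0 1 / v i 0 0 := fun i => (div_eq_mul_inv _ _).symm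
  have hp : pts v u = fun i => chartPt (slots v) (v i) := by
    funext i
    rw [pts, hX, chartPt, div_eq_mul_inv (v i 1 1)]
  simp only [condition, mul_ne_zero_iff, Finset.prod_ne_zero_iff, Finset.mem_univ, true_implies,
    Finset.mem_erase, and_true] at h
  obtain ⟨⟨⟨⟨⟨⟨hinj, hspread⟩, hA⟩, hchart⟩, hq⟩, hM⟩, hN⟩ := h
  obtain ⟨hqd, hqs⟩ := separable_of_resultant (natDegree_curveQ _) hq
  have hAd : ∀ j, (curveA (slots v) j).natDegree = 2 := fun j =>
    le_antisymm (natDegree_curve _ j).1 (le_natDegree_of_ne_zero (hA j))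
  have hBd : ∀ j, (curveB (slots v) j).natDegree ≤ 2 := fun j => (natDegree_curve _ j).2.1
  have hAdm : Admissible (curveA (slots v)) (curveB (slots v)) (curveQ (slots v)) :=
    ⟨curveA_dvd _, hAd, hBd, hqd, hqs.squarefree⟩
  set c := (secMat (curveA (slots v)) (curveB (slots v)) (curveQ (slots v))
    (pts v u)).adjugate.mulVec (secVec (curveA (slots v)) (curveB (slots v)) (curveQ (slots v))
    (pts v u) fun i => ∏ j, u i j) with hc
  have hNd : (secNm (curveA (slots v)) (curveB (slots v)) (curveQ (slots v)) (pts v u)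
      fun i => ∏ j, u i j).natDegree ≤ 18 := by
    rw [secNm, nm_eq]
    exact (natDegree_mul_star hAdm _ _).1
  obtain ⟨hNd, hNs⟩ := separable_of_resultant hNd hN
  have hval := secMat_mulVec (curveA (slots v)) (curveB (slots v)) (curveQ (slots v)) (pts v u) c
  rw [hc, Matrix.mulVec_mulVec, Matrix.mul_adjugate, Matrix.smul_mulVec, Matrix.one_mulVec,
    ← hc] at hval
  refine ⟨fun a b c hab hac hbc => hspread a b (Ne.symm hab) c ⟨hbc.symm, hac.symm⟩,
    hAdm, hv, fun k => ⟨hv k 0, fun j => ?_⟩,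
    fun i k hik => ?_, hp ▸ spans_of_secMat hM, monoSum c, _, hM, hNd, hNs, fun i => ?_⟩
  · rw [← hX]
    exact hchart k j
  · by_contra hne
    refine hinj i k (Ne.symm hne) ?_
    rw [hX, hX]
    exact sub_eq_zero.2 hik
  · rw [← congrFun hp i]
    have h1 := congrFun hval (Sum.inl i)
    have h2 := congrFun hval (Sum.inr i)
    simp only [secVec, Pi.smul_apply, Sum.elim_inl, Sum.elim_inr, Pi.zero_apply, smul_eq_mul,
      mul_zero] at h1 h2
    refine ⟨h1.symm, ?_⟩
    rw [← h2]
    have h3 : (∏ j, v i j 0) * ∏ j, u i j = 1 := by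
      rw [← Finset.prod_mul_distrib]
      exact Finset.prod_eq_one fun j _ => mul_inv_cancel₀ (hv i j)
    linear_combination (secMat (curveA (slots v)) (curveB (slots v)) (curveQ (slots v))
      (pts v u)).det * (∏ j, evalPt (curveQ (slots v)) (pts v u i)
      (curveVec (curveA (slots v)) (curveB (slots v)) (curveQ (slots v)) j 0)) * h3

end Conditions

theorem exists_polynomial_generic {k : Type} [Field k] {v₀ : Fin 5 → Fin 5 → Fin 2 → k}
    (hv₀ : ∀ i j, v₀ i j 0 = 1) (h₀ : condition k v₀ (fun _ _ => 1) ≠ 0) :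
    ∃ P : MvPolynomial (Fin 5 × Fin 5 × Fin 2) ℂ, P ≠ 0 ∧ ∀ v : Fin 5 → Fin 5 → Fin 2 → ℂ,
      MvPolynomial.eval (fun p => v p.1 p.2.1 p.2.2) P ≠ 0 → Generic v := by
  obtain ⟨P, hP, h⟩ := exists_polynomial_of_natural (fun R => condition R)
    (fun R S _ _ φ v u => map_condition φ v u) hv₀ h₀
  refine ⟨(∏ i, ∏ j, MvPolynomial.X (i, j, 0)) * P, mul_ne_zero ?_ hP, fun v hv => ?_⟩
  · exact Finset.prod_ne_zero_iff.2 fun i _ => Finset.prod_ne_zero_iff.2 fun j _ =>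
      MvPolynomial.X_ne_zero _
  · simp only [map_mul, map_prod, MvPolynomial.eval_X, mul_ne_zero_iff, Finset.prod_ne_zero_iff,
      Finset.mem_univ, true_implies] at hv
    exact generic_of_condition hv.1 (h v hv.1 hv.2)

section CofactorExpansion
variable {R : Type*} [CommRing R]

theorem det_fin_four (M : Matrix (Fin 4) (Fin 4) R) :
    M.det = M 0 0 * (M.submatrix Fin.succ ![1, 2, 3]).det
      - M 0 1 * (M.submatrix Fin.succ ![0, 2, 3]).det
      + M 0 2 * (M.submatrix Fin.succ ![0, 1, 3]).det
      - M 0 3 * (M.submatrix Fin.succ ![0, 1, 2]).det := by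
  have h0 : (Fin.succAbove (0 : Fin 4) : Fin 3 → Fin 4) = ![1, 2, 3] := by decide
  have h1 : (Fin.succAbove (1 : Fin 4) : Fin 3 → Fin 4) = ![0, 2, 3] := by decide
  have h2 : (Fin.succAbove (2 : Fin 4) : Fin 3 → Fin 4) = ![0, 1, 3] := by decide
  have h3 : (Fin.succAbove (3 : Fin 4) : Fin 3 → Fin 4) = ![0, 1, 2] := by decide
  rw [Matrix.det_succ_row_zero, Fin.sum_univ_four, h0, h1, h2, h3]
  simp
  ring

theorem det_fin_five (M : Matrix (Fin 5) (Fin 5) R) :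
    M.det = M 0 0 * (M.submatrix Fin.succ ![1, 2, 3, 4]).det
      - M 0 1 * (M.submatrix Fin.succ ![0, 2, 3, 4]).det
      + M 0 2 * (M.submatrix Fin.succ ![0, 1, 3, 4]).det
      - M 0 3 * (M.submatrix Fin.succ ![0, 1, 2, 4]).det
      + M 0 4 * (M.submatrix Fin.succ ![0, 1, 2, 3]).det := by
  have h0 : (Fin.succAbove (0 : Fin 5) : Fin 4 → Fin 5) = ![1, 2, 3, 4] := by decide
  have h1 : (Fin.succAbove (1 : Fin 5) : Fin 4 → Fin 5) = ![0, 2, 3, 4] := by decide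
  have h2 : (Fin.succAbove (2 : Fin 5) : Fin 4 → Fin 5) = ![0, 1, 3, 4] := by decide
  have h3 : (Fin.succAbove (3 : Fin 5) : Fin 4 → Fin 5) = ![0, 1, 2, 4] := by decide
  have h4 : (Fin.succAbove (4 : Fin 5) : Fin 4 → Fin 5) = ![0, 1, 2, 3] := by decide
  rw [Matrix.det_succ_row_zero, Fin.sum_univ_five, h0, h1, h2, h3, h4]
  simp
  ring

/-- The `3 × 3` minor of three rows in the columns `i`, `j`, `k`. -/
def minor3 (c d e : Fin 5 → R) (i j k : Fin 5) : R :=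
  c i * (d j * e k - d k * e j) - c j * (d i * e k - d k * e i) + c k * (d i * e j - d j * e i)

/-- The `4 × 4` minor of four rows in the columns `i`, `j`, `k`, `l`. -/
def minor4 (b c d e : Fin 5 → R) (i j k l : Fin 5) : R :=
  b i * minor3 c d e j k l - b j * minor3 c d e i k l + b k * minor3 c d e i j l
    - b l * minor3 c d e i j k

/-- The `5 × 5` determinant, by cofactor expansion. -/
def expand5 (a b c d e : Fin 5 → R) : R :=
  a 0 * minor4 b c d e 1 2 3 4 - a 1 * minor4 b c d e 0 2 3 4 + a 2 * minor4 b c d e 0 1 3 4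
    - a 3 * minor4 b c d e 0 1 2 4 + a 4 * minor4 b c d e 0 1 2 3

theorem det_eq_minor4 (b c d e : Fin 5 → R) (a : Fin 5 → R) (s : Fin 4 → Fin 5) :
    ((Matrix.of (rows5 a b c d e)).submatrix Fin.succ s).det =
      minor4 b c d e (s 0) (s 1) (s 2) (s 3) := by
  rw [det_fin_four, Matrix.det_fin_three, Matrix.det_fin_three, Matrix.det_fin_three,
    Matrix.det_fin_three]
  simp only [Matrix.submatrix_apply, Matrix.of_apply]
  change b (s 0) * (c (s 1) * d (s 2) * e (s 3) - c (s 1) * d (s 3) * e (s 2) -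
    c (s 2) * d (s 1) * e (s 3) + c (s 2) * d (s 3) * e (s 1) + c (s 3) * d (s 1) * e (s 2) -
    c (s 3) * d (s 2) * e (s 1)) - b (s 1) * (c (s 0) * d (s 2) * e (s 3) -
    c (s 0) * d (s 3) * e (s 2) -
    c (s 2) * d (s 0) * e (s 3) + c (s 2) * d (s 3) * e (s 0) + c (s 3) * d (s 0) * e (s 2) -
    c (s 3) * d (s 2) * e (s 0)) + b (s 2) * (c (s 0) * d (s 1) * e (s 3) -
    c (s 0) * d (s 3) * e (s 1) -
    c (s 1) * d (s 0) * e (s 3) + c (s 1) * d (s 3) * e (s 0) + c (s 3) * d (s 0) * e (s 1) -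
    c (s 3) * d (s 1) * e (s 0)) - b (s 3) * (c (s 0) * d (s 1) * e (s 2) -
    c (s 0) * d (s 2) * e (s 1) -
    c (s 1) * d (s 0) * e (s 2) + c (s 1) * d (s 2) * e (s 0) + c (s 2) * d (s 0) * e (s 1) -
    c (s 2) * d (s 1) * e (s 0)) = _
  simp only [minor4, minor3]
  ring

theorem det5_eq_expand5 (a b c d e : Fin 5 → R) : det5 a b c d e = expand5 a b c d e := by
  rw [det5_eq_det, det_fin_five]
  simp only [det_eq_minor4]
  rfl

end CofactorExpansion

section PolynomialLists
variable {R : Type*} [CommRing R]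

/-- The polynomial with a given list of coefficients, in ascending order. -/
noncomputable def toPoly : List R → R[X]
  | [] => 0
  | a :: l => C a + X * toPoly l

/-- Addition of coefficient lists. -/
def listAdd : List R → List R → List R
  | [], m => m
  | a :: l, [] => a :: l
  | a :: l, b :: m => (a + b) :: listAdd l m

/-- Scalar multiplication of coefficient lists. -/
def listSmul (c : R) : List R → List R
  | [] => []
  | a :: l => c * a :: listSmul c l

/-- Multiplication of coefficient lists. -/
def listMul : List R → List R → List R
  | [], _ => []
  | a :: l, m => listAdd (listSmul a m) (0 :: listMul l m)

/-- Subtraction of coefficient lists. -/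
def listSub (l m : List R) : List R := listAdd l (listSmul (-1) m)

/-- Evaluation of coefficient lists. -/
def listEval (x : R) : List R → R
  | [] => 0
  | a :: l => a + x * listEval x l

/-- Derivative of coefficient lists. -/
def listDeriv : List R → List R
  | [] => []
  | _ :: l => listAdd l (0 :: listDeriv l)

theorem toPoly_add (l m : List R) : toPoly (listAdd l m) = toPoly l + toPoly m := by
  induction l generalizing m with
  | nil => simp [listAdd, toPoly]
  | cons a l ih =>
    cases m with
    | nil => simp [listAdd, toPoly]
    | cons b m =>
      rw [listAdd, toPoly, toPoly, toPoly, ih, C_add]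
      ring

theorem toPoly_smul (c : R) (l : List R) : toPoly (listSmul c l) = C c * toPoly l := by
  induction l with
  | nil => simp [listSmul, toPoly]
  | cons a l ih =>
    rw [listSmul, toPoly, toPoly, ih, C_mul]
    ring

theorem toPoly_mul (l m : List R) : toPoly (listMul l m) = toPoly l * toPoly m := by
  induction l with
  | nil => simp [listMul, toPoly]
  | cons a l ih =>
    rw [listMul, toPoly_add, toPoly_smul, toPoly, toPoly, ih, C_0]
    ring

theorem toPoly_sub (l m : List R) : toPoly (listSub l m) = toPoly l - toPoly m := by
  rw [listSub, toPoly_add, toPoly_smul, C_neg, C_1]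
  ring

theorem eval_toPoly (x : R) (l : List R) : (toPoly l).eval x = listEval x l := by
  induction l with
  | nil => simp [toPoly, listEval]
  | cons a l ih => rw [toPoly, listEval, eval_add, eval_mul, eval_C, eval_X, ih]

theorem derivative_toPoly (l : List R) : derivative (toPoly l) = toPoly (listDeriv l) := by
  induction l with
  | nil => simp [toPoly, listDeriv]
  | cons a l ih =>
    rw [toPoly, listDeriv, toPoly_add, toPoly, derivative_add, derivative_mul, derivative_C,
      derivative_X, ih, C_0]
    ring

theorem coeff_toPoly (l : List R) (n : ℕ) : (toPoly l).coeff n = l.getD n 0 := by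
  induction l generalizing n with
  | nil => simp [toPoly]
  | cons a l ih =>
    rw [toPoly]
    cases n with
    | zero => simp
    | succ n => simp [coeff_X_mul, coeff_C_succ, ih]

theorem natDegree_toPoly (l : List R) {n : ℕ} (hl : l.length ≤ n + 1) (hn : l.getD n 0 ≠ 0) :
    (toPoly l).natDegree = n := by
  refine le_antisymm (natDegree_le_iff_coeff_eq_zero.2 fun m hm => ?_)
    (le_natDegree_of_ne_zero (by rwa [coeff_toPoly]))
  rw [coeff_toPoly, List.getD_eq_default]
  omega

/-- Coefficient lists which agree up to trailing zeros. -/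
def ListEq (l m : List R) : Prop := ∀ a ∈ listSub l m, a = 0

instance [DecidableEq R] (l m : List R) : Decidable (ListEq l m) :=
  inferInstanceAs (Decidable (∀ a ∈ listSub l m, a = 0))

theorem toPoly_eq_zero {l : List R} (h : ∀ a ∈ l, a = 0) : toPoly l = 0 := by
  induction l with
  | nil => rfl
  | cons a l ih =>
    rw [toPoly, ih fun b hb => h b (List.mem_cons_of_mem _ hb), h a List.mem_cons_self]
    simp

theorem ListEq.toPoly_eq {l m : List R} (h : ListEq l m) : toPoly l = toPoly m := by
  rw [← sub_eq_zero, ← toPoly_sub, toPoly_eq_zero h]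

end PolynomialLists

section CurveLists
variable {R : Type*} [CommRing R]

/-- The function on the curve given by a pair of coefficient lists. -/
noncomputable def toCurve (q : R[X]) (f : List R × List R) : CurveRing q := ⟨toPoly f.1, toPoly f.2⟩

/-- Multiplication of functions on the curve. -/
def curveMul (q : List R) (f g : List R × List R) : List R × List R :=
  (listAdd (listMul f.1 g.1) (listMul q (listMul f.2 g.2)),
    listAdd (listMul f.1 g.2) (listMul f.2 g.1))

theorem toCurve_mul (q : List R) (f g : List R × List R) :
    toCurve (toPoly q) (curveMul q f g) = toCurve (toPoly q) f * toCurve (toPoly q) g := by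
  ext1
  · simp only [toCurve, curveMul, toPoly_add, toPoly_mul, QuadraticAlgebra.re_mul]
    ring
  · simp only [toCurve, curveMul, toPoly_add, toPoly_mul, QuadraticAlgebra.im_mul, zero_mul,
      add_zero]

/-- The list version of `curveVec`. -/
def listVec (A B : Fin 4 → List R) : Fin 5 → Fin 2 → List R × List R :=
  Fin.cons ![([1], []), ([0, 1], [])] fun j => ![(listSmul 2 (A j), []), (listSmul (-1) (B j), [1])]

theorem toCurve_listVec (A B : Fin 4 → List R) (q : R[X]) (j : Fin 5) (a : Fin 2) :
    toCurve q (listVec A B j a) =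
      curveVec (fun j => toPoly (A j)) (fun j => toPoly (B j)) q j a := by
  refine Fin.cases ?_ (fun j => ?_) j
  · fin_cases a <;> ext <;>
      simp [toCurve, listVec, curveVec, toPoly, QuadraticAlgebra.re_one, QuadraticAlgebra.im_one]
  · fin_cases a <;> ext <;>
      simp [toCurve, listVec, curveVec, toPoly, toPoly_smul]

/-- The list version of the coordinate functions on the curve. -/
def listMono (A B : Fin 4 → List R) (q : List R) (α : Fin 5 → Fin 2) : List R × List R :=
  curveMul q (listVec A B 0 (α 0)) (curveMul q (listVec A B 1 (α 1)) (curveMul q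
    (listVec A B 2 (α 2)) (curveMul q (listVec A B 3 (α 3)) (listVec A B 4 (α 4)))))

theorem pull_single (A B : Fin 4 → R[X]) (q : R[X]) (α : Fin 5 → Fin 2) :
    pull A B q (Pi.single α 1) = ∏ j, curveVec A B q j (α j) := by
  rw [pull_apply, multiEval, Finset.sum_eq_single α]
  · simp
  · intro β _ hβ
    rw [Pi.single_eq_of_ne hβ, map_zero, zero_mul]
  · simp

theorem toCurve_listMono (A B : Fin 4 → List R) (q : List R) (α : Fin 5 → Fin 2) :
    toCurve (toPoly q) (listMono A B q α) =
      pull (fun j => toPoly (A j)) (fun j => toPoly (B j)) (toPoly q) (Pi.single α 1) := by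
  simp only [pull_single, listMono, toCurve_mul, toCurve_listVec, Fin.prod_univ_five, mul_assoc]

/-- The list version of `evalPt`. -/
def listEvalPt (s : R × R) (f : List R × List R) : R := listEval s.1 f.1 + listEval s.1 f.2 * s.2

/-- The list version of `derivPt`. -/
def listDerivPt (q : List R) (s : R × R) (f : List R × List R) : R :=
  2 * s.2 * (listEval s.1 (listDeriv f.1) + listEval s.1 (listDeriv f.2) * s.2)
    + listEval s.1 (listDeriv q) * listEval s.1 f.2

theorem evalPt_toCurve (q : R[X]) (s : R × R) (f : List R × List R) :
    evalPt q s (toCurve q f) = listEvalPt s f := by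
  simp only [evalPt_apply, toCurve, eval_toPoly, listEvalPt]

theorem derivPt_toCurve (q : List R) (s : R × R) (f : List R × List R) :
    derivPt (toPoly q) s (toCurve (toPoly q) f) = listDerivPt q s f := by
  simp only [derivPt_apply, toCurve, derivative_toPoly, eval_toPoly, listDerivPt]

/-- The list version of `nm`. -/
def listNm (q : List R) (f : List R × List R) : List R :=
  listSub (listMul f.1 f.1) (listMul (listMul f.2 f.2) q)

theorem nm_toCurve (q : List R) (f : List R × List R) :
    nm (toCurve (toPoly q) f) = toPoly (listNm q f) := by
  simp only [nm, toCurve, listNm, toPoly_sub, toPoly_mul, sq]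

/-- The list version of `slotPoly`. -/
def listSlot (l : Fin 5 → Fin 2 → Fin 5 → R) (b c : Fin 5) (α β : Fin 2) : List R :=
  [expand5 (l 0 0) (l 1 α) (l b β) (l c 0) (l c 1),
    expand5 (l 0 1) (l 1 α) (l b β) (l c 0) (l c 1)]

theorem slotPoly_eq_toPoly (l : Fin 5 → Fin 2 → Fin 5 → R) (b c : Fin 5) (α β : Fin 2) :
    slotPoly l b c α β = toPoly (listSlot l b c α β) := by
  rw [slotPoly, slotForm, slotForm, det5_eq_expand5, det5_eq_expand5]
  rw [listSlot, toPoly, toPoly, toPoly]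
  ring

/-- The list version of `pencilA`. -/
def listPencilA (f g : Fin 2 → Fin 2 → List R) : List R :=
  listSub (listMul (f 1 0) (g 1 1)) (listMul (f 1 1) (g 1 0))

/-- The list version of `pencilB`. -/
def listPencilB (f g : Fin 2 → Fin 2 → List R) : List R :=
  listAdd (listSub (listMul (f 0 0) (g 1 1)) (listMul (f 0 1) (g 1 0)))
    (listSub (listMul (f 1 0) (g 0 1)) (listMul (f 1 1) (g 0 0)))

/-- The list version of `pencilC`. -/
def listPencilC (f g : Fin 2 → Fin 2 → List R) : List R :=
  listSub (listMul (f 0 0) (g 0 1)) (listMul (f 0 1) (g 0 0))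

/-- The list version of `curveA`. -/
def listA (l : Fin 5 → Fin 2 → Fin 5 → R) : Fin 4 → List R :=
  ![listPencilA (listSlot l 2 3) (listSlot l 2 4),
    listSmul (-1) (listPencilA (fun β α => listSlot l 2 3 α β) (fun β α => listSlot l 2 4 α β)),
    listSmul (-1) (listPencilA (fun β α => listSlot l 3 4 α β) (fun β α => listSlot l 3 2 α β)),
    listSmul (-1) (listPencilA (fun β α => listSlot l 4 2 α β) (fun β α => listSlot l 4 3 α β))]

/-- The list version of `curveB`. -/
def listB (l : Fin 5 → Fin 2 → Fin 5 → R) : Fin 4 → List R :=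
  ![listPencilB (listSlot l 2 3) (listSlot l 2 4),
    listSmul (-1) (listPencilB (fun β α => listSlot l 2 3 α β) (fun β α => listSlot l 2 4 α β)),
    listSmul (-1) (listPencilB (fun β α => listSlot l 3 4 α β) (fun β α => listSlot l 3 2 α β)),
    listSmul (-1) (listPencilB (fun β α => listSlot l 4 2 α β) (fun β α => listSlot l 4 3 α β))]

/-- The list version of `curveQ`. -/
def listQ (l : Fin 5 → Fin 2 → Fin 5 → R) : List R :=
  listSub (listMul (listB l 0) (listB l 0))
    (listMul (listSmul 4 (listA l 0)) (listPencilC (listSlot l 2 3) (listSlot l 2 4)))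

theorem curveA_eq_toPoly (l : Fin 5 → Fin 2 → Fin 5 → R) (j : Fin 4) :
    curveA l j = toPoly (listA l j) := by
  fin_cases j <;>
    simp [curveA, listA, pencilA, listPencilA, toPoly_smul, toPoly_sub, toPoly_mul,
      slotPoly_eq_toPoly]

theorem curveB_eq_toPoly (l : Fin 5 → Fin 2 → Fin 5 → R) (j : Fin 4) :
    curveB l j = toPoly (listB l j) := by
  fin_cases j <;>
    simp [curveB, listB, pencilB, listPencilB, toPoly_smul, toPoly_sub, toPoly_mul, toPoly_add,
      slotPoly_eq_toPoly]

theorem curveQ_eq_toPoly (l : Fin 5 → Fin 2 → Fin 5 → R) : curveQ l = toPoly (listQ l) := by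
  rw [curveQ, listQ, toPoly_sub, toPoly_mul, toPoly_mul, toPoly_smul, curveA_eq_toPoly,
    curveB_eq_toPoly, sq, C_ofNat]
  simp [curveC, pencilC, listPencilC, toPoly_sub, toPoly_mul, slotPoly_eq_toPoly]

end CurveLists

/-- The point at which the genericity condition is checked to be nonzero. -/
def witness : Fin 5 → Fin 5 → Fin 2 → ZMod 101 :=
  let a : Fin 5 → Fin 5 → ZMod 101 :=
    ![![7, 11, 10, 46, 21],
      ![94, 85, 39, 32, 77],
      ![27, 77, 4, 74, 87],
      ![20, 55, 81, 50, 92],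
      ![65, 47, 69, 56, 64]]
  fun i j => ![1, a i j]

/-- The slots of the witness. -/
def witnessSlots : Fin 5 → Fin 2 → Fin 5 → ZMod 101 :=
  ![![![94, 42, 4, 55, 94], ![98, 77, 86, 38, 1]],
    ![![59, 33, 98, 81, 96], ![89, 14, 37, 52, 28]],
    ![![49, 79, 59, 68, 29], ![11, 56, 85, 40, 88]],
    ![![71, 55, 78, 86, 34], ![33, 17, 51, 67, 30]],
    ![![58, 66, 79, 10, 52], ![78, 48, 78, 3, 36]]]

/-- The leading coefficients of the curve of the witness. -/
def witnessA : Fin 4 → List (ZMod 101) :=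
  ![[67, 16, 61], [54, 44, 35], [59, 32, 32], [65, 39, 91]]

/-- The middle coefficients of the curve of the witness. -/
def witnessB : Fin 4 → List (ZMod 101) :=
  ![[35, 5, 55], [40, 47, 34], [79, 90, 77], [11, 32, 46]]

/-- The discriminant of the curve of the witness. -/
def witnessQ : List (ZMod 101) :=
  [63, 77, 39, 24, 80]

/-- The marked points on the curve of the witness. -/
def witnessPts : Fin 5 → ZMod 101 × ZMod 101 :=
  ![(7, 44), (94, 94), (27, 74), (20, 91), (65, 46)]

/-- The coordinate functions on the curve of the witness. -/
def witnessMono : Fin 5 ⊕ Fin 5 → List (ZMod 101) × List (ZMod 101) :=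
  Sum.elim
    ![([56, 0, 63, 42, 96, 1, 38, 83, 30], []),
      ([31, 22, 48, 27, 39, 2, 0, 3, 69], [89, 88, 1, 49, 15, 91, 49]),
      ([19, 36, 7, 58, 61, 49, 98, 85, 87], [33, 54, 98, 60, 100, 75, 92]),
      ([84, 83, 24, 81, 58, 45, 11, 77, 72], [8, 87, 4, 38, 1, 26, 87]),
      ([11, 39, 46, 54, 100, 83, 38, 23, 8], [17, 8, 17, 96, 0, 43, 88])]
    ![([0, 56, 0, 63, 42, 96, 1, 38, 83, 30], []),
      ([61, 55, 76, 70, 100, 62, 0, 28, 24], [16, 65, 60, 52, 55, 91, 81]),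
      ([73, 2, 69, 43, 2, 20, 88, 59, 60], [45, 78, 27, 93, 5, 90, 59]),
      ([18, 39, 54, 14, 4, 36, 79, 32, 13], [92, 31, 65, 98, 60, 4, 93]),
      ([0, 31, 22, 48, 27, 39, 2, 0, 3, 69], [0, 89, 88, 1, 49, 15, 91, 49])]

/-- The values and derivatives of the coordinate functions at the marked points. -/
def witnessMat : Matrix (Fin 5 ⊕ Fin 5) (Fin 5 ⊕ Fin 5) (ZMod 101) :=
  Matrix.fromBlocks
    !![37, 70, 86, 67, 3;
      37, 21, 73, 29, 14;
      98, 42, 81, 89, 72;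
      25, 78, 38, 5, 62;
      87, 13, 24, 44, 49]
    !![57, 89, 52, 30, 86;
      44, 66, 19, 41, 55;
      20, 78, 21, 86, 23;
      96, 62, 48, 73, 45;
      100, 21, 40, 48, 37]
    !![69, 21, 61, 97, 9;
      89, 29, 82, 100, 19;
      65, 30, 26, 30, 31;
      45, 16, 42, 63, 34;
      96, 7, 85, 89, 78]
    !![2, 31, 97, 31, 45;
      71, 46, 63, 36, 8;
      99, 11, 52, 89, 57;
      97, 68, 42, 68, 73;
      3, 17, 71, 25, 35]

/-- The inverse of `witnessMat`. -/
def witnessInv : Matrix (Fin 5 ⊕ Fin 5) (Fin 5 ⊕ Fin 5) (ZMod 101) :=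
  Matrix.fromBlocks
    !![19, 2, 84, 52, 54;
      33, 2, 69, 7, 5;
      71, 44, 8, 83, 33;
      24, 11, 38, 93, 13;
      65, 47, 73, 55, 7]
    !![48, 68, 17, 84, 94;
      8, 67, 29, 6, 94;
      63, 78, 9, 67, 46;
      30, 97, 79, 44, 47;
      46, 40, 35, 44, 87]
    !![43, 23, 8, 100, 38;
      99, 17, 30, 0, 10;
      10, 19, 11, 25, 58;
      77, 45, 42, 71, 94;
      65, 43, 53, 2, 89]
    !![100, 31, 38, 41, 36;
      82, 0, 100, 39, 60;
      3, 17, 46, 6, 96;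
      34, 97, 72, 15, 75;
      16, 63, 88, 17, 97]

/-- The prescribed values for the section. -/
def witnessVec : Fin 5 ⊕ Fin 5 → ZMod 101 :=
  Sum.elim ![0, 0, 0, 0, 0] ![37, 37, 98, 25, 87]

/-- The coordinates of the section. -/
def witnessCoeff : Fin 5 ⊕ Fin 5 → ZMod 101 :=
  Sum.elim ![76, 7, 60, 56, 30] ![2, 41, 14, 17, 9]

/-- The section. -/
def witnessSec : List (ZMod 101) × List (ZMod 101) :=
  ([33, 56, 33, 14, 83, 99, 90, 37, 50, 75], [48, 14, 44, 21, 49, 48, 25, 37])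

/-- The norm of the section. -/
def witnessNm : List (ZMod 101) :=
  [64, 75, 29, 61, 75, 59, 99, 15, 36, 67, 82, 86, 64, 39, 11, 63, 97, 61, 34]

instance : Fact (Nat.Prime 101) := ⟨by norm_num⟩

theorem slots_witness : slots witness = witnessSlots := by
  have h : ∀ j α k, slots witness j α k = witnessSlots j α k := by decide +kernel
  funext j α k
  exact h j α k

theorem listA_witness (j : Fin 4) : ListEq (listA witnessSlots j) (witnessA j) := by
  revert j
  decide +kernel

theorem listB_witness (j : Fin 4) : ListEq (listB witnessSlots j) (witnessB j) := by
  revert j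
  decide +kernel

theorem curveA_witness : curveA (slots witness) = fun j => toPoly (witnessA j) := by
  funext j
  rw [slots_witness, curveA_eq_toPoly, (listA_witness j).toPoly_eq]

theorem curveB_witness : curveB (slots witness) = fun j => toPoly (witnessB j) := by
  funext j
  rw [slots_witness, curveB_eq_toPoly, (listB_witness j).toPoly_eq]

theorem curveQ_witness : curveQ (slots witness) = toPoly witnessQ := by
  rw [slots_witness, curveQ_eq_toPoly]
  apply ListEq.toPoly_eq
  decide +kernel

theorem spread_witness (a b c : Fin 5) (hab : b ≠ a) (hcb : c ≠ b) (hca : c ≠ a) :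
    expand5 (witnessSlots a 0) (witnessSlots a 1) (witnessSlots b 0) (witnessSlots b 1)
      (witnessSlots c 0) ≠ 0 := by
  revert a b c
  decide +kernel

theorem listMono_witness (r : Fin 5 ⊕ Fin 5) :
    ListEq (listMono witnessA witnessB witnessQ (monos r)).1 (witnessMono r).1 ∧
      ListEq (listMono witnessA witnessB witnessQ (monos r)).2 (witnessMono r).2 := by
  revert r
  decide +kernel

theorem witnessMat_eq (i : Fin 5) (r : Fin 5 ⊕ Fin 5) :
    listEvalPt (witnessPts i) (witnessMono r) = witnessMat (Sum.inl i) r ∧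
      listDerivPt witnessQ (witnessPts i) (witnessMono r) = witnessMat (Sum.inr i) r := by
  revert i r
  decide +kernel

theorem witnessMat_mul_inv : witnessMat * witnessInv = 1 := by
  have h : ∀ i j, (witnessMat * witnessInv) i j = if i = j then 1 else 0 := by decide +kernel
  ext i j
  rw [h, Matrix.one_apply]

theorem witnessInv_mulVec : witnessInv.mulVec witnessVec = witnessCoeff := by
  have h : ∀ i, witnessInv.mulVec witnessVec i = witnessCoeff i := by decide +kernel
  funext i
  exact h i

theorem pts_witness : pts witness (fun _ _ => 1) = witnessPts := by
  have h : ∀ i, (ptX witness (fun _ _ => 1) i,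
      2 * listEval (ptX witness (fun _ _ => 1) i) (witnessA 0) * (witness i 1 1 * 1) +
        listEval (ptX witness (fun _ _ => 1) i) (witnessB 0)) = witnessPts i := by decide +kernel
  funext i
  rw [← h, pts, curveA_witness, curveB_witness, eval_toPoly, eval_toPoly]

theorem pull_witness (r : Fin 5 ⊕ Fin 5) :
    pull (fun j => toPoly (witnessA j)) (fun j => toPoly (witnessB j)) (toPoly witnessQ)
      (Pi.single (monos r) 1) = toCurve (toPoly witnessQ) (witnessMono r) := by
  rw [← toCurve_listMono, toCurve, toCurve, (listMono_witness r).1.toPoly_eq,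
    (listMono_witness r).2.toPoly_eq]

theorem secMat_witness :
    secMat (fun j => toPoly (witnessA j)) (fun j => toPoly (witnessB j)) (toPoly witnessQ)
      witnessPts = witnessMat := by
  ext r c
  rcases r with i | i
  · simp only [secMat, Matrix.of_apply, Sum.elim_inl, pull_witness, evalPt_toCurve, witnessMat_eq]
  · simp only [secMat, Matrix.of_apply, Sum.elim_inr, pull_witness, derivPt_toCurve, witnessMat_eq]

theorem secVec_witness :
    secVec (fun j => toPoly (witnessA j)) (fun j => toPoly (witnessB j)) (toPoly witnessQ)
      witnessPts (fun _ => 1) = witnessVec := by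
  have h : ∀ i, (∏ j, listEvalPt (witnessPts i) (listVec witnessA witnessB j 0)) * 1 =
      witnessVec (Sum.inr i) := by decide +kernel
  funext r
  rcases r with i | i
  · revert i
    simp only [secVec, Sum.elim_inl]
    decide +kernel
  · simp only [secVec, Sum.elim_inr, ← toCurve_listVec, evalPt_toCurve, h]

theorem det_witnessMat_ne_zero : witnessMat.det ≠ 0 := by
  intro h
  have h1 := congrArg Matrix.det witnessMat_mul_inv
  rw [Matrix.det_mul, h, zero_mul, Matrix.det_one] at h1
  exact zero_ne_one h1

theorem adjugate_witnessMat : witnessMat.adjugate = witnessMat.det • witnessInv := by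
  calc witnessMat.adjugate = witnessMat.adjugate * (witnessMat * witnessInv) := by
        rw [witnessMat_mul_inv, mul_one]
    _ = witnessMat.det • witnessInv := by
        rw [← mul_assoc, Matrix.adjugate_mul, Matrix.smul_mul, one_mul]

theorem pull_monoSum_witness :
    pull (fun j => toPoly (witnessA j)) (fun j => toPoly (witnessB j)) (toPoly witnessQ)
      (monoSum witnessCoeff) = toCurve (toPoly witnessQ) witnessSec := by
  simp only [pull_monoSum, pull_witness, Fintype.sum_sum_type, Fin.sum_univ_five]
  ext1
  · simp only [toCurve, QuadraticAlgebra.re_add, QuadraticAlgebra.re_smul, smul_eq_C_mul,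
      ← toPoly_smul, ← toPoly_add]
    apply ListEq.toPoly_eq
    decide +kernel
  · simp only [toCurve, QuadraticAlgebra.im_add, QuadraticAlgebra.im_smul, smul_eq_C_mul,
      ← toPoly_smul, ← toPoly_add]
    apply ListEq.toPoly_eq
    decide +kernel

theorem nm_smul {R : Type*} [CommRing R] {q : R[X]} (d : R) (f : CurveRing q) :
    nm (d • f) = C (d ^ 2) * nm f := by
  simp only [nm, QuadraticAlgebra.re_smul, QuadraticAlgebra.im_smul, smul_eq_C_mul, C_pow]
  ring

theorem secNm_witness :
    secNm (fun j => toPoly (witnessA j)) (fun j => toPoly (witnessB j)) (toPoly witnessQ)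
      witnessPts (fun _ => 1) = C (witnessMat.det ^ 2) * toPoly witnessNm := by
  have h : monoSum (witnessMat.det • witnessCoeff) = witnessMat.det • monoSum witnessCoeff := by
    simp only [monoSum, Pi.smul_apply, smul_eq_mul, mul_smul, Finset.smul_sum]
  rw [secNm, secMat_witness, secVec_witness, adjugate_witnessMat, Matrix.smul_mulVec,
    witnessInv_mulVec, h, map_smul, pull_monoSum_witness, nm_smul, nm_toCurve,
    ListEq.toPoly_eq (show ListEq (listNm witnessQ witnessSec) witnessNm by decide +kernel)]

theorem isCoprime_of_listEq {R : Type*} [CommRing R] {l s t : List R}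
    (h : ListEq (listAdd (listMul s l) (listMul t (listDeriv l))) [1]) :
    IsCoprime (toPoly l) (derivative (toPoly l)) := by
  refine ⟨toPoly s, toPoly t, ?_⟩
  rw [derivative_toPoly, ← toPoly_mul, ← toPoly_mul, ← toPoly_add, h.toPoly_eq]
  simp [toPoly]

theorem resultant_ne_zero_of_listEq {K : Type*} [Field K] {l s t : List K} {n : ℕ}
    (h : ListEq (listAdd (listMul s l) (listMul t (listDeriv l))) [1])
    (hl : l.length ≤ n + 2) (hm : l.getD (n + 1) 0 ≠ 0) (hn : (listDeriv l).getD n 0 ≠ 0) {d : K}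
    (hd : d ≠ 0) :
    resultant (C d * toPoly l) (derivative (C d * toPoly l)) (n + 1) n ≠ 0 := by
  have hu : IsUnit (C d) := isUnit_C.2 hd.isUnit
  have hc : IsCoprime (C d * toPoly l) (derivative (C d * toPoly l)) := by
    rw [derivative_C_mul, isCoprime_mul_unit_left hu]
    exact isCoprime_of_listEq h
  have h1 : (C d * toPoly l).natDegree = n + 1 := by
    rw [natDegree_C_mul hd, natDegree_toPoly l hl hm]
  have h2 : (derivative (C d * toPoly l)).natDegree = n := by
    refine le_antisymm ((natDegree_derivative_le _).trans (by rw [h1, Nat.add_sub_cancel]))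
      (le_natDegree_of_ne_zero ?_)
    rw [derivative_C_mul, coeff_C_mul, derivative_toPoly, coeff_toPoly]
    exact mul_ne_zero hd hn
  have := resultant_ne_zero _ _ hc
  rwa [h1, h2] at this

theorem condition_witness : condition (ZMod 101) witness (fun _ _ => 1) ≠ 0 := by
  rw [condition, pts_witness, curveA_witness, curveB_witness, curveQ_witness, slots_witness]
  have hU : (fun _ : Fin 5 => ∏ _j : Fin 5, (1 : ZMod 101)) = fun _ => 1 :=
    funext fun _ => Finset.prod_const_one
  rw [hU, secNm_witness, secMat_witness]
  simp only [coeff_toPoly, eval_toPoly, det5_eq_expand5]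
  refine mul_ne_zero (mul_ne_zero (mul_ne_zero (mul_ne_zero (mul_ne_zero (mul_ne_zero
    ?_ ?_) ?_) ?_) ?_) det_witnessMat_ne_zero) ?_
  · decide +kernel
  · refine Finset.prod_ne_zero_iff.2 fun a _ => Finset.prod_ne_zero_iff.2 fun b hb =>
      Finset.prod_ne_zero_iff.2 fun c hc => ?_
    simp only [Finset.mem_erase] at hb hc
    exact spread_witness a b c hb.1 hc.1 hc.2.1
  · decide +kernel
  · decide +kernel
  · have h := resultant_ne_zero_of_listEq (l := witnessQ) (n := 3)
      (s := [93, 57, 52]) (t := [0, 44, 58, 88]) (by decide +kernel) (by decide) (by decide +kernel)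
      (by decide +kernel) one_ne_zero
    rwa [C_1, one_mul] at h
  · exact resultant_ne_zero_of_listEq (l := witnessNm) (n := 17)
      (s := [40, 80, 53, 79, 58, 11, 92, 17, 60, 71, 40, 7, 91, 47, 66, 20, 46])
      (t := [79, 69, 32, 80, 36, 44, 53, 28, 51, 11, 37, 42, 37, 21, 68, 24, 87, 76])
      (by decide +kernel) (by decide +kernel) (by decide +kernel) (by decide +kernel)
      (pow_ne_zero 2 det_witnessMat_ne_zero)

theorem isDecomposition_pures {v w : Fin 5 → Fin 5 → Fin 2 → ℂ} (hw : ∀ k j, w k j ≠ 0)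
    (h : SameTensor v w) : IsDecomposition 5 (∑ i : Fin 5, ⨂ₜ[ℂ] j, v i j) (pures w) := by
  refine ⟨by simp [pures], fun t ht => ?_, ?_⟩
  · obtain ⟨k, rfl⟩ := mem_pures.1 ht
    exact ⟨tprod_ne_zero.2 (hw k), w k, rfl⟩
  · rw [sum_pures]
    exact ((sameTensor_iff v w).1 h).symm

theorem exists_two_decompositions {P : MvPolynomial (Fin 5 × Fin 5 × Fin 2) ℂ}
    (hP : ∀ v : Fin 5 → Fin 5 → Fin 2 → ℂ,
      MvPolynomial.eval (fun p => v p.1 p.2.1 p.2.2) P ≠ 0 → Generic v)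
    (v : Fin 5 → Fin 5 → Fin 2 → ℂ)
    (hv : MvPolynomial.eval (fun p => v p.1 p.2.1 p.2.2) P ≠ 0) :
    ∃ D₁ D₂ : Multiset (BinTensor 5), D₁ ≠ D₂ ∧
      ∀ D : Multiset (BinTensor 5),
        IsDecomposition 5 (∑ i : Fin 5, ⨂ₜ[ℂ] j, v i j) D ↔ (D = D₁ ∨ D = D₂) := by
  obtain ⟨w, hw, hvw, hne⟩ := (hP v hv).exists_other
  refine ⟨pures v, pures w, hne.symm, fun D => ⟨fun ⟨hc, hD, hs⟩ => ?_, ?_⟩⟩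
  · obtain ⟨u, rfl, hu⟩ := exists_pures hc hD
    have hvu : SameTensor v u := (sameTensor_iff v u).2 (hs.symm.trans (sum_pures u))
    rcases pures_eq_of_generic hP hv hw hu hvw hvu with h | h | h
    · exact absurd h hne
    · exact Or.inl h
    · exact Or.inr h
  · rintro (rfl | rfl)
    · exact isDecomposition_pures (hP v hv).vec_ne_zero (SameTensor.refl v)
    · exact isDecomposition_pures hw hvw

end BinarySegre

theorem segre_P1_pow5_exactly_two_decompositions :
    ∃ P : MvPolynomial (Fin 5 × Fin 5 × Fin 2) ℂ, P ≠ 0 ∧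
      ∀ v : Fin 5 → Fin 5 → Fin 2 → ℂ,
        MvPolynomial.eval (fun p => v p.1 p.2.1 p.2.2) P ≠ 0 →
        ∃ D₁ D₂ : Multiset (BinTensor 5), D₁ ≠ D₂ ∧
          ∀ D : Multiset (BinTensor 5),
            IsDecomposition 5 (∑ i : Fin 5, ⨂ₜ[ℂ] j, v i j) D ↔ (D = D₁ ∨ D = D₂) := by
  obtain ⟨P, hP, h⟩ := BinarySegre.exists_polynomial_generic (v₀ := BinarySegre.witness)
    (fun _ _ => rfl) BinarySegre.condition_witness
  exact ⟨P, hP, BinarySegre.exists_two_decompositions h⟩
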